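/- Let 2 < λ ≤ 8 (equivalently λ = 2/α with 1/4 ≤ α < 1) and let u be a solution of the mean field equation Δu = λ(1−e^u) on S². If u is even, i.e. u(−x) = u(x) for all x ∈ S², then u is axially symmetric: there exists a unit vector e ∈ ℝ³ such that u(x) = u(x') for all x, x' ∈ S² with ⟨x,e⟩ = ⟨x',e⟩. -/

import Mathlib

open Real MeasureTheory

noncomputable section

/-- Euclidean Laplacian on ℝ² via the second iterated derivative. -/
def lap (w : ℝ × ℝ → ℝ) (y : ℝ × ℝ) : ℝ :=
  iteratedFDeriv ℝ 2 w y ![(1, 0), (1, 0)] + iteratedFDeriv ℝ 2 w y ![(0, 1), (0, 1)]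

/-- The unit sphere S² ⊂ ℝ³ (vectors encoded as functions `Fin 3 → ℝ`). -/
def sphere3 : Set (Fin 3 → ℝ) := {x | x 0 ^ 2 + x 1 ^ 2 + x 2 ^ 2 = 1}

/-- Inverse stereographic projection from the north pole. -/
def stereoN (y : ℝ × ℝ) : Fin 3 → ℝ :=
  ![2 * y.1 / (1 + y.1 ^ 2 + y.2 ^ 2), 2 * y.2 / (1 + y.1 ^ 2 + y.2 ^ 2),
    (y.1 ^ 2 + y.2 ^ 2 - 1) / (1 + y.1 ^ 2 + y.2 ^ 2)]

/-- South-pole parametrization of the sphere. -/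
def stereoS (y : ℝ × ℝ) : Fin 3 → ℝ :=
  ![2 * y.1 / (1 + y.1 ^ 2 + y.2 ^ 2), 2 * y.2 / (1 + y.1 ^ 2 + y.2 ^ 2),
    (1 - y.1 ^ 2 - y.2 ^ 2) / (1 + y.1 ^ 2 + y.2 ^ 2)]

/-- `u` is a solution of the mean field equation `Δu = lam (1 - e^u)` on `S²`,
expressed in the two stereographic charts. -/
def IsMFSolution (lam : ℝ) (u : (Fin 3 → ℝ) → ℝ) : Prop :=
  ContinuousOn u sphere3 ∧
  ContDiff ℝ 2 (fun y => u (stereoN y)) ∧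
  ContDiff ℝ 2 (fun y => u (stereoS y)) ∧
  (∀ y : ℝ × ℝ, lap (fun z => u (stereoN z)) y =
    4 * lam * (1 - Real.exp (u (stereoN y))) / (1 + y.1 ^ 2 + y.2 ^ 2) ^ 2) ∧
  (∀ y : ℝ × ℝ, lap (fun z => u (stereoS z)) y =
    4 * lam * (1 - Real.exp (u (stereoS y))) / (1 + y.1 ^ 2 + y.2 ^ 2) ^ 2)

/-- `u` is axially symmetric on `S²`: constant on the level sets of `⟨·, e⟩`
for some unit vector `e`. -/
def AxiallySymmetric (u : (Fin 3 → ℝ) → ℝ) : Prop :=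
  ∃ e : Fin 3 → ℝ, e 0 ^ 2 + e 1 ^ 2 + e 2 ^ 2 = 1 ∧
    ∀ x ∈ sphere3, ∀ x' ∈ sphere3,
      x 0 * e 0 + x 1 * e 1 + x 2 * e 2 = x' 0 * e 0 + x' 1 * e 1 + x' 2 * e 2 →
      u x = u x'

/-- Surface integral over `S²`, written in the north-pole stereographic chart. -/
def sphereIntegral (f : (Fin 3 → ℝ) → ℝ) : ℝ :=
  ∫ y : ℝ × ℝ, f (stereoN y) * (4 / (1 + y.1 ^ 2 + y.2 ^ 2) ^ 2)

namespace MF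
open scoped ContDiff

theorem two_le_inf : (2 : WithTop ℕ∞) ≤ ∞ := by
  show ((2:ℕ∞) : WithTop ℕ∞) ≤ ((⊤:ℕ∞) : WithTop ℕ∞)
  exact WithTop.coe_le_coe.2 le_top

/-! ### Part A: calculus on ℝ² -/

def dx (f : ℝ × ℝ → ℝ) (y : ℝ × ℝ) : ℝ := fderiv ℝ f y (1, 0)
def dy (f : ℝ × ℝ → ℝ) (y : ℝ × ℝ) : ℝ := fderiv ℝ f y (0, 1)

theorem _root_.ContDiff.mdf {f : ℝ × ℝ → ℝ} (hf : ContDiff ℝ ∞ f) (y) : DifferentiableAt ℝ f y :=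
  (hf.differentiable (by simp)) y

theorem _root_.ContDiff.mdx {f : ℝ × ℝ → ℝ} (hf : ContDiff ℝ ∞ f) : ContDiff ℝ ∞ (dx f) := by
  have : ContDiff ℝ ∞ (fderiv ℝ f) := hf.fderiv_right (by simp)
  exact this.clm_apply contDiff_const

theorem _root_.ContDiff.mdy {f : ℝ × ℝ → ℝ} (hf : ContDiff ℝ ∞ f) : ContDiff ℝ ∞ (dy f) := by
  have : ContDiff ℝ ∞ (fderiv ℝ f) := hf.fderiv_right (by simp)
  exact this.clm_apply contDiff_const

theorem dx_add {f g : ℝ × ℝ → ℝ} (hf : ContDiff ℝ ∞ f) (hg : ContDiff ℝ ∞ g) :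
    dx (fun y => f y + g y) = fun y => dx f y + dx g y := by
  funext y; simp [dx, fderiv_fun_add (hf.mdf y) (hg.mdf y)]
theorem dy_add {f g : ℝ × ℝ → ℝ} (hf : ContDiff ℝ ∞ f) (hg : ContDiff ℝ ∞ g) :
    dy (fun y => f y + g y) = fun y => dy f y + dy g y := by
  funext y; simp [dy, fderiv_fun_add (hf.mdf y) (hg.mdf y)]
theorem dx_mul {f g : ℝ × ℝ → ℝ} (hf : ContDiff ℝ ∞ f) (hg : ContDiff ℝ ∞ g) :
    dx (fun y => f y * g y) = fun y => dx f y * g y + f y * dx g y := by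
  funext y; simp [dx, fderiv_fun_mul (hf.mdf y) (hg.mdf y)]; ring
theorem dy_mul {f g : ℝ × ℝ → ℝ} (hf : ContDiff ℝ ∞ f) (hg : ContDiff ℝ ∞ g) :
    dy (fun y => f y * g y) = fun y => dy f y * g y + f y * dy g y := by
  funext y; simp [dy, fderiv_fun_mul (hf.mdf y) (hg.mdf y)]; ring
theorem dx_cmul {f : ℝ × ℝ → ℝ} (c : ℝ) (hf : ContDiff ℝ ∞ f) :
    dx (fun y => c * f y) = fun y => c * dx f y := by
  funext y; simp [dx, fderiv_const_mul (hf.mdf y)]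
theorem dy_cmul {f : ℝ × ℝ → ℝ} (c : ℝ) (hf : ContDiff ℝ ∞ f) :
    dy (fun y => c * f y) = fun y => c * dy f y := by
  funext y; simp [dy, fderiv_const_mul (hf.mdf y)]

theorem fd2_apply {f : ℝ × ℝ → ℝ} (hf : ContDiff ℝ ∞ f) (y u v : ℝ × ℝ) :
    fderiv ℝ (fun z => fderiv ℝ f z v) y u = fderiv ℝ (fderiv ℝ f) y u v := by
  have : ContDiff ℝ ∞ (fderiv ℝ f) := hf.fderiv_right (by simp)
  rw [fderiv_clm_apply (this.differentiable (by simp) y) (differentiableAt_const v)]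
  simp

theorem fd2_symm {f : ℝ × ℝ → ℝ} (hf : ContDiff ℝ ∞ f) (y u v : ℝ × ℝ) :
    fderiv ℝ (fderiv ℝ f) y u v = fderiv ℝ (fderiv ℝ f) y v u := by
  have h := (hf.contDiffAt (x := y)).isSymmSndFDerivAt (by simpa using two_le_inf)
  exact h u v

theorem dx_dy {f : ℝ × ℝ → ℝ} (hf : ContDiff ℝ ∞ f) : dx (dy f) = dy (dx f) := by
  funext y
  change fderiv ℝ (fun z => fderiv ℝ f z (0,1)) y (1,0) =
    fderiv ℝ (fun z => fderiv ℝ f z (1,0)) y (0,1)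
  rw [fd2_apply hf, fd2_apply hf, fd2_symm hf]

theorem key_identity (ε : ℝ) (w D s m q : ℝ × ℝ → ℝ)
    (sw : ContDiff ℝ ∞ w) (sD : ContDiff ℝ ∞ D) (ss : ContDiff ℝ ∞ s) (sm : ContDiff ℝ ∞ m)
    (hDx : ∀ y, dx D y = D y * dx m y / 2 + s y * dx w y / 4)
    (hDy : ∀ y, dy D y = D y * dy m y / 2 + s y * dy w y / 4)
    (hsx : ∀ y, dx s y = s y * dx m y / 2 + ε / 4 * D y * dx w y)
    (hsy : ∀ y, dy s y = s y * dy m y / 2 + ε / 4 * D y * dy w y)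
    (hw : ∀ y, dx (dx w) y + dy (dy w) y = - (D y * s y))
    (hm : ∀ y, dx (dx m) y + dy (dy m) y = q y - (s y ^ 2 + ε * D y ^ 2) / 4)
    (T : ℝ × ℝ → ℝ) (hT : T = fun y => dx w y ^ 2 + dy w y ^ 2 + 2 * D y ^ 2) (y : ℝ × ℝ) :
    T y * (dx (dx T) y + dy (dy T) y) - (dx T y ^ 2 + dy T y ^ 2) =
      T y ^ 2 * (dx (dx m) y + dy (dy m) y) - q y * (dx w y ^ 2 + dy w y ^ 2) * T y
      + 2 * D y ^ 2 * ((dx (dx w) y - dy (dy w) y - dx m y * dx w y + dy m y * dy w y) ^ 2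
        + (2 * dx (dy w) y - dx m y * dy w y - dy m y * dx w y) ^ 2) := by
  have swx := sw.mdx
  have swy := sw.mdy
  have smx := sm.mdx
  have smy := sm.mdy
  have hT' : T = fun y => (dx w y * dx w y + dy w y * dy w y) + 2 * (D y * D y) := by
    rw [hT]; funext y; ring
  have e1 : dx T = fun y => 2 * (dx w y * dx (dx w) y + dy w y * dx (dy w) y) +
      4 * (D y * dx D y) := by
    rw [hT', dx_add (by fun_prop) (by fun_prop), dx_add (by fun_prop) (by fun_prop),
      dx_mul swx swx, dx_mul swy swy, dx_cmul _ (by fun_prop), dx_mul sD sD]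
    funext y; ring
  have e2 : dy T = fun y => 2 * (dx w y * dx (dy w) y + dy w y * dy (dy w) y) +
      4 * (D y * dy D y) := by
    rw [hT', dy_add (by fun_prop) (by fun_prop), dy_add (by fun_prop) (by fun_prop),
      dy_mul swx swx, dy_mul swy swy, dy_cmul _ (by fun_prop), dy_mul sD sD, dx_dy sw]
    funext y; ring
  have swxx := swx.mdx
  have swxy := swy.mdx
  have swyy := swy.mdy
  have sDx := sD.mdx
  have sDy := sD.mdy
  have e3 : dx (dx T) y = 2 * (dx (dx w) y ^ 2 + dx w y * dx (dx (dx w)) y + dx (dy w) y ^ 2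
      + dy w y * dx (dx (dy w)) y) + 4 * (dx D y ^ 2 + D y * dx (dx D) y) := by
    rw [e1, dx_add (by fun_prop) (by fun_prop), dx_cmul _ (by fun_prop),
      dx_add (by fun_prop) (by fun_prop), dx_mul swx swxx, dx_mul swy swxy,
      dx_cmul _ (by fun_prop), dx_mul sD sDx]
    ring
  have e4 : dy (dy T) y = 2 * (dx (dy w) y ^ 2 + dx w y * dy (dx (dy w)) y + dy (dy w) y ^ 2
      + dy w y * dy (dy (dy w)) y) + 4 * (dy D y ^ 2 + D y * dy (dy D) y) := by
    rw [e2, dy_add (by fun_prop) (by fun_prop), dy_cmul _ (by fun_prop),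
      dy_add (by fun_prop) (by fun_prop), dy_mul swx swxy, dy_mul swy swyy,
      dy_cmul _ (by fun_prop), dy_mul sD sDy, ← dx_dy sw]
    ring
  -- third derivatives
  have hwf : (fun y => dx (dx w) y + dy (dy w) y) = fun y => (-1) * (D y * s y) := by
    funext y; rw [hw y]; ring
  have t1 : dx (dx (dx w)) y + dy (dx (dy w)) y = - (dx D y * s y + D y * dx s y) := by
    have h := congrFun (congrArg dx hwf) y
    rw [dx_add swxx swyy, dx_cmul _ (by fun_prop), dx_mul sD ss] at h
    simp only at h
    rw [dx_dy swy] at h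
    linarith
  have t2 : dx (dx (dy w)) y + dy (dy (dy w)) y = - (dy D y * s y + D y * dy s y) := by
    have h := congrFun (congrArg dy hwf) y
    rw [dy_add swxx swyy, dy_cmul _ (by fun_prop), dy_mul sD ss] at h
    simp only at h
    rw [← dx_dy swx, ← dx_dy sw] at h
    linarith
  have hDxf : dx D = fun y => (1/2) * (D y * dx m y) + (1/4) * (s y * dx w y) := by
    funext y; rw [hDx y]; ring
  have hDyf : dy D = fun y => (1/2) * (D y * dy m y) + (1/4) * (s y * dy w y) := by
    funext y; rw [hDy y]; ring
  have d1 : dx (dx D) y = (1/2) * (dx D y * dx m y + D y * dx (dx m) y) +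
      (1/4) * (dx s y * dx w y + s y * dx (dx w) y) := by
    conv_lhs => rw [hDxf]
    rw [dx_add (by fun_prop) (by fun_prop), dx_cmul _ (by fun_prop), dx_cmul _ (by fun_prop),
      dx_mul sD smx, dx_mul ss swx]
  have d2 : dy (dy D) y = (1/2) * (dy D y * dy m y + D y * dy (dy m) y) +
      (1/4) * (dy s y * dy w y + s y * dy (dy w) y) := by
    conv_lhs => rw [hDyf]
    rw [dy_add (by fun_prop) (by fun_prop), dy_cmul _ (by fun_prop), dy_cmul _ (by fun_prop),
      dy_mul sD smy, dy_mul ss swy]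
  have hTy : T y = dx w y ^ 2 + dy w y ^ 2 + 2 * D y ^ 2 := by rw [hT]
  have e1y := congrFun e1 y
  have e2y := congrFun e2 y
  rw [e3, e4, e1y, e2y, hTy, d1, d2]
  have T1 : dx (dx (dx w)) y = - (dx D y * s y + D y * dx s y) - dy (dx (dy w)) y := by linarith
  have T2 : dx (dx (dy w)) y = - (dy D y * s y + D y * dy s y) - dy (dy (dy w)) y := by linarith
  rw [T1, T2, hDx, hDy, hsx, hsy]
  have W : dy (dy w) y = - (D y * s y) - dx (dx w) y := by linarith [hw y]
  have Mq : q y = dx (dx m) y + dy (dy m) y + (s y ^ 2 + ε * D y ^ 2) / 4 := by linarith [hm y]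
  rw [W, Mq]
  ring

end MF

namespace MF
open scoped ContDiff Topology
open Filter

/-! ### Second derivatives at a point -/
section D2sec
variable {V W X : Type*} [NormedAddCommGroup V] [NormedSpace ℝ V]
  [NormedAddCommGroup W] [NormedSpace ℝ W] [NormedAddCommGroup X] [NormedSpace ℝ X]

/-- The second derivative. -/
def D2 (f : V → W) (x u v : V) : W := fderiv ℝ (fderiv ℝ f) x u v

theorem C2.df {f : V → W} {x : V} (hf : ContDiffAt ℝ 2 f x) : DifferentiableAt ℝ f x :=
  hf.differentiableAt (by simp)

theorem C2.ev {f : V → W} {x : V} (hf : ContDiffAt ℝ 2 f x) :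
    ∀ᶠ z in 𝓝 x, DifferentiableAt ℝ f z := by
  have := hf.eventually (by simp)
  filter_upwards [this] with z hz using C2.df hz

theorem C2.d2f {f : V → W} {x : V} (hf : ContDiffAt ℝ 2 f x) :
    DifferentiableAt ℝ (fderiv ℝ f) x :=
  (hf.fderiv_right (m := 1) (by norm_num)).differentiableAt (by simp)

theorem D2_congr {f g : V → W} {x : V} (h : f =ᶠ[𝓝 x] g) (u v : V) : D2 f x u v = D2 g x u v := by
  unfold D2; rw [(h.fderiv).fderiv_eq]

theorem D2_eq {f : V → W} {x : V} {f' : V → V →L[ℝ] W} {f'' : V →L[ℝ] V →L[ℝ] W}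
    (h1 : ∀ᶠ z in 𝓝 x, HasFDerivAt f (f' z) z) (h2 : HasFDerivAt f' f'' x) (u v : V) :
    D2 f x u v = f'' u v := by
  have : fderiv ℝ f =ᶠ[𝓝 x] f' := by
    filter_upwards [h1] with z hz using hz.fderiv
  unfold D2; rw [this.fderiv_eq, h2.fderiv]

theorem D2_symm {f : V → W} {x : V} (hf : ContDiffAt ℝ 2 f x) (u v : V) :
    D2 f x u v = D2 f x v u :=
  hf.isSymmSndFDerivAt (by simp) u v

theorem D2_add {f g : V → W} {x : V} (hf : ContDiffAt ℝ 2 f x) (hg : ContDiffAt ℝ 2 g x) (u v : V) :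
    D2 (fun z => f z + g z) x u v = D2 f x u v + D2 g x u v := by
  rw [D2_eq (f' := fun z => fderiv ℝ f z + fderiv ℝ g z) ?_
    ((C2.d2f hf).hasFDerivAt.add (C2.d2f hg).hasFDerivAt)]
  · rfl
  · filter_upwards [C2.ev hf, C2.ev hg] with z h1 h2 using h1.hasFDerivAt.add h2.hasFDerivAt

theorem D2_sub {f g : V → W} {x : V} (hf : ContDiffAt ℝ 2 f x) (hg : ContDiffAt ℝ 2 g x) (u v : V) :
    D2 (fun z => f z - g z) x u v = D2 f x u v - D2 g x u v := by
  rw [D2_eq (f' := fun z => fderiv ℝ f z - fderiv ℝ g z) ?_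
    ((C2.d2f hf).hasFDerivAt.sub (C2.d2f hg).hasFDerivAt)]
  · rfl
  · filter_upwards [C2.ev hf, C2.ev hg] with z h1 h2 using h1.hasFDerivAt.sub h2.hasFDerivAt

theorem D2_cmul {f : V → W} {x : V} (c : ℝ) (hf : ContDiffAt ℝ 2 f x) (u v : V) :
    D2 (fun z => c • f z) x u v = c • D2 f x u v := by
  rw [D2_eq (f' := fun z => c • fderiv ℝ f z) ?_
    ((C2.d2f hf).hasFDerivAt.const_smul c)]
  · rfl
  · filter_upwards [C2.ev hf] with z h1 using h1.hasFDerivAt.const_smul c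

theorem D2_mul {f g : V → ℝ} {x : V} (hf : ContDiffAt ℝ 2 f x) (hg : ContDiffAt ℝ 2 g x) (u v : V) :
    D2 (fun z => f z * g z) x u v = D2 f x u v * g x + fderiv ℝ f x u * fderiv ℝ g x v
      + fderiv ℝ f x v * fderiv ℝ g x u + f x * D2 g x u v := by
  rw [D2_eq (f' := fun z => f z • fderiv ℝ g z + g z • fderiv ℝ f z) ?_
    (((C2.df hf).hasFDerivAt.smul (C2.d2f hg).hasFDerivAt).add
     ((C2.df hg).hasFDerivAt.smul (C2.d2f hf).hasFDerivAt))]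
  · simp [D2]; ring
  · filter_upwards [C2.ev hf, C2.ev hg] with z h1 h2 using h1.hasFDerivAt.mul h2.hasFDerivAt

theorem D2_comp {g : W → X} {f : V → W} {x : V} (hg : ContDiffAt ℝ 2 g (f x))
    (hf : ContDiffAt ℝ 2 f x) (u v : V) :
    D2 (fun z => g (f z)) x u v = D2 g (f x) (fderiv ℝ f x u) (fderiv ℝ f x v)
      + fderiv ℝ g (f x) (D2 f x u v) := by
  have hc : Tendsto f (𝓝 x) (𝓝 (f x)) := hf.continuousAt
  have h1 : HasFDerivAt (fun z => fderiv ℝ g (f z))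
      ((fderiv ℝ (fderiv ℝ g) (f x)).comp (fderiv ℝ f x)) x :=
    (C2.d2f hg).hasFDerivAt.comp x (C2.df hf).hasFDerivAt
  rw [D2_eq (f' := fun z => (fderiv ℝ g (f z)).comp (fderiv ℝ f z)) ?_
    (h1.clm_comp (C2.d2f hf).hasFDerivAt)]
  · simp [D2, add_comm]
  · filter_upwards [hc.eventually (C2.ev hg), C2.ev hf] with z h1 h2
    exact h1.hasFDerivAt.comp z h2.hasFDerivAt

theorem D2_clm {g : W → X} (L : V →L[ℝ] W) {x : V} (hg : ContDiffAt ℝ 2 g (L x)) (u v : V) :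
    D2 (fun z => g (L z)) x u v = D2 g (L x) (L u) (L v) := by
  rw [D2_comp hg L.contDiff.contDiffAt]
  have : D2 (fun z => L z) x u v = 0 := by
    unfold D2
    have : fderiv ℝ (fun z => L z) = fun _ => L := by funext z; exact L.fderiv
    rw [this]; simp
  change _ + fderiv ℝ g (L x) (D2 (fun z => L z) x u v) = _
  rw [this]; simp

/-- composition with a real function -/
theorem D2_real {f : V → ℝ} {x : V} (φ φ' : ℝ → ℝ) (φ'' : ℝ) 
    (h1 : ∀ᶠ t in 𝓝 (f x), HasDerivAt φ (φ' t) t) (h2 : HasDerivAt φ' φ'' (f x))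
    (hf : ContDiffAt ℝ 2 f x) (u v : V) :
    D2 (fun z => φ (f z)) x u v = φ'' * fderiv ℝ f x u * fderiv ℝ f x v + φ' (f x) * D2 f x u v := by
  have hc : Tendsto f (𝓝 x) (𝓝 (f x)) := hf.continuousAt
  have h3 := h2.comp_hasFDerivAt x (C2.df hf).hasFDerivAt
  rw [D2_eq (f' := fun z => φ' (f z) • (fderiv ℝ f z)) ?_
    (h3.smul (C2.d2f hf).hasFDerivAt)]
  · simp [D2]; ring
  · filter_upwards [hc.eventually h1, C2.ev hf] with z h1 h2
    exact h1.comp_hasFDerivAt z h2.hasFDerivAt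

theorem D2_log {f : V → ℝ} {x : V} (hf : ContDiffAt ℝ 2 f x) (h0 : f x ≠ 0) (u v : V) :
    D2 (fun z => Real.log (f z)) x u v = 
      (f x * D2 f x u v - fderiv ℝ f x u * fderiv ℝ f x v) / f x ^ 2 := by
  rw [D2_real Real.log (fun t => t⁻¹) (-(f x ^ 2)⁻¹) ?_ (hasDerivAt_inv h0) hf]
  · field_simp; ring
  · filter_upwards [isOpen_ne.mem_nhds h0] with t ht using Real.hasDerivAt_log ht

theorem D2_exp {f : V → ℝ} {x : V} (hf : ContDiffAt ℝ 2 f x) (u v : V) :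
    D2 (fun z => Real.exp (f z)) x u v = 
      Real.exp (f x) * (fderiv ℝ f x u * fderiv ℝ f x v + D2 f x u v) := by
  rw [D2_real Real.exp Real.exp (Real.exp (f x)) ?_ (Real.hasDerivAt_exp _) hf]
  · ring
  · exact Eventually.of_forall fun t => Real.hasDerivAt_exp t

theorem D2_apply {f : V → W} {x : V} (hf : ContDiffAt ℝ 2 f x) (u v : V) :
    fderiv ℝ (fun z => fderiv ℝ f z v) x u = D2 f x u v := by
  rw [fderiv_clm_apply (C2.d2f hf) (differentiableAt_const v)]
  simp [D2]

theorem D2_deriv {f : V → ℝ} {x : V} (hf : ContDiffAt ℝ 2 f x) (u : V) :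
    deriv (deriv (fun t : ℝ => f (x + t • u))) 0 = D2 f x u u := by
  have hl : ∀ t : ℝ, HasDerivAt (fun t : ℝ => x + t • u) u t := by
    intro t
    simpa using ((hasDerivAt_id t).smul_const u).const_add x
  have hc : Tendsto (fun t : ℝ => x + t • u) (𝓝 0) (𝓝 x) := by
    have := (hl 0).continuousAt.tendsto
    simpa using this
  have h1 : deriv (fun t : ℝ => f (x + t • u)) =ᶠ[𝓝 0] fun t => fderiv ℝ f (x + t • u) u := by
    filter_upwards [hc.eventually (C2.ev hf)] with t ht
    exact (ht.hasFDerivAt.comp_hasDerivAt t (hl t)).deriv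
  rw [h1.deriv_eq]
  have h2 : HasFDerivAt (fun z => fderiv ℝ f z u) (fderiv ℝ (fun z => fderiv ℝ f z u) x)
      (x + (0:ℝ) • u) := by
    simp only [zero_smul, add_zero]
    exact ((C2.d2f hf).clm_apply (differentiableAt_const u)).hasFDerivAt
  have := (h2.comp_hasDerivAt (0:ℝ) (hl 0)).deriv
  rw [← D2_apply hf]
  exact this

theorem D2_localMax {f : V → ℝ} {x : V} (hf : ContDiffAt ℝ 2 f x) (hm : IsLocalMax f x) (u : V) :
    D2 f x u u ≤ 0 := by
  by_contra! hpos
  have hc : ContinuousAt (fun t : ℝ => x + t • u) 0 := by fun_prop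
  have hc' : Tendsto (fun t : ℝ => x + t • u) (𝓝 0) (𝓝 x) := by
    simpa using hc.tendsto
  have hmax : IsLocalMax (fun t : ℝ => f (x + t • u)) 0 := by
    have := hc'.eventually hm
    simpa [IsLocalMax, IsMaxFilter] using this
  rw [← D2_deriv hf] at hpos
  have hmin := isLocalMin_of_deriv_deriv_pos hpos hmax.deriv_eq_zero
    (by
      have : ContinuousAt f (x + (0:ℝ) • u) := by simpa using hf.continuousAt
      exact ContinuousAt.comp (f := fun t : ℝ => x + t • u) this hc)
  have hconst : (fun t : ℝ => f (x + t • u)) =ᶠ[𝓝 0] fun _ => f (x + (0:ℝ) • u) := by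
    filter_upwards [hmax, hmin] with t h1 h2 using le_antisymm h1 h2
  have h0 : deriv (deriv (fun t : ℝ => f (x + t • u))) 0 = 0 := by
    rw [(hconst.deriv).deriv_eq]; simp
  linarith
end D2sec

end MF

namespace MF
open scoped ContDiff Topology
open Filter

/-! ### Part B: homogeneous functions on ℝ³ minus the origin -/

abbrev E3 := EuclideanSpace ℝ (Fin 3)
abbrev ONB := OrthonormalBasis (Fin 3) ℝ E3

structure Hom0 (F : E3 → ℝ) : Prop where
  smooth : ContDiffOn ℝ ∞ F {0}ᶜ
  hom : ∀ t : ℝ, 0 < t → ∀ x, F (t • x) = F x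

namespace Hom0
variable {F G : E3 → ℝ}

theorem atp (h : Hom0 F) {x : E3} (hx : x ≠ 0) : ContDiffAt ℝ ∞ F x :=
  h.smooth.contDiffAt (isOpen_compl_singleton.mem_nhds hx)

theorem c2 (h : Hom0 F) {x : E3} (hx : x ≠ 0) : ContDiffAt ℝ 2 F x :=
  (h.atp hx).of_le two_le_inf

theorem df (h : Hom0 F) {x : E3} (hx : x ≠ 0) : DifferentiableAt ℝ F x :=
  C2.df (h.c2 hx)

theorem euler (h : Hom0 F) {x : E3} (hx : x ≠ 0) : fderiv ℝ F x x = 0 := by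
  have h1 : HasDerivAt (fun t : ℝ => F (t • x)) (fderiv ℝ F x x) 1 := by
    have hl : HasDerivAt (fun t : ℝ => t • x) x 1 := by
      simpa using (hasDerivAt_id (1:ℝ)).smul_const x
    have h2 : HasFDerivAt F (fderiv ℝ F x) ((1:ℝ) • x) := by
      simpa using (h.df hx).hasFDerivAt
    exact h2.comp_hasDerivAt 1 hl
  have h3 : (fun t : ℝ => F (t • x)) =ᶠ[𝓝 1] fun _ => F x := by
    filter_upwards [isOpen_Ioi.mem_nhds (show (1:ℝ) ∈ Set.Ioi 0 by simp)] with t ht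
    exact h.hom t ht x
  have h4 := h1.deriv
  rw [h3.deriv_eq] at h4
  simpa using h4.symm

theorem fd_smul (h : Hom0 F) {t : ℝ} (ht : 0 < t) {x : E3} (hx : x ≠ 0) (v : E3) :
    fderiv ℝ F (t • x) v = t⁻¹ * fderiv ℝ F x v := by
  have e : (fun z => F (t • z)) = F := by funext z; exact h.hom t ht z
  have hL : HasFDerivAt (fun z : E3 => t • z) (t • ContinuousLinearMap.id ℝ E3) x :=
    (hasFDerivAt_id x).const_smul t
  have htx : t • x ≠ 0 := smul_ne_zero ht.ne' hx
  have h1 : HasFDerivAt (fun z => F (t • z)) _ x := (h.df htx).hasFDerivAt.comp x hL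
  rw [e] at h1
  rw [h1.fderiv]
  simp
  field_simp

theorem D2_smul (h : Hom0 F) {t : ℝ} (ht : 0 < t) {x : E3} (hx : x ≠ 0) (u v : E3) :
    D2 F (t • x) u v = t⁻¹ ^ 2 * D2 F x u v := by
  have e : (fun z => F (t • z)) = F := by funext z; exact h.hom t ht z
  have htx : t • x ≠ 0 := smul_ne_zero ht.ne' hx
  have h1 := D2_clm (g := F) (t • ContinuousLinearMap.id ℝ E3) (x := x)
    (by simpa using h.c2 htx) u v
  simp only [_root_.smul_apply, ContinuousLinearMap.id_apply] at h1
  rw [e] at h1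
  rw [h1]
  have : D2 F (t • x) (t • u) (t • v) = t * (t * D2 F (t • x) u v) := by simp [D2]
  rw [this]
  field_simp

theorem D2_x (h : Hom0 F) {x : E3} (hx : x ≠ 0) (v : E3) :
    D2 F x v x = - fderiv ℝ F x v := by
  have e : (fun z : E3 => fderiv ℝ F z z) =ᶠ[𝓝 x] fun _ => (0:ℝ) := by
    filter_upwards [isOpen_compl_singleton.mem_nhds hx] with z hz using h.euler hz
  have h1 := Filter.EventuallyEq.fderiv_eq (𝕜 := ℝ) e
  rw [fderiv_clm_apply (C2.d2f (h.c2 hx)) differentiableAt_fun_id] at h1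
  have h2 := congrArg (fun L => L v) h1
  simp at h2
  unfold D2
  linarith

end Hom0

/-- The Laplacian on ℝ³. -/
def lap3 (F : E3 → ℝ) (x : E3) : ℝ :=
  ∑ i, D2 F x (EuclideanSpace.basisFun (Fin 3) ℝ i) (EuclideanSpace.basisFun (Fin 3) ℝ i)

theorem lap3_laplacian (a : ONB) (F : E3 → ℝ) (x : E3) :
    Laplacian.laplacian F x = ∑ i, D2 F x (a i) (a i) := by
  rw [InnerProductSpace.laplacian_eq_iteratedFDeriv_orthonormalBasis F a]
  simp [iteratedFDeriv_two_apply, D2]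

theorem lap3_onb (a : ONB) (F : E3 → ℝ) (x : E3) :
    lap3 F x = ∑ i, D2 F x (a i) (a i) := by
  rw [← lap3_laplacian a, lap3_laplacian (EuclideanSpace.basisFun (Fin 3) ℝ), lap3]

theorem lap3_iso (ρ : E3 ≃ₗᵢ[ℝ] E3) {F : E3 → ℝ} (x : E3) (hF : ContDiffAt ℝ 2 F (ρ x)) :
    lap3 (fun z => F (ρ z)) x = lap3 F (ρ x) := by
  rw [lap3_onb ((EuclideanSpace.basisFun (Fin 3) ℝ).map ρ) F, lap3]
  refine Finset.sum_congr rfl fun i _ => ?_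
  exact D2_clm (ρ.toContinuousLinearEquiv : E3 →L[ℝ] E3) hF _ _

theorem normsq_onb (a : ONB) (l : E3 →L[ℝ] ℝ) : ‖l‖ ^ 2 = ∑ i, l (a i) ^ 2 := by
  obtain ⟨v, rfl⟩ := (InnerProductSpace.toDual ℝ E3).surjective l
  rw [LinearIsometryEquiv.norm_map, ← a.sum_sq_norm_inner_left v]
  simp

theorem onb_expand (a : ONB) (x : E3) :
    x = inner ℝ (a 0) x • a 0 + inner ℝ (a 1) x • a 1 + inner ℝ (a 2) x • a 2 := by
  conv_lhs => rw [← a.sum_repr' x]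
  simp [Fin.sum_univ_three]

theorem onb_normsq (a : ONB) (x : E3) :
    ‖x‖ ^ 2 = inner ℝ (a 0) x ^ 2 + inner ℝ (a 1) x ^ 2 + inner ℝ (a 2) x ^ 2 := by
  rw [← a.sum_sq_norm_inner_right x]
  simp [Fin.sum_univ_three]

theorem onb_inner (a : ONB) (i j : Fin 3) : inner ℝ (a i) (a j) = if i = j then (1:ℝ) else 0 :=
  a.inner_eq_ite i j

theorem exists_onb2 (p : E3) (hp : ‖p‖ = 1) : ∃ a : ONB, a 2 = p := by
  have h : Orthonormal ℝ (Set.domRestrict {(2 : Fin 3)} (fun _ : Fin 3 => p)) := by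
    rw [orthonormal_iff_ite]
    rintro ⟨i, hi⟩ ⟨j, hj⟩
    simp at hi hj
    subst hi; subst hj
    simp [Set.domRestrict, hp]
  obtain ⟨b, hb⟩ := h.exists_orthonormalBasis_extension_of_card_eq (by simp)
  exact ⟨b, hb 2 (by simp)⟩

/-- orthonormal basis with two prescribed vectors -/
theorem exists_onb02 (n p : E3) (hn : ‖n‖ = 1) (hp : ‖p‖ = 1) (hnp : inner ℝ n p = (0:ℝ)) :
    ∃ a : ONB, a 0 = n ∧ a 2 = p := by
  have h : Orthonormal ℝ (Set.domRestrict {(0 : Fin 3), 2} (fun i : Fin 3 => if i = 0 then n else p)) := by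
    rw [orthonormal_iff_ite]
    rintro ⟨i, hi⟩ ⟨j, hj⟩
    simp at hi hj
    rcases hi with rfl | rfl <;> rcases hj with rfl | rfl <;>
      simp [Set.domRestrict, hp, hn, hnp]
    rw [real_inner_comm]; exact hnp
  obtain ⟨b, hb⟩ := h.exists_orthonormalBasis_extension_of_card_eq (by simp)
  exact ⟨b, by simpa using hb 0 (by simp), by simpa using hb 2 (by simp)⟩

/-- The (unnormalised) stereographic chart around `a 2`. -/
def ch (a : ONB) (y : ℝ × ℝ) : E3 :=
  (2 * y.1) • a 0 + (2 * y.2) • a 1 + (1 - y.1 ^ 2 - y.2 ^ 2) • a 2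

def NN (y : ℝ × ℝ) : ℝ := 1 + y.1 ^ 2 + y.2 ^ 2

theorem NN_pos (y : ℝ × ℝ) : 0 < NN y := by unfold NN; positivity

theorem NN_smooth : ContDiff ℝ ∞ NN := by unfold NN; fun_prop

theorem ch_smooth (a : ONB) : ContDiff ℝ ∞ (ch a) := by
  unfold ch; fun_prop

theorem ch_i0 (a : ONB) (y) : inner ℝ (a 0) (ch a y) = 2 * y.1 := by
  simp [ch, inner_add_right, inner_smul_right]
theorem ch_i1 (a : ONB) (y) : inner ℝ (a 1) (ch a y) = 2 * y.2 := by
  simp [ch, inner_add_right, inner_smul_right]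
theorem ch_i2 (a : ONB) (y) : inner ℝ (a 2) (ch a y) = 1 - y.1 ^ 2 - y.2 ^ 2 := by
  simp [ch, inner_add_right, inner_smul_right]

theorem ch_norm (a : ONB) (y) : ‖ch a y‖ = NN y := by
  have h := onb_normsq a (ch a y)
  rw [ch_i0, ch_i1, ch_i2] at h
  rw [← abs_of_nonneg (norm_nonneg (ch a y)), ← abs_of_pos (NN_pos y), ← sq_eq_sq_iff_abs_eq_abs, h]
  unfold NN; ring

theorem ch_ne (a : ONB) (y) : ch a y ≠ 0 := by
  rw [← norm_pos_iff, ch_norm]; exact NN_pos y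

theorem ch_zero (a : ONB) : ch a 0 = a 2 := by simp [ch]

def chd (a : ONB) (y v : ℝ × ℝ) : E3 :=
  (2 * v.1) • a 0 + (2 * v.2) • a 1 + (- 2 * (y.1 * v.1 + y.2 * v.2)) • a 2

theorem ch_fd (a : ONB) (y v : ℝ × ℝ) : fderiv ℝ (ch a) y v = chd a y v := by
  have h1 : HasDerivAt (fun t : ℝ => ch a (y + t • v)) (chd a y v) 0 := by
    have e : (fun t : ℝ => ch a (y + t • v)) = fun t : ℝ =>
        (2 * (y.1 + t * v.1)) • a 0 + (2 * (y.2 + t * v.2)) • a 1 +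
        (1 - (y.1 + t * v.1) ^ 2 - (y.2 + t * v.2) ^ 2) • a 2 := by
      funext t; simp [ch]
    rw [e]
    have A1 : HasDerivAt (fun t : ℝ => y.1 + t * v.1) v.1 0 := by
      simpa using ((hasDerivAt_id (0:ℝ)).mul_const v.1).const_add y.1
    have A2 : HasDerivAt (fun t : ℝ => y.2 + t * v.2) v.2 0 := by
      simpa using ((hasDerivAt_id (0:ℝ)).mul_const v.2).const_add y.2
    have := (((A1.const_mul 2).smul_const (a 0)).add ((A2.const_mul 2).smul_const (a 1))).add
      ((((A1.pow 2).const_sub 1).sub (A2.pow 2)).smul_const (a 2))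
    refine this.congr_deriv ?_
    simp only [chd, zero_mul, add_zero]
    congr 2
    simp; ring
  have h2 : HasFDerivAt (ch a) (fderiv ℝ (ch a) y) (y + (0:ℝ) • v) := by
    simpa using ((ch_smooth a).differentiable (by simp) y).hasFDerivAt
  have hl : HasDerivAt (fun t : ℝ => y + t • v) v 0 := by
    simpa using ((hasDerivAt_id (0:ℝ)).smul_const v).const_add y
  have h3 : HasDerivAt (fun t : ℝ => _) _ 0 := h2.comp_hasDerivAt (0:ℝ) hl
  exact h3.unique h1

theorem ch_D2 (a : ONB) (y u v : ℝ × ℝ) :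
    D2 (ch a) y u v = (- 2 * (u.1 * v.1 + u.2 * v.2)) • a 2 := by
  rw [← D2_apply ((ch_smooth a).contDiffAt.of_le two_le_inf)]
  have e : (fun z => fderiv ℝ (ch a) z v) = fun z => chd a z v := by funext z; exact ch_fd a z v
  rw [e]
  have h1 : HasDerivAt (fun t : ℝ => chd a (y + t • u) v) ((- 2 * (u.1 * v.1 + u.2 * v.2)) • a 2) 0 := by
    have e : (fun t : ℝ => chd a (y + t • u) v) = fun t : ℝ =>
        ((2 * v.1) • a 0 + (2 * v.2) • a 1) +
        (-2 * ((y.1 + t * u.1) * v.1 + (y.2 + t * u.2) * v.2)) • a 2 := by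
      funext t; simp [chd]
    rw [e]
    have A1 : HasDerivAt (fun t : ℝ => y.1 + t * u.1) u.1 0 := by
      simpa using ((hasDerivAt_id (0:ℝ)).mul_const u.1).const_add y.1
    have A2 : HasDerivAt (fun t : ℝ => y.2 + t * u.2) u.2 0 := by
      simpa using ((hasDerivAt_id (0:ℝ)).mul_const u.2).const_add y.2
    exact ((((A1.mul_const v.1).add (A2.mul_const v.2)).const_mul (-2)).smul_const (a 2)).const_add _
  have hd : Differentiable ℝ (fun z => chd a z v) := by unfold chd; fun_prop
  have h2 : HasFDerivAt (fun z => chd a z v) (fderiv ℝ (fun z => chd a z v) y) (y + (0:ℝ) • u) := by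
    simpa using (hd y).hasFDerivAt
  have hl : HasDerivAt (fun t : ℝ => y + t • u) u 0 := by
    simpa using ((hasDerivAt_id (0:ℝ)).smul_const u).const_add y
  have h3 : HasDerivAt (fun t : ℝ => _) _ 0 := h2.comp_hasDerivAt (0:ℝ) hl
  exact h3.unique h1

section chart

theorem chart_smooth {F : E3 → ℝ} (h : Hom0 F) (a : ONB)
    : ContDiff ℝ ∞ (fun y => F (ch a y)) := by
  rw [contDiff_iff_contDiffAt]
  intro y
  exact (h.atp (ch_ne a y)).comp y (ch_smooth a).contDiffAt

theorem chart_fd {F : E3 → ℝ} (h : Hom0 F) (a : ONB)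
    (y v : ℝ × ℝ) :
    fderiv ℝ (fun y => F (ch a y)) y v = fderiv ℝ F (ch a y) (chd a y v) := by
  have h1 := (h.df (ch_ne a y)).hasFDerivAt.comp y
    ((ch_smooth a).differentiable (by simp) y).hasFDerivAt
  have h2 : fderiv ℝ (fun y => F (ch a y)) y = _ := h1.fderiv
  rw [h2]
  simp [ch_fd]

theorem chart_D2 {F : E3 → ℝ} (h : Hom0 F) (a : ONB)
    (y u v : ℝ × ℝ) :
    D2 (fun y => F (ch a y)) y u v = D2 F (ch a y) (chd a y u) (chd a y v)
      - 2 * (u.1 * v.1 + u.2 * v.2) * fderiv ℝ F (ch a y) (a 2) := by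
  rw [D2_comp (h.c2 (ch_ne a y)) ((ch_smooth a).contDiffAt.of_le two_le_inf), ch_fd, ch_fd, ch_D2]
  simp; ring

theorem chart_grad {F : E3 → ℝ} (h : Hom0 F) (a : ONB)
    (y : ℝ × ℝ) :
    dx (fun y => F (ch a y)) y ^ 2 + dy (fun y => F (ch a y)) y ^ 2 =
      4 * ‖fderiv ℝ F (ch a y)‖ ^ 2 := by
  unfold dx dy
  rw [chart_fd h, chart_fd h, normsq_onb a]
  have e := h.euler (ch_ne a y)
  set l := fderiv ℝ F (ch a y)
  simp only [ch, map_add, map_smul, smul_eq_mul] at e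
  simp only [chd, map_add, map_smul, smul_eq_mul, Fin.sum_univ_three]
  linear_combination (-4 * l (a 2)) * e

theorem chart_lap {F : E3 → ℝ} (h : Hom0 F) (a : ONB)
    (y : ℝ × ℝ) :
    D2 (fun y => F (ch a y)) y (1, 0) (1, 0) + D2 (fun y => F (ch a y)) y (0, 1) (0, 1) =
      4 * lap3 F (ch a y) := by
  rw [chart_D2 h, chart_D2 h, lap3_onb a]
  have e := h.D2_x (ch_ne a y) (a 2)
  have s1 := D2_symm (h.c2 (ch_ne a y)) (a 0) (a 2)
  have s2 := D2_symm (h.c2 (ch_ne a y)) (a 1) (a 2)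
  unfold D2 at *
  set l := fderiv ℝ F (ch a y)
  set B := fderiv ℝ (fderiv ℝ F) (ch a y)
  simp only [ch, map_add, map_smul, smul_eq_mul] at e
  simp only [chd, map_add, map_smul, smul_eq_mul, Fin.sum_univ_three,
    _root_.add_apply, _root_.smul_apply]
  rw [s1, s2]
  linear_combination (-4) * e

end chart
end MF

namespace MF
open scoped ContDiff Topology
open Filter

/-! ### Data -/

structure Datum (lam ε : ℝ) (w D s M : E3 → ℝ) : Prop where
  hw : Hom0 w
  hD : Hom0 D
  hs : Hom0 s
  hM : Hom0 M
  gD : ∀ x, x ≠ 0 → ∀ v, fderiv ℝ D x v = D x * fderiv ℝ M x v / 2 + s x * fderiv ℝ w x v / 4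
  gs : ∀ x, x ≠ 0 → ∀ v, fderiv ℝ s x v = s x * fderiv ℝ M x v / 2 + ε / 4 * D x * fderiv ℝ w x v
  lw : ∀ x, x ≠ 0 → lap3 w x = - (D x * s x) / ‖x‖ ^ 2
  lM : ∀ x, x ≠ 0 → lap3 M x = (lam - (s x ^ 2 + ε * D x ^ 2) / 4) / ‖x‖ ^ 2

/-- The quantity `P`. -/
def PP (w D : E3 → ℝ) (x : E3) : ℝ := ‖x‖ ^ 2 * ‖fderiv ℝ w x‖ ^ 2 + 2 * D x ^ 2

theorem PP_nonneg (w D : E3 → ℝ) (x : E3) : 0 ≤ PP w D x := by unfold PP; positivity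

theorem dxdx_D2 {f : ℝ × ℝ → ℝ} (hf : ContDiff ℝ ∞ f) (y) : dx (dx f) y = D2 f y (1, 0) (1, 0) :=
  D2_apply (hf.contDiffAt.of_le two_le_inf) _ _
theorem dydy_D2 {f : ℝ × ℝ → ℝ} (hf : ContDiff ℝ ∞ f) (y) : dy (dy f) y = D2 f y (0, 1) (0, 1) :=
  D2_apply (hf.contDiffAt.of_le two_le_inf) _ _

def lapl (f : ℝ × ℝ → ℝ) (y : ℝ × ℝ) : ℝ := D2 f y (1, 0) (1, 0) + D2 f y (0, 1) (0, 1)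

theorem NN_eq : NN = fun y : ℝ × ℝ => (1 + y.1 * y.1) + y.2 * y.2 := by
  funext y; unfold NN; ring

theorem fd_fst (y v : ℝ × ℝ) : fderiv ℝ (fun z : ℝ × ℝ => z.1) y v = v.1 := by
  rw [fderiv_fst]; rfl
theorem fd_snd (y v : ℝ × ℝ) : fderiv ℝ (fun z : ℝ × ℝ => z.2) y v = v.2 := by
  rw [fderiv_snd]; rfl

/-- A quadratic polynomial. -/
def quad (A B1 B2 C : ℝ) (y : ℝ × ℝ) : ℝ := A * (y.1 ^ 2 + y.2 ^ 2) + B1 * y.1 + B2 * y.2 + C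

theorem quad_smooth (A B1 B2 C : ℝ) : ContDiff ℝ ∞ (quad A B1 B2 C) := by unfold quad; fun_prop

theorem quad_fd (A B1 B2 C : ℝ) (y v : ℝ × ℝ) :
    fderiv ℝ (quad A B1 B2 C) y v = 2 * A * (y.1 * v.1 + y.2 * v.2) + B1 * v.1 + B2 * v.2 := by
  have A1 : HasFDerivAt (fun z : ℝ × ℝ => z.1) (ContinuousLinearMap.fst ℝ ℝ ℝ) y := hasFDerivAt_fst
  have A2 : HasFDerivAt (fun z : ℝ × ℝ => z.2) (ContinuousLinearMap.snd ℝ ℝ ℝ) y := hasFDerivAt_snd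
  have h := (((((A1.pow 2).add (A2.pow 2)).const_mul A).add (A1.const_mul B1)).add
    (A2.const_mul B2)).add_const C
  have h2 : HasFDerivAt (quad A B1 B2 C) _ y := h
  rw [h2.fderiv]
  simp
  ring

theorem quad_D2 (A B1 B2 C : ℝ) (y u v : ℝ × ℝ) :
    D2 (quad A B1 B2 C) y u v = 2 * A * (u.1 * v.1 + u.2 * v.2) := by
  rw [← D2_apply ((quad_smooth A B1 B2 C).contDiffAt.of_le two_le_inf)]
  have e : (fun z => fderiv ℝ (quad A B1 B2 C) z v) =
      quad 0 (2 * A * v.1) (2 * A * v.2) (B1 * v.1 + B2 * v.2) := by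
    funext z; rw [quad_fd]; unfold quad; ring
  rw [e, quad_fd]; ring

theorem NN_quad : NN = quad 1 0 0 1 := by
  funext y; unfold NN quad; ring

theorem lapl_log_quad {A B1 B2 C : ℝ} (y : ℝ × ℝ) (h : quad A B1 B2 C y ≠ 0) :
    lapl (fun z => Real.log (quad A B1 B2 C z)) y =
      (4 * A * C - B1 ^ 2 - B2 ^ 2) / quad A B1 B2 C y ^ 2 := by
  have c2 := (quad_smooth A B1 B2 C).contDiffAt.of_le two_le_inf (x := y)
  unfold lapl
  rw [D2_log c2 h, D2_log c2 h, quad_D2, quad_D2, quad_fd, quad_fd, ← add_div]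
  congr 1
  simp; unfold quad; ring

theorem lapl_log_NN (y : ℝ × ℝ) : lapl (fun z => Real.log (NN z)) y = 4 / NN y ^ 2 := by
  rw [NN_quad, lapl_log_quad]
  · norm_num
  · rw [← NN_quad]; exact (NN_pos y).ne'

section

theorem datum_chart_grad {lam ε : ℝ} {w D s M : E3 → ℝ} (d : Datum lam ε w D s M) (a : ONB)
    {F G : E3 → ℝ} (hF : Hom0 F) (c : ℝ)
    (hg : ∀ x, x ≠ 0 → ∀ v, fderiv ℝ F x v = F x * fderiv ℝ M x v / 2 + c * G x * fderiv ℝ w x v)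
    (y v : ℝ × ℝ) :
    fderiv ℝ (fun z => 2 * F (ch a z) / NN z) y v =
      (2 * F (ch a y) / NN y) * fderiv ℝ (fun z => M (ch a z) - 2 * Real.log (NN z)) y v / 2
      + c * (2 * G (ch a y) / NN y) * fderiv ℝ (fun z => w (ch a z)) y v := by
  have hN := NN_pos y
  have h1 : HasFDerivAt (fun z => F (ch a z)) _ y := ((chart_smooth hF a).mdf y).hasFDerivAt
  have h2 : HasFDerivAt NN (fderiv ℝ NN y) y := (NN_smooth.mdf y).hasFDerivAt
  have h3 : HasFDerivAt (fun z => M (ch a z)) _ y := ((chart_smooth d.hM a).mdf y).hasFDerivAt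
  have h6 := (hasDerivAt_inv hN.ne').comp_hasFDerivAt y h2
  have h4 : HasFDerivAt (fun z => 2 * F (ch a z) / NN z) _ y := (h1.const_mul 2).mul h6
  have h5 := h3.sub ((h2.log hN.ne').const_mul 2)
  have h5' : HasFDerivAt (fun z => M (ch a z) - 2 * Real.log (NN z)) _ y := h5
  rw [h4.fderiv, h5'.fderiv]
  simp only [_root_.smul_apply, _root_.sub_apply, _root_.add_apply, smul_eq_mul, Function.comp]
  rw [chart_fd hF, chart_fd d.hM, chart_fd d.hw, hg _ (ch_ne a y)]
  field_simp
  ring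

theorem datum_T {lam ε : ℝ} {w D s M : E3 → ℝ} (d : Datum lam ε w D s M) (a : ONB)
    (y : ℝ × ℝ) :
    dx (fun z => w (ch a z)) y ^ 2 + dy (fun z => w (ch a z)) y ^ 2 + 2 * (2 * D (ch a y) / NN y) ^ 2
     = 4 / NN y ^ 2 * PP w D (ch a y) := by
  have hN := NN_pos y
  rw [chart_grad d.hw, PP, ch_norm]
  field_simp
  ring

theorem datum_log {lam ε : ℝ} {w D s M : E3 → ℝ} (d : Datum lam ε w D s M) (a : ONB)
    (hlam : 2 ≤ lam) (hpos : 0 < PP w D (a 2)) :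
    lapl (fun y => Real.log (4 / NN y ^ 2 * PP w D (ch a y))) 0 ≥
      lapl (fun y => M (ch a y) - 2 * Real.log (NN y)) 0
       - 4 * (lam - 2) * (1 - 2 * D (a 2) ^ 2 / PP w D (a 2)) := by
  set wc : ℝ × ℝ → ℝ := fun z => w (ch a z) with hwc
  set Dc : ℝ × ℝ → ℝ := fun z => 2 * D (ch a z) / NN z with hDc
  set sc : ℝ × ℝ → ℝ := fun z => 2 * s (ch a z) / NN z with hsc
  set mc : ℝ × ℝ → ℝ := fun z => M (ch a z) - 2 * Real.log (NN z) with hmc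
  have hNN : ∀ y, NN y ≠ 0 := fun y => (NN_pos y).ne'
  have lN : ContDiff ℝ ∞ (fun z => Real.log (NN z)) := NN_smooth.log hNN
  have sw : ContDiff ℝ ∞ wc := chart_smooth d.hw a
  have sM := chart_smooth d.hM a
  have sD : ContDiff ℝ ∞ Dc := (contDiff_const.mul (chart_smooth d.hD a)).div NN_smooth hNN
  have ss : ContDiff ℝ ∞ sc := (contDiff_const.mul (chart_smooth d.hs a)).div NN_smooth hNN
  have sm : ContDiff ℝ ∞ mc := sM.sub (contDiff_const.mul lN)
  have gD : ∀ y v, fderiv ℝ Dc y v = Dc y * fderiv ℝ mc y v / 2 + sc y * fderiv ℝ wc y v / 4 := by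
    intro y v
    have := datum_chart_grad d a (G := s) d.hD (1/4) (by
      intro x hx v; rw [d.gD x hx]; ring) y v
    rw [hDc, this]; simp only [hsc]; ring
  have gs : ∀ y v, fderiv ℝ sc y v = sc y * fderiv ℝ mc y v / 2 + ε / 4 * Dc y * fderiv ℝ wc y v := by
    intro y v
    have := datum_chart_grad d a (G := D) d.hs (ε/4) (by
      intro x hx v; rw [d.gs x hx]) y v
    rw [hsc, this]
  have lw : ∀ y, dx (dx wc) y + dy (dy wc) y = - (Dc y * sc y) := by
    intro y
    have hN := NN_pos y
    rw [dxdx_D2 sw, dydy_D2 sw, chart_lap d.hw, d.lw _ (ch_ne a y), ch_norm]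
    simp only [hDc, hsc]
    field_simp
    ring
  have lm : ∀ y, dx (dx mc) y + dy (dy mc) y = 4 * (lam - 2) / NN y ^ 2 - (sc y ^ 2 + ε * Dc y ^ 2) / 4 := by
    intro y
    have hN := NN_pos y
    have c1 := sM.contDiffAt.of_le two_le_inf (x := y)
    have c2 := lN.contDiffAt.of_le two_le_inf (x := y)
    have e : ∀ u v, D2 mc y u v = D2 (fun z => M (ch a z)) y u v
        - 2 * D2 (fun z => Real.log (NN z)) y u v := by
      intro u v
      have h2 := D2_cmul (2:ℝ) c2 u v
      simp only [smul_eq_mul] at h2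
      rw [hmc, D2_sub c1 (contDiffAt_const.mul c2), h2]
    rw [dxdx_D2 sm, dydy_D2 sm, e, e]
    have l1 := chart_lap d.hM a y
    have l2 := lapl_log_NN y
    unfold lapl at l2
    rw [d.lM _ (ch_ne a y), ch_norm] at l1
    have : ∀ p q r t : ℝ, p - 2 * q + (r - 2 * t) = (p + r) - 2 * (q + t) := by intros; ring
    rw [this, l1, l2]
    simp only [hDc, hsc]
    field_simp
    ring
  set T : ℝ × ℝ → ℝ := fun y => dx wc y ^ 2 + dy wc y ^ 2 + 2 * Dc y ^ 2 with hT
  have key := key_identity ε wc Dc sc mc (fun y => 4 * (lam - 2) / NN y ^ 2) sw sD ss sm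
    (fun y => gD y _) (fun y => gD y _) (fun y => gs y _) (fun y => gs y _) lw lm T hT 0
  have hTe : (fun y => 4 / NN y ^ 2 * PP w D (ch a y)) = T := by
    funext y; rw [← datum_T d]
  have sT : ContDiff ℝ ∞ T := by
    have h1 := sw.mdx
    have h2 := sw.mdy
    exact ((h1.pow 2).add (h2.pow 2)).add (contDiff_const.mul (sD.pow 2))
  have hN0 : NN 0 = 1 := by simp [NN]
  have hT0 : T 0 = 4 * PP w D (a 2) := by
    rw [← hTe]; simp only [hN0, ch_zero]; norm_num
  have hTpos : 0 < T 0 := by rw [hT0]; linarith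
  have c2 := sT.contDiffAt.of_le two_le_inf (x := (0 : ℝ × ℝ))
  have e1 : lapl (fun y => Real.log (4 / NN y ^ 2 * PP w D (ch a y))) 0 =
      (T 0 * (dx (dx T) 0 + dy (dy T) 0) - (dx T 0 ^ 2 + dy T 0 ^ 2)) / T 0 ^ 2 := by
    have : (fun y => Real.log (4 / NN y ^ 2 * PP w D (ch a y))) = fun y => Real.log (T y) := by
      funext y; rw [← hTe]
    rw [this, dxdx_D2 sT, dydy_D2 sT]
    unfold lapl
    rw [D2_log c2 hTpos.ne', D2_log c2 hTpos.ne', ← add_div]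
    congr 1
    unfold dx dy
    ring
  rw [e1, key]
  have e2 : lapl mc 0 = dx (dx mc) 0 + dy (dy mc) 0 := by
    rw [dxdx_D2 sm, dydy_D2 sm]; rfl
  have hDc0 : Dc 0 = 2 * D (a 2) := by simp [hDc, hN0, ch_zero]
  have hg : dx wc 0 ^ 2 + dy wc 0 ^ 2 = 4 * PP w D (a 2) - 8 * D (a 2) ^ 2 := by
    rw [← hT0, hT]; simp only; rw [hDc0]; ring
  rw [e2, hN0, hg]
  set R := (dx (dx wc) 0 - dy (dy wc) 0 - dx mc 0 * dx wc 0 + dy mc 0 * dy wc 0) ^ 2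
        + (2 * dx (dy wc) 0 - dx mc 0 * dy wc 0 - dy mc 0 * dx wc 0) ^ 2 with hR
  have hRn : 0 ≤ R := by positivity
  have : (T 0 ^ 2 * (dx (dx mc) 0 + dy (dy mc) 0) - 4 * (lam - 2) / 1 ^ 2 *
      (4 * PP w D (a 2) - 8 * D (a 2) ^ 2) * T 0 + 2 * Dc 0 ^ 2 * R) / T 0 ^ 2
      = (dx (dx mc) 0 + dy (dy mc) 0) - 4 * (lam - 2) * (1 - 2 * D (a 2) ^ 2 / PP w D (a 2))
        + 2 * Dc 0 ^ 2 * R / T 0 ^ 2 := by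
    rw [hT0]; field_simp; ring
  rw [this]
  have : 0 ≤ 2 * Dc 0 ^ 2 * R / T 0 ^ 2 := by positivity
  linarith

theorem max_ineq {lam ε : ℝ} {w D s M : E3 → ℝ} (d : Datum lam ε w D s M) (a : ONB)
    (hlam : 2 ≤ lam) (hpos : 0 < PP w D (a 2)) (l : ℝ × ℝ → ℝ)
    (hl : ContDiffAt ℝ 2 l 0)
    (hmax : IsLocalMax (fun y => Real.log (PP w D (ch a y)) - M (ch a y) - l y) 0) :
    lapl l 0 ≥ - 4 * (lam - 2) * (1 - 2 * D (a 2) ^ 2 / PP w D (a 2)) := by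
  have key := datum_log d a hlam hpos
  set f1 : ℝ × ℝ → ℝ := fun y => Real.log (4 / NN y ^ 2 * PP w D (ch a y)) with hf1
  set f2 : ℝ × ℝ → ℝ := fun y => M (ch a y) - 2 * Real.log (NN y) with hf2
  have hNN : ∀ y, NN y ≠ 0 := fun y => (NN_pos y).ne'
  have lN : ContDiff ℝ ∞ (fun z => Real.log (NN z)) := NN_smooth.log hNN
  have sw := chart_smooth d.hw a
  have sD : ContDiff ℝ ∞ (fun z => 2 * D (ch a z) / NN z) :=
    (contDiff_const.mul (chart_smooth d.hD a)).div NN_smooth hNN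
  have sT : ContDiff ℝ ∞ (fun y => 4 / NN y ^ 2 * PP w D (ch a y)) := by
    have : (fun y => 4 / NN y ^ 2 * PP w D (ch a y)) = fun y => dx (fun z => w (ch a z)) y ^ 2
      + dy (fun z => w (ch a z)) y ^ 2 + 2 * (2 * D (ch a y) / NN y) ^ 2 := by
      funext y; rw [datum_T d]
    rw [this]
    have h1 := sw.mdx
    have h2 := sw.mdy
    exact ((h1.pow 2).add (h2.pow 2)).add (contDiff_const.mul (sD.pow 2))
  have hN0 : NN 0 = 1 := by simp [NN]
  have hP0 : (4 / NN 0 ^ 2 * PP w D (ch a 0)) ≠ 0 := by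
    rw [hN0, ch_zero]; positivity
  have c1 : ContDiffAt ℝ 2 f1 0 := (sT.contDiffAt.of_le two_le_inf).log hP0
  have c2 : ContDiffAt ℝ 2 f2 0 :=
    ((chart_smooth d.hM a).sub (contDiff_const.mul lN)).contDiffAt.of_le two_le_inf
  have hev : ∀ᶠ y in 𝓝 (0 : ℝ × ℝ), 0 < 4 / NN y ^ 2 * PP w D (ch a y) := by
    refine sT.continuous.continuousAt.eventually (isOpen_Ioi.mem_nhds ?_)
    simp only [Set.mem_Ioi, hN0, ch_zero]; positivity
  have hee : (fun y => Real.log (PP w D (ch a y)) - M (ch a y) - l y) =ᶠ[𝓝 0]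
      fun y => (f1 y - f2 y - l y) - Real.log 4 := by
    filter_upwards [hev] with y hy
    have hN := NN_pos y
    have hP : 0 < PP w D (ch a y) := by
      by_contra hc
      have : PP w D (ch a y) = 0 := le_antisymm (not_lt.1 hc) (PP_nonneg _ _ _)
      simp [this] at hy
    simp only [hf1, hf2]
    rw [Real.log_mul (by positivity) hP.ne', Real.log_div (by norm_num) (by positivity), Real.log_pow]
    push_cast
    ring
  have hmax2 : IsLocalMax (fun y => f1 y - f2 y - l y) 0 := by
    have h := hmax.congr hee
    have h3 : ∀ᶠ y in 𝓝 (0:ℝ × ℝ), (f1 y - f2 y - l y) - Real.log 4 ≤ (f1 0 - f2 0 - l 0) - Real.log 4 := h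
    filter_upwards [h3] with y hy
    linarith
  have c12 : ContDiffAt ℝ 2 (fun y => f1 y - f2 y) 0 := c1.sub c2
  have c3 : ContDiffAt ℝ 2 (fun y => f1 y - f2 y - l y) 0 := c12.sub hl
  have m1 := D2_localMax c3 hmax2 (1, 0)
  have m2 := D2_localMax c3 hmax2 (0, 1)
  rw [D2_sub c12 hl, D2_sub c1 c2] at m1 m2
  unfold lapl at *
  linarith
end
end MF

namespace MF
open scoped ContDiff Topology
open Filter

/-! ### The main vanishing theorem -/

theorem exists_max {X : Type*} [TopologicalSpace X] {S : Set X} (hS : IsCompact S)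
    {P q g : X → ℝ} (hP : ContinuousOn P S) (hq : ContinuousOn q S) (hg : ContinuousOn g S)
    (P0 : ∀ z ∈ S, 0 ≤ P z) (q0 : ∀ z ∈ S, 0 ≤ q z) (g0 : ∀ z ∈ S, 0 < g z)
    (C : ℝ) (hC : ∀ z ∈ S, P z ≤ C * q z) (δ : ℝ) (hδ : 0 < δ)
    (x0 : X) (hx0 : x0 ∈ S) (hPx0 : 0 < P x0) :
    ∃ x ∈ S, 0 < P x ∧ 0 < q x ∧ ∀ z ∈ S, 0 < P z → 0 < q z →
      Real.log (P z) + Real.log (g z) - (1 - δ) * Real.log (q z) ≤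
      Real.log (P x) + Real.log (g x) - (1 - δ) * Real.log (q x) := by
  have qpos : ∀ z ∈ S, 0 < P z → 0 < q z := by
    intro z hz h
    rcases (q0 z hz).lt_or_eq with h1 | h1
    · exact h1
    · have := hC z hz; rw [← h1] at this; simp at this; linarith
  have hC0 : 0 ≤ C := by
    by_contra hc
    have := hC x0 hx0
    nlinarith [qpos x0 hx0 hPx0]
  obtain ⟨zg, hzg, hzgm⟩ := hS.exists_isMaxOn ⟨x0, hx0⟩ hg
  set B := C * g zg with hB
  have hB0 : 0 ≤ B := mul_nonneg hC0 (g0 _ hzg).le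
  set G : X → ℝ := fun z => P z * g z * q z ^ (δ - 1) with hG
  have hGx0 : 0 < G x0 := by
    have := qpos x0 hx0 hPx0
    have := g0 x0 hx0
    simp only [hG]; positivity
  -- choose kappa
  have htend : Tendsto (fun κ : ℝ => B * κ ^ δ) (𝓝[>] 0) (𝓝 (B * 0 ^ δ)) := by
    have : ContinuousAt (fun κ : ℝ => B * κ ^ δ) 0 :=
      continuousAt_const.mul (Real.continuousAt_rpow_const _ _ (Or.inr hδ.le))
    exact this.tendsto.mono_left nhdsWithin_le_nhds
  rw [Real.zero_rpow hδ.ne', mul_zero] at htend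
  obtain ⟨κ, hκ1, hκ⟩ := ((htend.eventually (gt_mem_nhds hGx0)).and self_mem_nhdsWithin).exists
  have hκ0 : (0:ℝ) < κ := hκ
  have small : ∀ z ∈ S, 0 < P z → q z < κ → G z < G x0 := by
    intro z hz hPz hqz
    have h1 := qpos z hz hPz
    have h2 : G z ≤ B * q z ^ δ := by
      have e : q z ^ δ = q z * q z ^ (δ - 1) := by
        rw [Real.rpow_sub_one h1.ne']; field_simp
      simp only [hG, e]
      rw [show B * (q z * q z ^ (δ - 1)) = (B * q z) * q z ^ (δ - 1) by ring]
      refine mul_le_mul_of_nonneg_right ?_ (Real.rpow_nonneg h1.le _)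
      calc P z * g z ≤ (C * q z) * g zg :=
            mul_le_mul (hC z hz) (hzgm hz) (g0 z hz).le (mul_nonneg hC0 h1.le)
        _ = B * q z := by rw [hB]; ring
    have h3 : q z ^ δ ≤ κ ^ δ := Real.rpow_le_rpow h1.le hqz.le hδ.le
    nlinarith [mul_le_mul_of_nonneg_left h3 hB0]
  set K := S ∩ q ⁻¹' Set.Ici κ with hK
  have hKc : IsCompact K := by
    obtain ⟨F, hF, hFe⟩ := (continuousOn_iff_isClosed.1 hq) (Set.Ici κ) isClosed_Ici
    have : K = S ∩ F := by rw [hK, Set.inter_comm, hFe, Set.inter_comm]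
    rw [this]; exact hS.inter_right hF
  have hx0K : x0 ∈ K := ⟨hx0, by
    by_contra hc
    exact lt_irrefl _ (small x0 hx0 hPx0 (not_le.1 hc))⟩
  have hGc : ContinuousOn G K := by
    have hm : K ⊆ S := Set.inter_subset_left
    refine ((hP.mono hm).mul (hg.mono hm)).mul ((hq.mono hm).rpow_const ?_)
    intro z hz
    left
    have : κ ≤ q z := hz.2
    linarith
  obtain ⟨x, hx, hxm⟩ := hKc.exists_isMaxOn ⟨x0, hx0K⟩ hGc
  have hGx : G x0 ≤ G x := hxm hx0K
  have hqx : 0 < q x := lt_of_lt_of_le hκ0 hx.2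
  have hPx : 0 < P x := by
    rcases (P0 x hx.1).lt_or_eq with h | h
    · exact h
    · exfalso; simp only [hG] at hGx hGx0; rw [← h] at hGx; simp only [zero_mul] at hGx; linarith
  have hlog : ∀ z ∈ S, 0 < P z → 0 < q z → Real.log (G z) =
      Real.log (P z) + Real.log (g z) - (1 - δ) * Real.log (q z) := by
    intro z hz h1 h2
    have h3 := g0 z hz
    simp only [hG]
    rw [Real.log_mul (by positivity) (by positivity), Real.log_mul h1.ne' h3.ne', Real.log_rpow h2]
    ring
  refine ⟨x, hx.1, hPx, hqx, ?_⟩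
  intro z hz h1 h2
  rw [← hlog z hz h1 h2, ← hlog x hx.1 hPx hqx]
  have h3 := g0 z hz
  have hGz : 0 < G z := by simp only [hG]; positivity
  refine Real.log_le_log hGz ?_
  by_cases hk : κ ≤ q z
  · exact hxm ⟨hz, hk⟩
  · exact (small z hz h1 (not_le.1 hk)).le.trans hGx

theorem lapl_add {f g : ℝ × ℝ → ℝ} {y} (hf : ContDiffAt ℝ 2 f y) (hg : ContDiffAt ℝ 2 g y) :
    lapl (fun z => f z + g z) y = lapl f y + lapl g y := by
  unfold lapl; rw [D2_add hf hg, D2_add hf hg]; ring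
theorem lapl_sub {f g : ℝ × ℝ → ℝ} {y} (hf : ContDiffAt ℝ 2 f y) (hg : ContDiffAt ℝ 2 g y) :
    lapl (fun z => f z - g z) y = lapl f y - lapl g y := by
  unfold lapl; rw [D2_sub hf hg, D2_sub hf hg]; ring
theorem lapl_cmul (c : ℝ) {f : ℝ × ℝ → ℝ} {y} (hf : ContDiffAt ℝ 2 f y) :
    lapl (fun z => c * f z) y = c * lapl f y := by
  have h2 := D2_cmul c hf
  simp only [smul_eq_mul] at h2
  unfold lapl; rw [h2, h2]; ring

theorem lapl_congr {f g : ℝ × ℝ → ℝ} {y} (h : f =ᶠ[𝓝 y] g) : lapl f y = lapl g y := by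
  unfold lapl; rw [D2_congr h, D2_congr h]

theorem ch_inner (a : ONB) (b : E3) (y : ℝ × ℝ) : inner ℝ (ch a y) b =
    2 * y.1 * inner ℝ (a 0) b + 2 * y.2 * inner ℝ (a 1) b
     + (1 - y.1 ^ 2 - y.2 ^ 2) * inner ℝ (a 2) b := by
  simp [ch, inner_add_left, inner_smul_left]

theorem log_quad_c2 {A B1 B2 C : ℝ} {y} (h : quad A B1 B2 C y ≠ 0) :
    ContDiffAt ℝ 2 (fun z => Real.log (quad A B1 B2 C z)) y :=
  ((quad_smooth A B1 B2 C).contDiffAt.of_le two_le_inf).log h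

theorem quad_ev {A B1 B2 C : ℝ} {y} (h : 0 < quad A B1 B2 C y) :
    ∀ᶠ z in 𝓝 y, 0 < quad A B1 B2 C z :=
  (quad_smooth A B1 B2 C).continuous.continuousAt.eventually (isOpen_Ioi.mem_nhds h)

/-- `log(1 - ⟨x,b⟩²)` in the chart. -/
theorem lapl_zero_fn (a : ONB) (b : E3) (hb : ‖b‖ = 1) (h : 0 < 1 - inner ℝ (a 2) b ^ 2) :
    ContDiffAt ℝ 2 (fun y => Real.log (1 - (inner ℝ (ch a y) b / NN y) ^ 2)) 0 ∧
    lapl (fun y => Real.log (1 - (inner ℝ (ch a y) b / NN y) ^ 2)) 0 = -8 := by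
  have hn := onb_normsq a b
  rw [hb] at hn
  set β0 := inner ℝ (a 0) b
  set β1 := inner ℝ (a 1) b
  set β2 := inner ℝ (a 2) b
  have hm : 0 < 1 - β2 := by nlinarith
  have hp : 0 < 1 + β2 := by nlinarith
  have q1 : 0 < quad (1 + β2) (-2 * β0) (-2 * β1) (1 - β2) 0 := by simp [quad]; linarith
  have q2 : 0 < quad (1 - β2) (2 * β0) (2 * β1) (1 + β2) 0 := by simp [quad]; linarith
  have q3 : 0 < quad 1 0 0 1 0 := by simp [quad]
  have ee : (fun y => Real.log (1 - (inner ℝ (ch a y) b / NN y) ^ 2)) =ᶠ[𝓝 0] fun y =>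
      Real.log (quad (1 + β2) (-2 * β0) (-2 * β1) (1 - β2) y) +
      Real.log (quad (1 - β2) (2 * β0) (2 * β1) (1 + β2) y) - 2 * Real.log (quad 1 0 0 1 y) := by
    filter_upwards [quad_ev q1, quad_ev q2, quad_ev q3] with y h1 h2 h3
    rw [← Real.log_mul h1.ne' h2.ne', show (2:ℝ) = ((2:ℕ):ℝ) by norm_num, ← Real.log_pow,
      ← Real.log_div (by positivity) (by positivity)]
    congr 1
    rw [NN_quad, ch_inner, div_pow, eq_div_iff (by positivity), sub_mul, div_mul_cancel₀ _ (by positivity)]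
    unfold quad
    push_cast
    ring
  have c1 := log_quad_c2 q1.ne'
  have c2 := log_quad_c2 q2.ne'
  have c3 := log_quad_c2 q3.ne'
  have c12 := c1.add c2
  have c3' : ContDiffAt ℝ 2 (fun y => 2 * Real.log (quad 1 0 0 1 y)) 0 := contDiffAt_const.mul c3
  refine ⟨(c12.sub c3').congr_of_eventuallyEq ee, ?_⟩
  rw [lapl_congr ee, lapl_sub c12 c3', lapl_add c1 c2, lapl_cmul 2 c3, lapl_log_quad _ q1.ne',
    lapl_log_quad _ q2.ne', lapl_log_quad _ q3.ne']
  have : 4 * (1 + β2) * (1 - β2) - (-2 * β0) ^ 2 - (-2 * β1) ^ 2 = 0 := by nlinarith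
  rw [this]
  have : 4 * (1 - β2) * (1 + β2) - (2 * β0) ^ 2 - (2 * β1) ^ 2 = 0 := by nlinarith
  rw [this]
  simp [quad]; norm_num

theorem lapl_pole_fn (a : ONB) (b : E3) (hb : ‖b‖ = 1) (η : ℝ) (hη : 0 < η) :
    ContDiffAt ℝ 2 (fun y => Real.log (1 + η - inner ℝ (ch a y) b / NN y)) 0 ∧
    lapl (fun y => Real.log (1 + η - inner ℝ (ch a y) b / NN y)) 0 =
      4 * ((2 * inner ℝ (a 2) b * η - (1 - inner ℝ (a 2) b) ^ 2) / (1 + η - inner ℝ (a 2) b) ^ 2) := by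
  have hn := onb_normsq a b
  rw [hb] at hn
  set β0 := inner ℝ (a 0) b
  set β1 := inner ℝ (a 1) b
  set β2 := inner ℝ (a 2) b
  have hm : 0 < 1 + η - β2 := by nlinarith
  have q1 : 0 < quad (1 + η + β2) (-2 * β0) (-2 * β1) (1 + η - β2) 0 := by simp [quad]; linarith
  have q3 : 0 < quad 1 0 0 1 0 := by simp [quad]
  have ee : (fun y => Real.log (1 + η - inner ℝ (ch a y) b / NN y)) =ᶠ[𝓝 0] fun y =>
      Real.log (quad (1 + η + β2) (-2 * β0) (-2 * β1) (1 + η - β2) y) - Real.log (quad 1 0 0 1 y) := by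
    filter_upwards [quad_ev q1, quad_ev q3] with y h1 h3
    rw [← Real.log_div (by positivity) (by positivity)]
    congr 1
    rw [NN_quad, ch_inner, eq_div_iff (by positivity), sub_mul, div_mul_cancel₀ _ (by positivity)]
    unfold quad
    ring
  have c1 := log_quad_c2 q1.ne'
  have c3 := log_quad_c2 q3.ne'
  refine ⟨(c1.sub c3).congr_of_eventuallyEq ee, ?_⟩
  rw [lapl_congr ee, lapl_sub c1 c3, lapl_log_quad _ q1.ne', lapl_log_quad _ q3.ne']
  have : 4 * (1 + η + β2) * (1 + η - β2) - (-2 * β0) ^ 2 - (-2 * β1) ^ 2 = 4 * (2 * η + η ^ 2) := by nlinarith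
  rw [this]
  simp [quad]
  field_simp
  ring

theorem Hom0.fd_cont {F : E3 → ℝ} (h : Hom0 F) : ContinuousOn (fderiv ℝ F) {0}ᶜ := by
  intro x hx
  exact (((h.atp hx).fderiv_right (m := 0) (by simp)).continuousAt).continuousWithinAt

theorem sphere_sub : Metric.sphere (0 : E3) 1 ⊆ {0}ᶜ := by
  intro x hx h
  simp at hx h; subst h; simp at hx

theorem PP_cont {w D : E3 → ℝ} (hw : Hom0 w) (hD : Hom0 D) : ContinuousOn (PP w D) {0}ᶜ := by
  have h1 := hw.fd_cont
  have h2 := hD.smooth.continuousOn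
  unfold PP
  fun_prop

theorem PP_smul {w D : E3 → ℝ} (hw : Hom0 w) (hD : Hom0 D) {t : ℝ} (ht : 0 < t) {x : E3} (hx : x ≠ 0) :
    PP w D (t • x) = PP w D x := by
  have e : fderiv ℝ w (t • x) = t⁻¹ • fderiv ℝ w x := by
    ext v; rw [hw.fd_smul ht hx]; rfl
  unfold PP
  rw [e, hD.hom t ht, norm_smul, norm_smul]
  simp [abs_of_pos ht]
  field_simp

theorem one_sub_inner (x b : E3) (hx : ‖x‖ = 1) (hb : ‖b‖ = 1) : 0 ≤ 1 - inner ℝ x b ^ 2 := by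
  have := abs_real_inner_le_norm x b
  rw [hx, hb, mul_one] at this
  have := (sq_le_one_iff_abs_le_one _).2 this
  linarith

theorem A_le1 {η sx : ℝ} (hη0 : 0 < η) (sx1 : sx ≤ 1) :
    (2 * sx * η - (1 - sx) ^ 2) / (1 + η - sx) ^ 2 ≤ 2 / η := by
  have hden : 0 < 1 + η - sx := by linarith
  rw [div_le_div_iff₀ (by positivity) hη0]
  have h1 : 0 ≤ 1 - sx := by linarith
  have e : 2 * (1 + η - sx) ^ 2 - (2 * sx * η - (1 - sx) ^ 2) * η =
     2 * (1 - sx) ^ 2 + 4 * η * (1 - sx) + 2 * η ^ 2 * (1 - sx) + η * (1 - sx) ^ 2 := by ring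
  have : 0 ≤ 2 * (1 - sx) ^ 2 + 4 * η * (1 - sx) + 2 * η ^ 2 * (1 - sx) + η * (1 - sx) ^ 2 := by positivity
  linarith

theorem A_le2 {η sx σ : ℝ} (hη0 : 0 < η) (hη1 : η ≤ 1) (hη2 : η ≤ σ ^ 2 / 4) (hσ0 : 0 < σ)
    (sx1 : sx ≤ 1) (sxm : -1 ≤ sx) (hσs : σ ≤ 1 - sx) :
    (2 * sx * η - (1 - sx) ^ 2) / (1 + η - sx) ^ 2 ≤ - (σ ^ 2 / 18) := by
  have hden : 0 < 1 + η - sx := by linarith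
  rw [div_le_iff₀ (by positivity)]
  have hd : (1 + η - sx) ^ 2 ≤ 9 := by nlinarith
  have q1 : σ ^ 2 ≤ (1 - sx) ^ 2 := by nlinarith
  have q2 : sx * η ≤ η := by nlinarith
  have hn : 2 * sx * η - (1 - sx) ^ 2 ≤ - (σ ^ 2 / 2) := by linarith
  nlinarith [sq_nonneg σ]

set_option maxHeartbeats 1000000 in
theorem D_vanish {lam ε : ℝ} {w D s M : E3 → ℝ} (d : Datum lam ε w D s M)
    (h2 : 2 < lam) (h8 : lam ≤ 8) (b1 b2 b3 : E3) (n1 : ‖b1‖ = 1) (n2 : ‖b2‖ = 1) (n3 : ‖b3‖ = 1)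
    (C : ℝ) (hC : ∀ x : E3, ‖x‖ = 1 → PP w D x ≤
      C * ((1 - inner ℝ x b1 ^ 2) * (1 - inner ℝ x b2 ^ 2) * (1 - inner ℝ x b3 ^ 2))) :
    ∀ x : E3, x ≠ 0 → D x = 0 := by
  suffices H : ∀ x : E3, ‖x‖ = 1 → D x = 0 by
    intro x hx
    have := H (‖x‖⁻¹ • x) (by simp [norm_smul, hx])
    rwa [d.hD.hom _ (by positivity)] at this
  intro b0 n0
  by_contra hD0
  have hS : IsCompact (Metric.sphere (0 : E3) 1) := isCompact_sphere 0 1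
  have memS : ∀ x : E3, x ∈ Metric.sphere (0 : E3) 1 ↔ ‖x‖ = 1 := by intro x; simp
  have hPc := (PP_cont d.hw d.hD).mono sphere_sub
  have hDc := (d.hD.smooth.continuousOn).mono sphere_sub
  have hMc := (d.hM.smooth.continuousOn).mono sphere_sub
  have hP0 : 0 < PP w D b0 := by
    unfold PP
    have : 0 < D b0 ^ 2 := by positivity
    nlinarith [sq_nonneg (‖b0‖ * ‖fderiv ℝ w b0‖)]
  obtain ⟨xp, hxp, hxpm⟩ := hS.exists_isMaxOn ⟨b0, (memS _).2 n0⟩ hPc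
  set Pm := PP w D xp with hPm
  have hPm0 : 0 < Pm := lt_of_lt_of_le hP0 (hxpm ((memS _).2 n0))
  have hDD : 0 < D b0 ^ 2 := by positivity
  set τ := (lam - 2) * D b0 ^ 2 / Pm with hτ
  have hτ0 : 0 < τ := by
    rw [hτ]; have : 0 < lam - 2 := by linarith
    positivity
  -- neighbourhood of b0
  obtain ⟨s1, hs1, hs1'⟩ : ∃ s1 < (1:ℝ), ∀ x : E3, ‖x‖ = 1 → s1 < inner ℝ x b0 → D b0 ^ 2 / 2 ≤ D x ^ 2 := by
    have hcont : ContinuousAt (fun x => D x ^ 2) b0 := by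
      refine ContinuousAt.pow ?_ 2
      exact (d.hD.df (by intro h; rw [h] at n0; simp at n0)).continuousAt
    have hev := hcont.eventually (isOpen_Ioi.mem_nhds (show D b0 ^ 2 / 2 < D b0 ^ 2 by linarith))
    obtain ⟨r, hr, hr'⟩ := Metric.eventually_nhds_iff.1 hev
    refine ⟨1 - r ^ 2 / 2, by nlinarith, ?_⟩
    intro x hx hs
    refine le_of_lt (hr' ?_)
    have : ‖x - b0‖ ^ 2 < r ^ 2 := by
      rw [norm_sub_sq_real, hx, n0]; linarith
    rw [dist_eq_norm]
    exact lt_of_pow_lt_pow_left₀ 2 hr.le this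
  set σ := 1 - s1 with hσ
  have hσ0 : 0 < σ := by rw [hσ]; linarith
  set η := min 1 (σ ^ 2 / 4) with hη
  have hη0 : 0 < η := by positivity
  have hη1 : η ≤ 1 := min_le_left _ _
  have hη2 : η ≤ σ ^ 2 / 4 := min_le_right _ _
  set ep := η * τ / 4 with hep
  have hep0 : 0 < ep := by positivity
  set a0 := σ ^ 2 / 18 with ha0
  have ha00 : 0 < a0 := by positivity
  set δ := min (1/2) (min (ep * a0) (τ / 2) / 12) with hδ
  have hδ0 : 0 < δ := by positivity
  have hδ1 : 6 * δ < ep * a0 := by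
    have h1 : δ ≤ min (ep * a0) (τ / 2) / 12 := min_le_right _ _
    have h2 : min (ep * a0) (τ / 2) ≤ ep * a0 := min_le_left _ _
    have : 0 < ep * a0 := by positivity
    linarith
  have hδ2 : 6 * δ < τ / 2 := by
    have h1 : δ ≤ min (ep * a0) (τ / 2) / 12 := min_le_right _ _
    have h2 : min (ep * a0) (τ / 2) ≤ τ / 2 := min_le_right _ _
    linarith
  have one_sub := one_sub_inner
  have ile : ∀ x b : E3, ‖x‖ = 1 → ‖b‖ = 1 → inner ℝ x b ≤ (1:ℝ) := by
    intro x b hx hb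
    have := one_sub x b hx hb; nlinarith
  have ige : ∀ x b : E3, ‖x‖ = 1 → ‖b‖ = 1 → -1 ≤ inner ℝ x b := by
    intro x b hx hb
    have := one_sub x b hx hb; nlinarith
  obtain ⟨x, hxS, hPx, hqx, hmax⟩ := exists_max hS (P := PP w D)
    (q := fun x => (1 - inner ℝ x b1 ^ 2) * (1 - inner ℝ x b2 ^ 2) * (1 - inner ℝ x b3 ^ 2))
    (g := fun x => Real.exp (- M x) * Real.exp (- ep * Real.log (1 + η - inner ℝ x b0)))
    hPc (by fun_prop) (by
      refine (Real.continuous_exp.comp_continuousOn hMc.neg).mul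
        (Real.continuous_exp.comp_continuousOn (continuousOn_const.mul (ContinuousOn.log (by fun_prop) ?_)))
      intro z hz
      have := ile z b0 ((memS z).1 hz) n0
      linarith)
    (fun z _ => PP_nonneg _ _ z)
    (by
      intro z hz
      have hz' := (memS z).1 hz
      exact mul_nonneg (mul_nonneg (one_sub _ _ hz' n1) (one_sub _ _ hz' n2)) (one_sub _ _ hz' n3))
    (by intro z hz; positivity) C (fun z hz => hC z ((memS z).1 hz)) δ hδ0 b0 ((memS _).2 n0) hP0
  have nx := (memS x).1 hxS
  obtain ⟨a, ha⟩ := exists_onb2 x nx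
  have p1 := one_sub x b1 nx n1
  have p2 := one_sub x b2 nx n2
  have p3 := one_sub x b3 nx n3
  have hp1 : 0 < 1 - inner ℝ x b1 ^ 2 := by
    rcases p1.lt_or_eq with h | h
    · exact h
    · simp only [← h, zero_mul] at hqx; exact absurd hqx (lt_irrefl _)
  have hp2 : 0 < 1 - inner ℝ x b2 ^ 2 := by
    rcases p2.lt_or_eq with h | h
    · exact h
    · simp only [← h, zero_mul, mul_zero] at hqx; exact absurd hqx (lt_irrefl _)
  have hp3 : 0 < 1 - inner ℝ x b3 ^ 2 := by
    rcases p3.lt_or_eq with h | h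
    · exact h
    · simp only [← h, mul_zero] at hqx; exact absurd hqx (lt_irrefl _)
  rw [← ha] at hp1 hp2 hp3
  obtain ⟨c1, l1⟩ := lapl_zero_fn a b1 n1 hp1
  obtain ⟨c2, l2⟩ := lapl_zero_fn a b2 n2 hp2
  obtain ⟨c3, l3⟩ := lapl_zero_fn a b3 n3 hp3
  obtain ⟨c4, l4⟩ := lapl_pole_fn a b0 n0 η hη0
  set f1 := fun y => Real.log (1 - (inner ℝ (ch a y) b1 / NN y) ^ 2) with hf1
  set f2 := fun y => Real.log (1 - (inner ℝ (ch a y) b2 / NN y) ^ 2) with hf2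
  set f3 := fun y => Real.log (1 - (inner ℝ (ch a y) b3 / NN y) ^ 2) with hf3
  set f4 := fun y => Real.log (1 + η - inner ℝ (ch a y) b0 / NN y) with hf4
  have c12 := c1.add c2
  have c123 := c12.add c3
  have c123' : ContDiffAt ℝ 2 (fun y => (1 - δ) * (f1 y + f2 y + f3 y)) 0 := contDiffAt_const.mul c123
  have c4' : ContDiffAt ℝ 2 (fun y => ep * f4 y) 0 := contDiffAt_const.mul c4
  have cl := c123'.add c4'
  have ll : lapl (fun y => (1 - δ) * (f1 y + f2 y + f3 y) + ep * f4 y) 0 =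
      (1 - δ) * (-24) + ep * lapl f4 0 := by
    rw [lapl_add c123' c4', lapl_cmul _ c123, lapl_cmul _ c4, lapl_add c12 c3, lapl_add c1 c2, l1, l2, l3]
    norm_num
  -- local max
  have hu : ∀ y : ℝ × ℝ, ‖(NN y)⁻¹ • ch a y‖ = 1 := by
    intro y; rw [norm_smul, ch_norm, Real.norm_eq_abs, abs_of_pos (inv_pos.2 (NN_pos y)),
      inv_mul_cancel₀ (NN_pos y).ne']
  have hin : ∀ (y : ℝ × ℝ) (b : E3), inner ℝ ((NN y)⁻¹ • ch a y) b = inner ℝ (ch a y) b / NN y := by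
    intro y b; rw [inner_smul_left]; simp; ring
  have hx0 : x ≠ 0 := by intro h; rw [h] at nx; simp at nx
  have hN0 : NN 0 = 1 := by simp [NN]
  -- value formula
  have val : ∀ y, 0 < PP w D (ch a y) → 0 < 1 - (inner ℝ (ch a y) b1 / NN y) ^ 2 →
      0 < 1 - (inner ℝ (ch a y) b2 / NN y) ^ 2 → 0 < 1 - (inner ℝ (ch a y) b3 / NN y) ^ 2 →
      Real.log (PP w D (ch a y)) - M (ch a y) - ((1 - δ) * (f1 y + f2 y + f3 y) + ep * f4 y) ≤
      Real.log (PP w D x) + Real.log (Real.exp (- M x) * Real.exp (- ep * Real.log (1 + η - inner ℝ x b0)))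
       - (1 - δ) * Real.log ((1 - inner ℝ x b1 ^ 2) * (1 - inner ℝ x b2 ^ 2) * (1 - inner ℝ x b3 ^ 2)) := by
    intro y h1 h2 h3 h4
    have hN := inv_pos.2 (NN_pos y)
    have h5 := PP_smul d.hw d.hD hN (ch_ne a y)
    have := hmax ((NN y)⁻¹ • ch a y) ((memS _).2 (hu y)) (by rw [h5]; exact h1)
      (by simp only [hin]; positivity)
    refine le_trans (le_of_eq ?_) this
    simp only [hin, h5, d.hM.hom _ hN]
    rw [← Real.exp_add, Real.log_exp, Real.log_mul (by positivity) (by positivity),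
      Real.log_mul (by positivity) (by positivity)]
    simp only [hf1, hf2, hf3, hf4]
    ring
  have ev : ∀ b : E3, 0 < 1 - inner ℝ (a 2) b ^ 2 → ∀ᶠ y in 𝓝 (0 : ℝ × ℝ),
      0 < 1 - (inner ℝ (ch a y) b / NN y) ^ 2 := by
    intro b hb
    have hc : Continuous (fun y => 1 - (inner ℝ (ch a y) b / NN y) ^ 2) := by
      have := (ch_smooth a).continuous
      have := NN_smooth.continuous
      have : ∀ y, NN y ≠ 0 := fun y => (NN_pos y).ne'
      fun_prop (disch := assumption)
    refine hc.continuousAt.eventually (isOpen_Ioi.mem_nhds ?_)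
    simpa [hN0, ch_zero] using hb
  have evP : ∀ᶠ y in 𝓝 (0 : ℝ × ℝ), 0 < PP w D (ch a y) := by
    have hc : Continuous (fun y => PP w D (ch a y)) :=
      (PP_cont d.hw d.hD).comp_continuous (ch_smooth a).continuous (fun y => ch_ne a y)
    refine hc.continuousAt.eventually (isOpen_Ioi.mem_nhds ?_)
    simpa [ch_zero, ha] using hPx
  have hlm : IsLocalMax (fun y => Real.log (PP w D (ch a y)) - M (ch a y)
      - ((1 - δ) * (f1 y + f2 y + f3 y) + ep * f4 y)) 0 := by
    filter_upwards [ev b1 hp1, ev b2 hp2, ev b3 hp3, evP] with y h1 h2 h3 h4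
    refine (val y h4 h1 h2 h3).trans (le_of_eq ?_)
    simp only [hf1, hf2, hf3, hf4, ch_zero, hN0, div_one]
    rw [← Real.exp_add, Real.log_exp, ← ha, Real.log_mul (by positivity) (by positivity),
      Real.log_mul (by positivity) (by positivity)]
    ring
  have key := max_ineq d a h2.le (by rw [ha]; exact hPx) _ cl hlm
  rw [ll, l4, ha] at key
  set sx := inner ℝ x b0 with hsx
  have sx1 : sx ≤ 1 := ile x b0 nx n0
  have sxm : -1 ≤ sx := ige x b0 nx n0
  set A := (2 * sx * η - (1 - sx) ^ 2) / (1 + η - sx) ^ 2 with hA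
  have hden : 0 < 1 + η - sx := by linarith
  have key2 : 6 * δ + ep * A ≥ 2 * (lam - 2) * D x ^ 2 / PP w D x := by
    have e : 2 * (lam - 2) * D x ^ 2 / PP w D x = (lam - 2) * (2 * D x ^ 2 / PP w D x) := by ring
    rw [e]
    nlinarith
  have hτn : 0 ≤ 2 * (lam - 2) * D x ^ 2 / PP w D x := by
    have : 0 < lam - 2 := by linarith
    positivity
  by_cases hcase : s1 < sx
  · have hDx := hs1' x nx hcase
    have hPle : PP w D x ≤ Pm := hxpm hxS
    have h3 : τ ≤ 2 * (lam - 2) * D x ^ 2 / PP w D x := by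
      rw [hτ]
      have h0 : 0 < lam - 2 := by linarith
      have hn : 0 ≤ 2 * (lam - 2) * D x ^ 2 := by positivity
      apply div_le_div₀ hn _ hPx hPle
      nlinarith
    have hA2 : A ≤ 2 / η := A_le1 hη0 sx1
    have : ep * A ≤ τ / 2 := by
      calc ep * A ≤ ep * (2 / η) := mul_le_mul_of_nonneg_left hA2 hep0.le
        _ = τ / 2 := by rw [hep]; field_simp; norm_num
    linarith
  · have hs := not_lt.1 hcase
    have hσs : σ ≤ 1 - sx := by rw [hσ]; linarith
    have hA2 : A ≤ - a0 := A_le2 hη0 hη1 hη2 hσ0 sx1 sxm hσs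
    have : ep * A ≤ - (ep * a0) := by nlinarith
    linarith
end MF

namespace MF
open scoped ContDiff Topology
open Filter

/-! ### Orders of vanishing -/

def OO (k : ℕ) (f : ℝ × ℝ → ℝ) : Prop := ∃ C : ℝ, 0 ≤ C ∧ ∀ y, ‖y‖ ≤ 1 → |f y| ≤ C * ‖y‖ ^ k

theorem OO_zero {f : ℝ × ℝ → ℝ} (hf : ContDiff ℝ ∞ f) : OO 0 f := by
  obtain ⟨C, hC⟩ := (isCompact_closedBall (0 : ℝ × ℝ) 1).exists_bound_of_continuousOn
    hf.continuous.continuousOn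
  refine ⟨|C|, abs_nonneg _, fun y hy => ?_⟩
  have := hC y (by simpa using hy)
  simpa using this.trans (le_abs_self C)

theorem fd_dxdy (f : ℝ × ℝ → ℝ) (y v : ℝ × ℝ) : fderiv ℝ f y v = v.1 * dx f y + v.2 * dy f y := by
  have : v = v.1 • ((1:ℝ), (0:ℝ)) + v.2 • ((0:ℝ), (1:ℝ)) := by ext <;> simp
  conv_lhs => rw [this]
  rw [map_add, map_smul, map_smul]; rfl

theorem OO_succ {k : ℕ} {f : ℝ × ℝ → ℝ} (hf : ContDiff ℝ ∞ f) (h0 : f 0 = 0)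
    (h1 : OO k (dx f)) (h2 : OO k (dy f)) : OO (k + 1) f := by
  obtain ⟨C1, hC1, h1⟩ := h1
  obtain ⟨C2, hC2, h2⟩ := h2
  refine ⟨C1 + C2, by positivity, fun y hy => ?_⟩
  have key := (convex_closedBall (0 : ℝ × ℝ) ‖y‖).norm_image_sub_le_of_norm_fderiv_le (𝕜 := ℝ)
    (f := f) (C := (C1 + C2) * ‖y‖ ^ k) (x := 0) (y := y) (fun z _ => hf.mdf z) ?_ (by simp) (by simp)
  · rw [h0, sub_zero, sub_zero, Real.norm_eq_abs] at key
    rw [pow_succ, ← mul_assoc]; exact key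
  · intro z hz
    have hz' : ‖z‖ ≤ ‖y‖ := by simpa using hz
    refine ContinuousLinearMap.opNorm_le_bound _ (by positivity) fun v => ?_
    rw [fd_dxdy, Real.norm_eq_abs]
    have a1 := h1 z (hz'.trans hy)
    have a2 := h2 z (hz'.trans hy)
    have p : ‖z‖ ^ k ≤ ‖y‖ ^ k := pow_le_pow_left₀ (norm_nonneg _) hz' k
    have b1 : |dx f z| ≤ C1 * ‖y‖ ^ k := a1.trans (mul_le_mul_of_nonneg_left p hC1)
    have b2 : |dy f z| ≤ C2 * ‖y‖ ^ k := a2.trans (mul_le_mul_of_nonneg_left p hC2)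
    have v1 : |v.1| ≤ ‖v‖ := norm_fst_le v
    have v2 : |v.2| ≤ ‖v‖ := norm_snd_le v
    calc |v.1 * dx f z + v.2 * dy f z| ≤ |v.1| * |dx f z| + |v.2| * |dy f z| := by
          rw [← abs_mul, ← abs_mul]; exact abs_add_le _ _
      _ ≤ ‖v‖ * (C1 * ‖y‖ ^ k) + ‖v‖ * (C2 * ‖y‖ ^ k) := by gcongr
      _ = _ := by ring

theorem OO_one {f : ℝ × ℝ → ℝ} (hf : ContDiff ℝ ∞ f) (h0 : f 0 = 0) : OO 1 f :=
  OO_succ hf h0 (OO_zero hf.mdx) (OO_zero hf.mdy)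

/-- vanishing at the unit vector `b` to order `k`. -/
def Sg (w : E3 → ℝ) (b : E3) (k : ℕ) : Prop :=
  ∃ C : ℝ, 0 ≤ C ∧ ∀ x : E3, ‖x‖ = 1 → ‖fderiv ℝ w x‖ ^ 2 + w x ^ 2 ≤ C * (1 - inner ℝ x b ^ 2) ^ k

theorem ch_surj (a : ONB) (x : E3) (hx : ‖x‖ = 1) (h : 0 ≤ inner ℝ x (a 2)) :
    ∃ y : ℝ × ℝ, y.1 ^ 2 + y.2 ^ 2 ≤ 1 ∧ ch a y = NN y • x ∧
      1 - inner ℝ x (a 2) ^ 2 = 4 * (y.1 ^ 2 + y.2 ^ 2) / NN y ^ 2 := by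
  have e := onb_expand a x
  have n := onb_normsq a x
  rw [hx] at n
  rw [real_inner_comm] at h ⊢
  set x0 := inner ℝ (a 0) x
  set x1 := inner ℝ (a 1) x
  set x2 := inner ℝ (a 2) x
  have hp : 0 < 1 + x2 := by linarith
  have hsum : (x0 / (1 + x2)) ^ 2 + (x1 / (1 + x2)) ^ 2 = (1 - x2) / (1 + x2) := by
    field_simp; nlinarith
  have hN : NN (x0 / (1 + x2), x1 / (1 + x2)) = 2 / (1 + x2) := by
    unfold NN; simp only
    rw [add_assoc, hsum]; field_simp; ring
  refine ⟨(x0 / (1 + x2), x1 / (1 + x2)), ?_, ?_, ?_⟩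
  · simp only; rw [hsum, div_le_one hp]; linarith
  · rw [hN]
    conv_rhs => rw [e]
    unfold ch
    simp only
    rw [sub_sub, hsum, smul_add, smul_add, smul_smul, smul_smul, smul_smul]
    have e0 : 2 * (x0 / (1 + x2)) = 2 / (1 + x2) * x0 := by ring
    have e1 : 2 * (x1 / (1 + x2)) = 2 / (1 + x2) * x1 := by ring
    have e2 : 1 - (1 - x2) / (1 + x2) = 2 / (1 + x2) * x2 := by field_simp; ring
    rw [e0, e1, e2]
  · simp only; rw [hN, hsum]; field_simp; ring

theorem fd_even {w : E3 → ℝ} (he : ∀ x, w (-x) = w x) (x v : E3) :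
    fderiv ℝ w (-x) v = - fderiv ℝ w x v := by
  have e : (fun z => w (-z)) = w := funext he
  have h := fderiv_comp_smul (𝕜 := ℝ) (f := w) (x := x) (c := (-1:ℝ))
  simp only [neg_smul, one_smul, e] at h
  rw [h]; simp

theorem Sg_of_OO {w : E3 → ℝ} (hw : Hom0 w) (he : ∀ x, w (-x) = w x) (a : ONB) (k : ℕ)
    (h : OO k (fun y => w (ch a y))) (h1 : OO k (dx fun y => w (ch a y)))
    (h2 : OO k (dy fun y => w (ch a y))) : Sg w (a 2) k := by
  obtain ⟨C0, hC0, h0⟩ := h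
  obtain ⟨C1, hC1, h1⟩ := h1
  obtain ⟨C2, hC2, h2⟩ := h2
  set K : ℝ := (C1 ^ 2 + C2 ^ 2 + C0 ^ 2) with hK
  have hK0 : 0 ≤ K := by positivity
  have main : ∀ x : E3, ‖x‖ = 1 → 0 ≤ inner ℝ x (a 2) →
      ‖fderiv ℝ w x‖ ^ 2 + w x ^ 2 ≤ K * (1 - inner ℝ x (a 2) ^ 2) ^ k := by
    intro x hx hs
    obtain ⟨y, hy, hch, hsin⟩ := ch_surj a x hx hs
    have hx0 : x ≠ 0 := by intro h; rw [h] at hx; simp at hx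
    have hN := NN_pos y
    have hN2 : NN y ≤ 2 := by unfold NN; linarith
    have hyn : ‖y‖ ^ 2 ≤ y.1 ^ 2 + y.2 ^ 2 := by
      rw [Prod.norm_def, Real.norm_eq_abs, Real.norm_eq_abs]
      rcases max_cases |y.1| |y.2| with h | h <;> rw [h.1, sq_abs] <;> nlinarith [sq_nonneg y.1, sq_nonneg y.2]
    have hy1 : ‖y‖ ≤ 1 := by
      have : ‖y‖ ^ 2 ≤ 1 := by linarith
      nlinarith [norm_nonneg y]
    have g1 := h1 y hy1
    have g2 := h2 y hy1
    have g0 := h0 y hy1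
    simp only [hch, hw.hom _ hN] at g0
    have gr := chart_grad hw a y
    have efd : fderiv ℝ w (ch a y) = (NN y)⁻¹ • fderiv ℝ w x := by
      rw [hch]; ext v; rw [hw.fd_smul hN hx0]; rfl
    rw [efd, norm_smul, Real.norm_eq_abs, abs_of_pos (inv_pos.2 hN)] at gr
    have hfd : ‖fderiv ℝ w x‖ ^ 2 ≤ dx (fun y => w (ch a y)) y ^ 2 + dy (fun y => w (ch a y)) y ^ 2 := by
      rw [gr]
      have : (1:ℝ) ≤ 4 * ((NN y)⁻¹) ^ 2 := by
        have : (2:ℝ)⁻¹ ≤ (NN y)⁻¹ := by gcongr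
        nlinarith
      rw [mul_pow, ← mul_assoc]
      nlinarith [sq_nonneg ‖fderiv ℝ w x‖]
    have q : ∀ t c : ℝ, |t| ≤ c * ‖y‖ ^ k → t ^ 2 ≤ c ^ 2 * (‖y‖ ^ 2) ^ k := by
      intro t c ht
      have := pow_le_pow_left₀ (abs_nonneg t) ht 2
      rw [sq_abs] at this
      calc t ^ 2 ≤ _ := this
        _ = _ := by ring
    have a1 := q _ _ g1
    have a2 := q _ _ g2
    have a0 := q _ _ g0
    have pw : (‖y‖ ^ 2) ^ k ≤ (1 - inner ℝ x (a 2) ^ 2) ^ k := by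
      refine pow_le_pow_left₀ (by positivity) ?_ k
      rw [hsin, le_div_iff₀ (by positivity)]
      have : NN y ^ 2 ≤ 4 := by nlinarith
      calc ‖y‖ ^ 2 * NN y ^ 2 ≤ (y.1 ^ 2 + y.2 ^ 2) * 4 := by gcongr
        _ = _ := by ring
    calc ‖fderiv ℝ w x‖ ^ 2 + w x ^ 2 ≤ K * (‖y‖ ^ 2) ^ k := by rw [hK]; linarith
      _ ≤ _ := by gcongr
  refine ⟨K, hK0, fun x hx => ?_⟩
  by_cases hs : 0 ≤ inner ℝ x (a 2)
  · exact main x hx hs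
  · have := main (-x) (by simpa using hx) (by rw [inner_neg_left]; linarith)
    have e : fderiv ℝ w (-x) = - fderiv ℝ w x := by ext v; rw [fd_even he]; rfl
    rw [e, norm_neg, he, inner_neg_left, neg_sq] at this
    exact this

/-- Functions to which the vanishing theorem applies. -/
def ED (lam : ℝ) (w : E3 → ℝ) : Prop :=
  ∃ (ε : ℝ) (D s M : E3 → ℝ), Datum lam ε w D s M ∧ (∃ C, ∀ x, ‖x‖ = 1 → |D x| ≤ C * |w x|) ∧
    (∀ x, x ≠ 0 → D x = 0 → w x = 0) ∧ ∀ x, w (-x) = w x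

theorem ED.vanish {lam : ℝ} {w : E3 → ℝ} (h : ED lam w)
    (h2 : 2 < lam) (h8 : lam ≤ 8) (b1 b2 b3 : E3) (n1 : ‖b1‖ = 1) (n2 : ‖b2‖ = 1) (n3 : ‖b3‖ = 1)
    (C : ℝ) (hC : ∀ x : E3, ‖x‖ = 1 → ‖fderiv ℝ w x‖ ^ 2 + w x ^ 2 ≤
      C * ((1 - inner ℝ x b1 ^ 2) * (1 - inner ℝ x b2 ^ 2) * (1 - inner ℝ x b3 ^ 2))) :
    ∀ x : E3, x ≠ 0 → w x = 0 := by
  obtain ⟨ε, D, s, M, d, ⟨K, hK⟩, hDw, -⟩ := h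
  intro x hx
  refine hDw x hx (D_vanish d h2 h8 b1 b2 b3 n1 n2 n3 ((1 + 2 * K ^ 2) * C) ?_ x hx)
  intro z hz
  have hD : D z ^ 2 ≤ K ^ 2 * w z ^ 2 := by
    have := pow_le_pow_left₀ (abs_nonneg _) (hK z hz) 2
    rwa [mul_pow, sq_abs, sq_abs] at this
  unfold PP
  rw [hz, mul_assoc]
  calc (1:ℝ) ^ 2 * ‖fderiv ℝ w z‖ ^ 2 + 2 * D z ^ 2 ≤ (1 + 2 * K ^ 2) * (‖fderiv ℝ w z‖ ^ 2 + w z ^ 2) := by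
        nlinarith [sq_nonneg ‖fderiv ℝ w z‖, sq_nonneg (w z), mul_nonneg (sq_nonneg K) (sq_nonneg ‖fderiv ℝ w z‖)]
    _ ≤ _ := mul_le_mul_of_nonneg_left (hC z hz) (by positivity)

/-- combining bounds -/
theorem combine {Q A B : E3 → ℝ} (hQ : ∀ x, 0 ≤ Q x) (hA : Continuous A) (hB : Continuous B)
    (A0 : ∀ x, ‖x‖ = 1 → 0 ≤ A x) (B0 : ∀ x, ‖x‖ = 1 → 0 ≤ B x)
    (hAB : ∀ x, ‖x‖ = 1 → A x = 0 → B x = 0 → False) (C1 C2 : ℝ)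
    (h1 : ∀ x, ‖x‖ = 1 → Q x ≤ C1 * A x) (h2 : ∀ x, ‖x‖ = 1 → Q x ≤ C2 * B x) :
    ∃ C, 0 ≤ C ∧ ∀ x, ‖x‖ = 1 → Q x ≤ C * (A x * B x) := by
  have hS : IsCompact (Metric.sphere (0 : E3) 1) := isCompact_sphere 0 1
  have hne : (Metric.sphere (0 : E3) 1).Nonempty := NormedSpace.sphere_nonempty.2 zero_le_one
  obtain ⟨m, hm, hmm⟩ := hS.exists_isMinOn hne (hA.add hB).continuousOn
  have hm1 : ‖m‖ = 1 := by simpa using hm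
  have hpos : 0 < A m + B m := by
    have a := A0 m hm1
    have b := B0 m hm1
    rcases (add_nonneg a b).lt_or_eq with h | h
    · exact h
    · exact absurd (hAB m hm1 (by linarith) (by linarith)) id
  refine ⟨|C1 + C2| / (A m + B m), by positivity, fun x hx => ?_⟩
  have hmx : A m + B m ≤ A x + B x := hmm (show x ∈ Metric.sphere (0:E3) 1 by simpa using hx)
  rw [div_mul_eq_mul_div, le_div_iff₀ hpos]
  have a := A0 x hx
  have b := B0 x hx
  have p1 := mul_le_mul_of_nonneg_right (h1 x hx) b
  have p2 := mul_le_mul_of_nonneg_right (h2 x hx) a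
  calc Q x * (A m + B m) ≤ Q x * (A x + B x) := mul_le_mul_of_nonneg_left hmx (hQ x)
    _ ≤ (C1 + C2) * (A x * B x) := by nlinarith
    _ ≤ _ := mul_le_mul_of_nonneg_right (le_abs_self _) (mul_nonneg a b)

theorem unit_par {x b : E3} (hx : ‖x‖ = 1) (hb : ‖b‖ = 1) (h : inner ℝ x b ^ 2 = 1) :
    x = (inner ℝ x b : ℝ) • b := by
  have : ‖x - (inner ℝ x b : ℝ) • b‖ ^ 2 = 0 := by
    rw [norm_sub_sq_real, norm_smul, inner_smul_right, hx, hb, mul_one, Real.norm_eq_abs, sq_abs]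
    linarith
  have : x - (inner ℝ x b : ℝ) • b = 0 := by simpa using this
  exact sub_eq_zero.1 this

theorem unit_no_common {x b q : E3} (hx : ‖x‖ = 1) (hb : ‖b‖ = 1) (hbq : inner ℝ b q ^ 2 ≠ (1:ℝ))
    (h1 : 1 - inner ℝ x b ^ 2 = 0) (h2 : 1 - inner ℝ x q ^ 2 = 0) : False := by
  have e := unit_par hx hb (by linarith)
  apply hbq
  have : inner ℝ x q = inner ℝ x b * inner ℝ b q := by
    conv_lhs => rw [e]
    rw [inner_smul_left]; simp
  rw [this, mul_pow] at h2
  have h3 : inner ℝ x b ^ 2 = (1:ℝ) := by linarith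
  rw [h3] at h2; linarith

section

theorem pattA {lam : ℝ} {w : E3 → ℝ} (h : ED lam w) (h2 : 2 < lam) (h8 : lam ≤ 8)
    {b : E3} (hb : ‖b‖ = 1) (h3 : Sg w b 3) : ∀ x : E3, x ≠ 0 → w x = 0 := by
  obtain ⟨C, -, hC⟩ := h3
  refine h.vanish h2 h8 b b b hb hb hb C fun x hx => (hC x hx).trans (le_of_eq ?_)
  ring

theorem pattB {lam : ℝ} {w : E3 → ℝ} (h : ED lam w) (h2 : 2 < lam) (h8 : lam ≤ 8)
    {b q : E3} (hb : ‖b‖ = 1) (hq : ‖q‖ = 1) (hbq : inner ℝ b q ^ 2 ≠ (1:ℝ))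
    (hB : Sg w b 2) (hQ : Sg w q 1) : ∀ x : E3, x ≠ 0 → w x = 0 := by
  obtain ⟨C1, -, hC1⟩ := hB
  obtain ⟨C2, -, hC2⟩ := hQ
  obtain ⟨C, -, hC⟩ := combine (Q := fun x => ‖fderiv ℝ w x‖ ^ 2 + w x ^ 2)
    (A := fun x => (1 - inner ℝ x b ^ 2) ^ 2) (B := fun x => (1 - inner ℝ x q ^ 2) ^ 1)
    (fun x => by positivity) (by fun_prop) (by fun_prop) (fun x hx => by positivity)
    (fun x hx => by simpa only [pow_one] using one_sub_inner x q hx hq)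
    (fun x hx e1 e2 => unit_no_common hx hb hbq (by simpa using e1) (by simpa using e2)) C1 C2 hC1 hC2
  refine h.vanish h2 h8 b b q hb hb hq C fun x hx => (hC x hx).trans (le_of_eq ?_)
  ring

theorem pattC {lam : ℝ} {w : E3 → ℝ} (h : ED lam w) (h2 : 2 < lam) (h8 : lam ≤ 8)
    {b1 b2 b3 : E3} (n1 : ‖b1‖ = 1) (n2 : ‖b2‖ = 1) (n3 : ‖b3‖ = 1)
    (h12 : inner ℝ b1 b2 ^ 2 ≠ (1:ℝ)) (h13 : inner ℝ b1 b3 ^ 2 ≠ (1:ℝ)) (h23 : inner ℝ b2 b3 ^ 2 ≠ (1:ℝ))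
    (H1 : Sg w b1 1) (H2 : Sg w b2 1) (H3 : Sg w b3 1) : ∀ x : E3, x ≠ 0 → w x = 0 := by
  obtain ⟨C1, -, hC1⟩ := H1
  obtain ⟨C2, -, hC2⟩ := H2
  obtain ⟨C3, -, hC3⟩ := H3
  simp only [pow_one] at hC1 hC2 hC3
  have o1 := fun x hx => one_sub_inner x b1 hx n1
  have o2 := fun x hx => one_sub_inner x b2 hx n2
  obtain ⟨C, -, hC⟩ := combine (Q := fun x => ‖fderiv ℝ w x‖ ^ 2 + w x ^ 2)
    (A := fun x => 1 - inner ℝ x b1 ^ 2) (B := fun x => 1 - inner ℝ x b2 ^ 2)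
    (fun x => by positivity) (by fun_prop) (by fun_prop) o1 o2
    (fun x hx e1 e2 => unit_no_common hx n1 h12 e1 e2) C1 C2 hC1 hC2
  obtain ⟨C', -, hC'⟩ := combine (Q := fun x => ‖fderiv ℝ w x‖ ^ 2 + w x ^ 2)
    (A := fun x => (1 - inner ℝ x b1 ^ 2) * (1 - inner ℝ x b2 ^ 2)) (B := fun x => 1 - inner ℝ x b3 ^ 2)
    (fun x => by positivity) (by fun_prop) (by fun_prop)
    (fun x hx => mul_nonneg (o1 x hx) (o2 x hx)) (fun x hx => one_sub_inner x b3 hx n3)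
    (fun x hx e1 e2 => by
      rcases mul_eq_zero.1 e1 with e | e
      · exact unit_no_common hx n1 h13 e e2
      · exact unit_no_common hx n2 h23 e e2) C C3 hC hC3
  exact h.vanish h2 h8 b1 b2 b3 n1 n2 n3 C' hC'
end

theorem ED.hom {lam : ℝ} {w : E3 → ℝ} (h : ED lam w) : Hom0 w := by
  obtain ⟨ε, D, s, M, d, -⟩ := h; exact d.hw
theorem ED.even {lam : ℝ} {w : E3 → ℝ} (h : ED lam w) : ∀ x, w (-x) = w x := by
  obtain ⟨ε, D, s, M, d, -, -, h⟩ := h; exact h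

theorem dx_zero {w : E3 → ℝ} (hw : Hom0 w) (a : ONB) :
    dx (fun y => w (ch a y)) 0 = 2 * fderiv ℝ w (a 2) (a 0) := by
  unfold dx; rw [chart_fd hw, ch_zero]; simp [chd]
theorem dy_zero {w : E3 → ℝ} (hw : Hom0 w) (a : ONB) :
    dy (fun y => w (ch a y)) 0 = 2 * fderiv ℝ w (a 2) (a 1) := by
  unfold dy; rw [chart_fd hw, ch_zero]; simp [chd]

/-- singular zeros have order one. -/
theorem Sg_one {w : E3 → ℝ} (hw : Hom0 w) (he : ∀ x, w (-x) = w x) {b : E3} (hb : ‖b‖ = 1)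
    (h0 : w b = 0) (h1 : fderiv ℝ w b = 0) : Sg w b 1 := by
  obtain ⟨a, ha⟩ := exists_onb2 b hb
  have sm := chart_smooth hw a
  rw [← ha]
  refine Sg_of_OO hw he a 1 (OO_one sm ?_) (OO_one sm.mdx ?_) (OO_one sm.mdy ?_)
  · simp only [ch_zero, ha, h0]
  · rw [dx_zero hw, ha, h1]; simp
  · rw [dy_zero hw, ha, h1]; simp
end MF

namespace MF
open scoped ContDiff Topology
open Filter

/-! ### Reflections and the criteria C1, C2 -/

def rf (n : E3) : E3 ≃ₗᵢ[ℝ] E3 := (ℝ ∙ n)ᗮ.reflection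

theorem rf_apply {n : E3} (hn : ‖n‖ = 1) (x : E3) : rf n x = x - (2 * inner ℝ n x : ℝ) • n := by
  unfold rf
  rw [Submodule.reflection_orthogonal_apply, Submodule.reflection_singleton_apply, hn]
  simp
  rw [two_nsmul, ← add_smul]
  congr 2; ring

theorem onb_norm (a : ONB) (i : Fin 3) : ‖a i‖ = 1 := a.norm_eq_one i

theorem rf_ch (a : ONB) (y : ℝ × ℝ) : rf (a 0) (ch a y) = ch a (-y.1, y.2) := by
  rw [rf_apply (onb_norm a 0), ch_i0]
  unfold ch
  simp only [neg_sq]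
  module

def OddX (f : ℝ × ℝ → ℝ) : Prop := ∀ y : ℝ × ℝ, f (-y.1, y.2) = - f y
def EvX (f : ℝ × ℝ → ℝ) : Prop := ∀ y : ℝ × ℝ, f (-y.1, y.2) = f y

def negX : ℝ × ℝ →L[ℝ] ℝ × ℝ :=
  (- ContinuousLinearMap.fst ℝ ℝ ℝ).prod (ContinuousLinearMap.snd ℝ ℝ ℝ)

theorem negX_apply (y : ℝ × ℝ) : negX y = (-y.1, y.2) := rfl

theorem fd_negX {f : ℝ × ℝ → ℝ} (hf : ContDiff ℝ ∞ f) (y v : ℝ × ℝ) :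
    fderiv ℝ (fun z : ℝ × ℝ => f (-z.1, z.2)) y v = fderiv ℝ f (-y.1, y.2) (-v.1, v.2) := by
  have h1 : HasFDerivAt (fun z : ℝ × ℝ => f (negX z)) _ y :=
    (hf.mdf (negX y)).hasFDerivAt.comp y negX.hasFDerivAt
  have h2 : HasFDerivAt (fun z : ℝ × ℝ => f (-z.1, z.2)) _ y := h1
  rw [h2.fderiv]; rfl

theorem OddX.dy {f : ℝ × ℝ → ℝ} (h : OddX f) (hf : ContDiff ℝ ∞ f) : OddX (dy f) := by
  intro y
  have e : (fun z : ℝ × ℝ => f (-z.1, z.2)) = fun z => - f z := funext h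
  have := fd_negX hf y (0, 1)
  rw [e, fderiv_fun_neg] at this
  simp only [neg_zero] at this
  exact this.symm

theorem OddX.dx {f : ℝ × ℝ → ℝ} (h : OddX f) (hf : ContDiff ℝ ∞ f) : EvX (dx f) := by
  intro y
  have e : (fun z : ℝ × ℝ => f (-z.1, z.2)) = fun z => - f z := funext h
  have := fd_negX hf y (1, 0)
  rw [e, fderiv_fun_neg, show ((-1:ℝ), (0:ℝ)) = - ((1:ℝ), (0:ℝ)) by simp, map_neg] at this
  exact (neg_injective this).symm

theorem EvX.dx {f : ℝ × ℝ → ℝ} (h : EvX f) (hf : ContDiff ℝ ∞ f) : OddX (dx f) := by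
  intro y
  have e : (fun z : ℝ × ℝ => f (-z.1, z.2)) = f := funext h
  have := fd_negX hf y (1, 0)
  rw [e, show ((-1:ℝ), (0:ℝ)) = - ((1:ℝ), (0:ℝ)) by simp, map_neg] at this
  show fderiv ℝ f _ _ = - fderiv ℝ f _ _
  rw [this]; simp

theorem OddX.z {f : ℝ × ℝ → ℝ} (h : OddX f) (t : ℝ) : f (0, t) = 0 := by
  have := h (0, t)
  simp only [neg_zero] at this
  linarith

theorem OddX.z0 {f : ℝ × ℝ → ℝ} (h : OddX f) : f 0 = 0 := h.z 0

theorem ED.lap_dx {lam : ℝ} {w : E3 → ℝ} (h : ED lam w) (a : ONB) (h0 : w (a 2) = 0)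
    (h1 : fderiv ℝ w (a 2) (a 0) = 0) :
    dx (dx (dx fun y => w (ch a y))) 0 + dx (dy (dy fun y => w (ch a y))) 0 = 0 := by
  obtain ⟨ε, D, s, M, d, ⟨C, hC⟩, -, -⟩ := h
  have sw := chart_smooth d.hw a
  have hNN : ∀ y, NN y ≠ 0 := fun y => (NN_pos y).ne'
  have sS : ContDiff ℝ ∞ (fun y => -4 * (s (ch a y) / NN y ^ 2)) :=
    contDiff_const.mul ((chart_smooth d.hs a).div (NN_smooth.pow 2) (fun y => pow_ne_zero 2 (hNN y)))
  have sD := chart_smooth d.hD a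
  have e : (fun y => dx (dx fun y => w (ch a y)) y + dy (dy fun y => w (ch a y)) y) =
      fun y => (-4 * (s (ch a y) / NN y ^ 2)) * D (ch a y) := by
    funext y
    rw [dxdx_D2 sw, dydy_D2 sw, chart_lap d.hw, d.lw _ (ch_ne a y), ch_norm]
    ring
  have e2 := congrFun (congrArg dx e) 0
  rw [dx_add sw.mdx.mdx sw.mdy.mdy, dx_mul sS sD] at e2
  simp only at e2
  rw [e2, ch_zero]
  have D0 : D (a 2) = 0 := by
    have := hC (a 2) (onb_norm a 2)
    rw [h0, abs_zero, mul_zero] at this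
    exact abs_eq_zero.1 (le_antisymm this (abs_nonneg _))
  have D1 : dx (fun y => D (ch a y)) 0 = 0 := by
    rw [dx_zero d.hD, d.gD _ (a.toBasis.ne_zero 2 |> fun h => by simpa using h), D0, h1]; simp
  rw [D0, D1]; ring

theorem onb_ne (a : ONB) (i : Fin 3) : a i ≠ 0 := by
  intro h; have := onb_norm a i; rw [h] at this; simp at this

section

theorem gfun {w : E3 → ℝ} (hw : Hom0 w) (a : ONB)
    (t : ℝ) : dx (fun y => w (ch a y)) (0, t) = 2 * fderiv ℝ w (ch a (0, t)) (a 0) := by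
  unfold dx; rw [chart_fd hw]; simp [chd]

theorem g_one {w : E3 → ℝ} (hw : Hom0 w) (he : ∀ x, w (-x) = w x) (a : ONB)
    : dx (fun y => w (ch a y)) (0, -1) = - dx (fun y => w (ch a y)) (0, 1) := by
  rw [gfun hw, gfun hw]
  have : ch a (0, -1) = - ch a (0, 1) := by unfold ch; simp
  rw [this, fd_even he]; ring


theorem odd_chart {w : E3 → ℝ} (a : ONB) (ho : ∀ x, w (rf (a 0) x) = - w x)
    : OddX (fun y => w (ch a y)) := by
  intro y
  simp only
  rw [← rf_ch, ho]

/-- zeros of `g` on the circle are singular zeros -/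
theorem sing_circle {w : E3 → ℝ} (hw : Hom0 w) (a : ONB) (ho : ∀ x, w (rf (a 0) x) = - w x)
    {t : ℝ} (ht : dx (fun y => w (ch a y)) (0, t) = 0) :
    w (ch a (0, t)) = 0 ∧ fderiv ℝ w (ch a (0, t)) = 0 := by
  have sm := chart_smooth hw a
  have od := odd_chart a ho
  refine ⟨od.z t, ?_⟩
  have := chart_grad hw a (0, t)
  rw [ht, (od.dy sm).z t] at this
  have : ‖fderiv ℝ w (ch a (0, t))‖ ^ 2 = 0 := by linarith
  simpa using this

theorem Sg_circle {w : E3 → ℝ} (hw : Hom0 w) (he : ∀ x, w (-x) = w x) (a : ONB) (ho : ∀ x, w (rf (a 0) x) = - w x)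
    {t : ℝ} (ht : dx (fun y => w (ch a y)) (0, t) = 0) :
    Sg w ((NN (0, t))⁻¹ • ch a (0, t)) 1 := by
  obtain ⟨h1, h2⟩ := sing_circle hw a ho ht
  have hN := inv_pos.2 (NN_pos (0, t))
  refine Sg_one hw he ?_ ?_ ?_
  · rw [norm_smul, ch_norm, Real.norm_eq_abs, abs_of_pos hN, inv_mul_cancel₀ (NN_pos _).ne']
  · rw [hw.hom _ hN, h1]
  · ext v; rw [hw.fd_smul hN (ch_ne a _), h2]; simp

end

theorem norm_chN (a : ONB) (y : ℝ × ℝ) : ‖(NN y)⁻¹ • ch a y‖ = 1 := by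
  have hN := inv_pos.2 (NN_pos y)
  rw [norm_smul, ch_norm, Real.norm_eq_abs, abs_of_pos hN, inv_mul_cancel₀ (NN_pos _).ne']

theorem cont_g {w : E3 → ℝ} (hw : Hom0 w) (a : ONB) :
    ContDiff ℝ ∞ (fun t : ℝ => dx (fun y => w (ch a y)) (0, t)) :=
  (chart_smooth hw a).mdx.comp (by fun_prop : ContDiff ℝ ∞ fun t : ℝ => ((0:ℝ), t))

theorem deriv_slice {f : ℝ × ℝ → ℝ} (hf : ContDiff ℝ ∞ f) (x : ℝ) :
    deriv (fun t : ℝ => f (x, t)) = fun t => dy f (x, t) := by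
  funext t
  have h1 : HasDerivAt (fun t : ℝ => (x, t)) ((0:ℝ), (1:ℝ)) t :=
    (hasDerivAt_const t x).prodMk (hasDerivAt_id t)
  exact ((hf.mdf (x, t)).hasFDerivAt.comp_hasDerivAt t h1).deriv

theorem C1 {lam : ℝ} {w : E3 → ℝ} (h : ED lam w) (h2 : 2 < lam) (h8 : lam ≤ 8) (a : ONB)
    (ho : ∀ x, w (rf (a 0) x) = - w x) (hg : fderiv ℝ w (a 2) (a 0) = 0)
    (hH : D2 w (a 2) (a 0) (a 1) = 0) : ∀ x : E3, x ≠ 0 → w x = 0 := by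
  have hw := h.hom
  have he := h.even
  set f : ℝ × ℝ → ℝ := fun y => w (ch a y) with hf
  have sm : ContDiff ℝ ∞ f := chart_smooth hw a
  have od : OddX f := odd_chart a ho
  have w0 : w (a 2) = 0 := by have := od.z0; simp only [hf, ch_zero] at this; exact this
  have x0 : dx f 0 = 0 := by rw [hf, dx_zero hw, hg]; ring
  have xy0 : dx (dy f) 0 = 0 := by
    have e : dx (dy f) 0 = D2 f 0 (1, 0) (0, 1) := D2_apply (sm.contDiffAt.of_le two_le_inf) _ _
    rw [e, hf, chart_D2 hw, ch_zero]
    simp only [chd, D2] at hH ⊢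
    simp [hH]
  have oy := od.dy sm
  have oyy := oy.dy sm.mdy
  have oyyy := oyy.dy sm.mdy.mdy
  have oxx := (od.dx sm).dx sm.mdx
  have oxxy := oxx.dy sm.mdx.mdx
  have cxy := dx_dy sm
  have xy0' : dy (dx f) 0 = 0 := by rw [← cxy, xy0]
  -- order two
  have S2 : Sg w (a 2) 2 := by
    refine Sg_of_OO hw he a 2 (OO_succ sm od.z0 (OO_one sm.mdx x0) (OO_one sm.mdy oy.z0))
      (OO_succ sm.mdx x0 (OO_one sm.mdx.mdx oxx.z0) (OO_one sm.mdx.mdy xy0'))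
      (OO_succ sm.mdy oy.z0 (OO_one sm.mdy.mdx xy0) (OO_one sm.mdy.mdy oyy.z0))
  by_cases hz : ∃ t : ℝ, t ≠ 0 ∧ dx f (0, t) = 0
  · obtain ⟨t, ht, hzt⟩ := hz
    refine pattB h h2 h8 (onb_norm a 2) (norm_chN a (0, t)) ?_ S2 (Sg_circle hw he a ho hzt)
    rw [inner_smul_right, ch_i2]
    unfold NN; simp only
    intro hc
    have hp : 0 < 1 + t ^ 2 := by positivity
    have : (1 - t ^ 2) ^ 2 = (1 + t ^ 2) ^ 2 := by
      field_simp at hc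
      norm_num at hc
      linarith
    have : t ^ 2 = 0 := by nlinarith
    exact ht (by simpa using this)
  · push Not at hz
    set g : ℝ → ℝ := fun t => dx f (0, t) with hgd
    have sg : ContDiff ℝ ∞ g := cont_g hw a
    have g1 : g (-1) = - g 1 := g_one hw he a
    have g0 : g 0 = 0 := x0
    have dg : deriv g = fun t => dy (dx f) (0, t) := deriv_slice sm.mdx 0
    have ddg : deriv (deriv g) = fun t => dy (dy (dx f)) (0, t) := by
      rw [dg]; exact deriv_slice sm.mdx.mdy 0
    have dg0 : deriv g 0 = 0 := by rw [dg]; exact xy0'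
    -- sign information
    have sgn : ∀ t, 0 < t → 0 < g t * g 1 := by
      intro t ht
      by_contra hc
      have hc := not_lt.1 hc
      have : ∃ z ∈ Set.uIcc t 1, g z = 0 := by
        have := intermediate_value_uIcc (f := g) (a := t) (b := 1) sg.continuous.continuousOn
        refine this ?_
        rw [Set.mem_uIcc]
        rcases le_total 0 (g 1) with h | h
        · left; exact ⟨by
            rcases h.lt_or_eq with h | h
            · nlinarith
            · exact absurd h.symm (hz 1 one_ne_zero), h⟩
        · right; exact ⟨h, by
            rcases h.lt_or_eq with h | h
            · nlinarith
            · exact absurd h (hz 1 one_ne_zero)⟩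
      obtain ⟨z, hz1, hz2⟩ := this
      refine hz z ?_ hz2
      have := hz1.1
      have : 0 < min t 1 := lt_min ht one_pos
      linarith
    have sgn' : ∀ t, t < 0 → g t * g 1 < 0 := by
      intro t ht
      by_contra hc
      have hc := not_lt.1 hc
      have : ∃ z ∈ Set.uIcc t (-1), g z = 0 := by
        have := intermediate_value_uIcc (f := g) (a := t) (b := -1) sg.continuous.continuousOn
        refine this ?_
        rw [Set.mem_uIcc, g1]
        have n1 := hz 1 one_ne_zero
        rcases le_total 0 (g 1) with h | h
        · right; exact ⟨by linarith, by
            rcases h.lt_or_eq with h | h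
            · nlinarith
            · exact absurd h.symm n1⟩
        · left; exact ⟨by
            rcases h.lt_or_eq with h | h
            · nlinarith
            · exact absurd h n1, by linarith⟩
      obtain ⟨z, hz1, hz2⟩ := this
      refine hz z ?_ hz2
      have := hz1.2
      have : max t (-1) < 0 := max_lt ht (by norm_num)
      linarith
    have nolmin : ¬ IsLocalMin g 0 := by
      intro hm
      have hm' : ∀ᶠ t in 𝓝 (0:ℝ), g 0 ≤ g t := hm
      obtain ⟨r, hr, hr'⟩ := Metric.eventually_nhds_iff.1 hm'
      have a1 := hr' (y := r / 2) (by simp [abs_of_pos hr]; linarith)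
      have a2 := hr' (y := -(r / 2)) (by simp [abs_of_pos hr]; linarith)
      have b1 := sgn (r / 2) (by linarith)
      have b2 := sgn' (-(r / 2)) (by linarith)
      rw [g0] at a1 a2
      rcases le_total 0 (g 1) with h | h
      · nlinarith
      · nlinarith
    have nolmax : ¬ IsLocalMax g 0 := by
      intro hm
      have hm' : ∀ᶠ t in 𝓝 (0:ℝ), g t ≤ g 0 := hm
      obtain ⟨r, hr, hr'⟩ := Metric.eventually_nhds_iff.1 hm'
      have a1 := hr' (y := r / 2) (by simp [abs_of_pos hr]; linarith)
      have a2 := hr' (y := -(r / 2)) (by simp [abs_of_pos hr]; linarith)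
      have b1 := sgn (r / 2) (by linarith)
      have b2 := sgn' (-(r / 2)) (by linarith)
      rw [g0] at a1 a2
      rcases le_total 0 (g 1) with h | h
      · nlinarith
      · nlinarith
    have gpp : deriv (deriv g) 0 = 0 := by
      rcases lt_trichotomy (deriv (deriv g) 0) 0 with h | h | h
      · exact absurd (isLocalMax_of_deriv_deriv_neg h dg0 sg.continuous.continuousAt) nolmax
      · exact h
      · exact absurd (isLocalMin_of_deriv_deriv_pos h dg0 sg.continuous.continuousAt) nolmin
    have yyx : dy (dy (dx f)) 0 = 0 := by rw [ddg] at gpp; exact gpp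
    have cxyy : dx (dy (dy f)) = dy (dy (dx f)) := by rw [dx_dy sm.mdy, cxy]
    have cyxx : dy (dx (dx f)) = dx (dy (dx f)) := by rw [dx_dy sm.mdx]
    have xyy : dx (dy (dy f)) 0 = 0 := by rw [cxyy, yyx]
    have xxx : dx (dx (dx f)) 0 = 0 := by
      have := h.lap_dx a w0 hg
      rw [← hf, xyy] at this; linarith
    have xyx : dx (dy (dx f)) 0 = 0 := by rw [← cyxx]; exact oxxy.z0
    refine pattA h h2 h8 (onb_norm a 2) (b := a 2) ?_
    have Oxx : OO 2 (dx (dx f)) :=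
      OO_succ sm.mdx.mdx oxx.z0 (OO_one sm.mdx.mdx.mdx xxx) (OO_one sm.mdx.mdx.mdy oxxy.z0)
    have Oxy : OO 2 (dy (dx f)) :=
      OO_succ sm.mdx.mdy xy0' (OO_one sm.mdx.mdy.mdx xyx) (OO_one sm.mdx.mdy.mdy yyx)
    have Oyy : OO 2 (dy (dy f)) :=
      OO_succ sm.mdy.mdy oyy.z0 (OO_one sm.mdy.mdy.mdx xyy) (OO_one sm.mdy.mdy.mdy oyyy.z0)
    have Ox : OO 3 (dx f) := OO_succ sm.mdx x0 Oxx Oxy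
    have Oy : OO 3 (dy f) := OO_succ sm.mdy oy.z0 (by rw [cxy]; exact Oxy) Oyy
    have Ox2 : OO 2 (dx f) := OO_succ sm.mdx x0 (OO_one sm.mdx.mdx oxx.z0) (OO_one sm.mdx.mdy xy0')
    have Oy2 : OO 2 (dy f) := OO_succ sm.mdy oy.z0 (OO_one sm.mdy.mdx xy0) (OO_one sm.mdy.mdy oyy.z0)
    exact Sg_of_OO hw he a 3 (OO_succ sm od.z0 Ox2 Oy2) Ox Oy

theorem C2crit {lam : ℝ} {w : E3 → ℝ} (h : ED lam w) (h2 : 2 < lam) (h8 : lam ≤ 8) {n : E3} (hn : ‖n‖ = 1)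
    (ho : ∀ x, w (rf n x) = - w x) {x : E3} (hx : ‖x‖ = 1) (hx0 : inner ℝ n x ≠ (0:ℝ))
    (hx1 : inner ℝ n x ^ 2 ≠ (1:ℝ)) (h0 : w x = 0) (h1 : fderiv ℝ w x = 0) :
    ∀ x : E3, x ≠ 0 → w x = 0 := by
  have hw := h.hom
  have he := h.even
  obtain ⟨a', ha'⟩ := exists_onb2 n hn
  obtain ⟨a, ha, -⟩ := exists_onb02 n (a' 0) hn (onb_norm a' 0) (by rw [← ha', onb_inner]; simp)
  have sg := (cont_g hw a).continuous
  have g1 := g_one hw he a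
  rw [← ha] at ho
  obtain ⟨t, -, ht⟩ : ∃ t ∈ Set.uIcc (-1:ℝ) 1, dx (fun y => w (ch a y)) (0, t) = 0 := by
    refine intermediate_value_uIcc (f := fun t : ℝ => dx (fun y => w (ch a y)) (0, t)) sg.continuousOn ?_
    rw [g1, Set.mem_uIcc]
    rcases le_total 0 (dx (fun y => w (ch a y)) (0, 1)) with h | h
    · left; constructor <;> linarith
    · right; constructor <;> linarith
  have hR : ‖rf n x‖ = 1 := by rw [LinearIsometryEquiv.norm_map, hx]
  have hinv : ∀ z, w (rf n z) = - w z := by rw [← ha]; exact ho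
  have hRfd : fderiv ℝ w (rf n x) = 0 := by
    have e : (fun z => w (rf n z)) = fun z => - w z := funext hinv
    have h3 : fderiv ℝ (fun z => w (rf n z)) x = - fderiv ℝ w x := by rw [e, fderiv_fun_neg]
    rw [h1, neg_zero] at h3
    have hne : rf n x ≠ 0 := by intro h; rw [h] at hR; simp at hR
    have h4 : HasFDerivAt (fun z => w (rf n z)) _ x := (hw.df hne).hasFDerivAt.comp x
      ((rf n).toContinuousLinearEquiv : E3 →L[ℝ] E3).hasFDerivAt
    rw [h4.fderiv] at h3
    ext v
    have := congrArg (fun L : E3 →L[ℝ] ℝ => L ((rf n).symm v)) h3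
    simpa using this
  have qn : inner ℝ n ((NN (0, t))⁻¹ • ch a (0, t)) = (0:ℝ) := by
    rw [← ha, inner_smul_right, ch_i0]; simp
  have hnn : inner ℝ n n = (1:ℝ) := by rw [real_inner_self_eq_norm_sq, hn]; norm_num
  have hpar : ∀ z : E3, ‖z‖ = 1 → inner ℝ n z ≠ (0:ℝ) →
      inner ℝ z ((NN (0, t))⁻¹ • ch a (0, t)) ^ 2 ≠ (1:ℝ) := by
    intro z hz hnz hc
    have := unit_par hz (norm_chN a (0, t)) hc
    apply hnz
    rw [this, inner_smul_right, qn, mul_zero]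
  have nR : inner ℝ n (rf n x) = - inner ℝ n x := by
    rw [rf_apply hn, inner_sub_right, inner_smul_right, hnn]; ring
  have xR : inner ℝ x (rf n x) = 1 - 2 * inner ℝ n x ^ 2 := by
    rw [rf_apply hn, inner_sub_right, inner_smul_right, real_inner_self_eq_norm_sq, hx, real_inner_comm n x]
    ring
  refine pattC h h2 h8 hx hR (norm_chN a (0, t)) ?_ (hpar x hx hx0) (hpar _ hR (by rw [nR]; simpa using hx0))
    (Sg_one hw he hx h0 h1) (Sg_one hw he hR (by rw [hinv, h0, neg_zero]) hRfd) (Sg_circle hw he a ho ht)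
  rw [xR]
  intro hc
  have : inner ℝ n x ^ 2 * (inner ℝ n x ^ 2 - 1) = (0:ℝ) := by nlinarith
  rcases mul_eq_zero.1 this with h | h
  · exact hx0 (by simpa using h)
  · exact hx1 (by linarith)
end MF

namespace MF
open scoped ContDiff Topology
open Filter

/-! ### Solutions and data -/

structure Sol (lam : ℝ) (U : E3 → ℝ) : Prop where
  hU : Hom0 U
  even : ∀ x, U (-x) = U x
  pde : ∀ x, x ≠ 0 → lap3 U x = lam * (1 - Real.exp (U x)) / ‖x‖ ^ 2

theorem Hom0.add {F G : E3 → ℝ} (hF : Hom0 F) (hG : Hom0 G) : Hom0 (fun x => F x + G x) :=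
  ⟨hF.smooth.add hG.smooth, fun t ht x => by simp only [hF.hom t ht, hG.hom t ht]⟩
theorem Hom0.sub {F G : E3 → ℝ} (hF : Hom0 F) (hG : Hom0 G) : Hom0 (fun x => F x - G x) :=
  ⟨hF.smooth.sub hG.smooth, fun t ht x => by simp only [hF.hom t ht, hG.hom t ht]⟩
theorem Hom0.mul {F G : E3 → ℝ} (hF : Hom0 F) (hG : Hom0 G) : Hom0 (fun x => F x * G x) :=
  ⟨hF.smooth.mul hG.smooth, fun t ht x => by simp only [hF.hom t ht, hG.hom t ht]⟩
theorem Hom0.const (c : ℝ) : Hom0 (fun _ => c) := ⟨contDiffOn_const, fun _ _ _ => rfl⟩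
theorem Hom0.cmul {F : E3 → ℝ} (c : ℝ) (hF : Hom0 F) : Hom0 (fun x => c * F x) :=
  (Hom0.const c).mul hF
theorem Hom0.exp {F : E3 → ℝ} (hF : Hom0 F) : Hom0 (fun x => Real.exp (F x)) :=
  ⟨hF.smooth.exp, fun t ht x => by simp only [hF.hom t ht]⟩
theorem Hom0.comp {F : E3 → ℝ} (hF : Hom0 F) (ρ : E3 ≃ₗᵢ[ℝ] E3) : Hom0 (fun x => F (ρ x)) :=
  ⟨hF.smooth.comp ρ.contDiff.contDiffOn (fun x hx => by simpa using hx),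
    fun t ht x => by simp only [map_smul, hF.hom t ht]⟩

theorem lap3_add {F G : E3 → ℝ} {x : E3} (hF : ContDiffAt ℝ 2 F x) (hG : ContDiffAt ℝ 2 G x) :
    lap3 (fun z => F z + G z) x = lap3 F x + lap3 G x := by
  unfold lap3; rw [← Finset.sum_add_distrib]
  exact Finset.sum_congr rfl fun i _ => D2_add hF hG _ _
theorem lap3_sub {F G : E3 → ℝ} {x : E3} (hF : ContDiffAt ℝ 2 F x) (hG : ContDiffAt ℝ 2 G x) :
    lap3 (fun z => F z - G z) x = lap3 F x - lap3 G x := by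
  unfold lap3; rw [← Finset.sum_sub_distrib]
  exact Finset.sum_congr rfl fun i _ => D2_sub hF hG _ _
theorem lap3_cmul {F : E3 → ℝ} {x : E3} (c : ℝ) (hF : ContDiffAt ℝ 2 F x) :
    lap3 (fun z => c * F z) x = c * lap3 F x := by
  unfold lap3; rw [Finset.mul_sum]
  exact Finset.sum_congr rfl fun i _ => by have := D2_cmul c hF; simp only [smul_eq_mul] at this; rw [this]

theorem Sol.comp {lam : ℝ} {U : E3 → ℝ} (h : Sol lam U) (ρ : E3 ≃ₗᵢ[ℝ] E3) :
    Sol lam (fun x => U (ρ x)) := by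
  refine ⟨h.hU.comp ρ, fun x => by simp only [map_neg, h.even], fun x hx => ?_⟩
  have hne : ρ x ≠ 0 := by simpa using hx
  rw [lap3_iso ρ x (h.hU.c2 hne), h.pde _ hne, LinearIsometryEquiv.norm_map]

theorem exp_lip {a b B : ℝ} (ha : a ≤ B) (hb : b ≤ B) : |Real.exp a - Real.exp b| ≤ Real.exp B * |a - b| := by
  wlog h : b ≤ a generalizing a b
  · rw [abs_sub_comm, abs_sub_comm a b]; exact this hb ha (le_of_not_ge h)
  have e1 : Real.exp b ≤ Real.exp a := Real.exp_le_exp.2 h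
  rw [abs_of_nonneg (by linarith), abs_of_nonneg (by linarith)]
  have h1 := Real.add_one_le_exp (b - a)
  have h2 : Real.exp b = Real.exp a * Real.exp (b - a) := by rw [← Real.exp_add]; congr 1; ring
  have h3 : Real.exp a ≤ Real.exp B := Real.exp_le_exp.2 ha
  have h4 := Real.exp_pos a
  calc Real.exp a - Real.exp b = Real.exp a * (1 - Real.exp (b - a)) := by rw [h2]; ring
    _ ≤ Real.exp a * (a - b) := mul_le_mul_of_nonneg_left (by linarith) h4.le
    _ ≤ _ := mul_le_mul_of_nonneg_right h3 (by linarith)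

theorem Hom0.bdd {F : E3 → ℝ} (hF : Hom0 F) : ∃ B, ∀ x, ‖x‖ = 1 → F x ≤ B := by
  obtain ⟨C, hC⟩ := (isCompact_sphere (0 : E3) 1).exists_bound_of_continuousOn
    (hF.smooth.continuousOn.mono sphere_sub)
  exact ⟨C, fun x hx => (le_abs_self _).trans (hC x (by simpa using hx))⟩

theorem sqrt_ne {lam : ℝ} (h : 0 < lam) : Real.sqrt lam ≠ 0 := (Real.sqrt_pos.2 h).ne'

theorem fd_exp_half {U : E3 → ℝ} (hU : Hom0 U) {x : E3} (hx : x ≠ 0) (v : E3) :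
    HasFDerivAt (fun z => Real.exp (1 / 2 * U z)) (Real.exp (1 / 2 * U x) • ((1 / 2 : ℝ) • fderiv ℝ U x)) x :=
  ((hU.df hx).hasFDerivAt.const_mul (1 / 2)).exp

theorem exp_half_sq (t : ℝ) : Real.exp (1 / 2 * t) ^ 2 = Real.exp t := by
  rw [← Real.exp_nat_mul]; congr 1; push_cast; ring

/-- difference of two solutions -/
theorem ED_sub {lam : ℝ} (hl : 0 < lam) {U V : E3 → ℝ} (hU : Sol lam U) (hV : Sol lam V) :
    ED lam (fun x => V x - U x) := by
  have eU := (hU.hU.cmul (1 / 2)).exp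
  have eV := (hV.hU.cmul (1 / 2)).exp
  have hs := Real.sq_sqrt hl.le
  refine ⟨1, fun x => √lam * (Real.exp (1 / 2 * V x) - Real.exp (1 / 2 * U x)),
    fun x => √lam * (Real.exp (1 / 2 * U x) + Real.exp (1 / 2 * V x)),
    fun x => 1 / 2 * (U x + V x), ⟨hV.hU.sub hU.hU, (eV.sub eU).cmul _, (eU.add eV).cmul _,
      (hU.hU.add hV.hU).cmul _, ?_, ?_, ?_, ?_⟩, ?_, ?_, ?_⟩
  · intro x hx v
    have du := (hU.hU.df hx).hasFDerivAt
    have dv := (hV.hU.df hx).hasFDerivAt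
    have h1 := (fd_exp_half hU.hU hx v)
    have h2 := (fd_exp_half hV.hU hx v)
    have e1 : HasFDerivAt (fun x => √lam * (Real.exp (1 / 2 * V x) - Real.exp (1 / 2 * U x))) _ x :=
      (h2.sub h1).const_mul _
    have e2 : HasFDerivAt (fun x => 1 / 2 * (U x + V x)) _ x := (du.add dv).const_mul _
    have e3 : HasFDerivAt (fun x => V x - U x) _ x := dv.sub du
    rw [e1.fderiv, e2.fderiv, e3.fderiv]
    simp; ring
  · intro x hx v
    have du := (hU.hU.df hx).hasFDerivAt
    have dv := (hV.hU.df hx).hasFDerivAt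
    have h1 := (fd_exp_half hU.hU hx v)
    have h2 := (fd_exp_half hV.hU hx v)
    have e1 : HasFDerivAt (fun x => √lam * (Real.exp (1 / 2 * U x) + Real.exp (1 / 2 * V x))) _ x :=
      (h1.add h2).const_mul _
    have e2 : HasFDerivAt (fun x => 1 / 2 * (U x + V x)) _ x := (du.add dv).const_mul _
    have e3 : HasFDerivAt (fun x => V x - U x) _ x := dv.sub du
    rw [e1.fderiv, e2.fderiv, e3.fderiv]
    simp; ring
  · intro x hx
    rw [lap3_sub (hV.hU.c2 hx) (hU.hU.c2 hx), hU.pde x hx, hV.pde x hx, ← exp_half_sq (U x), ← exp_half_sq (V x), ← sub_div]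
    congr 1
    linear_combination (Real.exp (1 / 2 * V x) ^ 2 - Real.exp (1 / 2 * U x) ^ 2) * hs
  · intro x hx
    rw [lap3_cmul _ ((hU.hU.add hV.hU).c2 hx), lap3_add (hU.hU.c2 hx) (hV.hU.c2 hx), hU.pde x hx, hV.pde x hx,
      ← exp_half_sq (U x), ← exp_half_sq (V x), ← add_div, ← mul_div_assoc]
    congr 1
    linear_combination (Real.exp (1 / 2 * V x) ^ 2 + Real.exp (1 / 2 * U x) ^ 2) / 2 * hs
  · obtain ⟨B1, hB1⟩ := hU.hU.bdd
    obtain ⟨B2, hB2⟩ := hV.hU.bdd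
    refine ⟨√lam * (Real.exp (1 / 2 * max B1 B2) / 2), fun x hx => ?_⟩
    have := exp_lip (a := 1 / 2 * V x) (b := 1 / 2 * U x) (B := 1 / 2 * max B1 B2)
      (by linarith [hB2 x hx, le_max_right B1 B2]) (by linarith [hB1 x hx, le_max_left B1 B2])
    rw [abs_mul, abs_of_nonneg (Real.sqrt_nonneg _), mul_assoc]
    refine mul_le_mul_of_nonneg_left (this.trans (le_of_eq ?_)) (Real.sqrt_nonneg _)
    rw [← mul_sub, abs_mul, abs_of_pos (by norm_num : (0:ℝ) < 1 / 2)]; ring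
  · intro x hx h
    rcases mul_eq_zero.1 h with h | h
    · exact absurd h (sqrt_ne hl)
    · have := Real.exp_injective (sub_eq_zero.1 h); linarith
  · intro x; simp only [hU.even, hV.even]

/-- kernel elements of the linearised operator -/
theorem ED_lin {lam : ℝ} (hl : 0 < lam) {U f : E3 → ℝ} (hU : Sol lam U) (hf : Hom0 f)
    (he : ∀ x, f (-x) = f x)
    (hp : ∀ x, x ≠ 0 → lap3 f x = - (lam * Real.exp (U x) * f x) / ‖x‖ ^ 2) : ED lam f := by
  have eU := (hU.hU.cmul (1 / 2)).exp
  have hs := Real.sq_sqrt hl.le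
  refine ⟨0, fun x => (√lam / 2) * (Real.exp (1 / 2 * U x) * f x),
    fun x => (2 * √lam) * Real.exp (1 / 2 * U x), U, ⟨hf, (eU.mul hf).cmul _, eU.cmul _, hU.hU,
      ?_, ?_, ?_, ?_⟩, ?_, ?_, he⟩
  · intro x hx v
    have df := (hf.df hx).hasFDerivAt
    have h1 := (fd_exp_half hU.hU hx v)
    have e1 : HasFDerivAt (fun x => (√lam / 2) * (Real.exp (1 / 2 * U x) * f x)) _ x :=
      (h1.mul df).const_mul _
    rw [e1.fderiv]
    simp; ring
  · intro x hx v
    have h1 := (fd_exp_half hU.hU hx v)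
    have e1 : HasFDerivAt (fun x => (2 * √lam) * Real.exp (1 / 2 * U x)) _ x :=
      h1.const_mul _
    rw [e1.fderiv]
    simp; ring
  · intro x hx
    rw [hp x hx, ← exp_half_sq (U x)]
    congr 1
    linear_combination (Real.exp (1 / 2 * U x) ^ 2 * f x) * hs
  · intro x hx
    rw [hU.pde x hx, ← exp_half_sq (U x)]
    congr 1
    linear_combination (Real.exp (1 / 2 * U x) ^ 2) * hs
  · obtain ⟨B, hB⟩ := (hU.hU.cmul (1 / 2)).bdd
    refine ⟨√lam / 2 * Real.exp B, fun x hx => ?_⟩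
    rw [abs_mul, abs_mul, abs_of_nonneg (by positivity), abs_of_nonneg (Real.exp_pos _).le, mul_assoc]
    have := hB x hx
    gcongr
  · intro x hx h
    rcases mul_eq_zero.1 h with h | h
    · exact absurd h (div_ne_zero (sqrt_ne hl) two_ne_zero)
    · exact (mul_eq_zero.1 h).resolve_left (Real.exp_pos _).ne'
end MF

namespace MF
open scoped ContDiff Topology
open Filter

/-! ### Reflection symmetries of solutions -/

theorem exists_onb3 {n v p : E3} (hn : ‖n‖ = 1) (hv : ‖v‖ = 1) (hp : ‖p‖ = 1)
    (hnv : inner ℝ n v = (0:ℝ)) (hnp : inner ℝ n p = (0:ℝ)) (hvp : inner ℝ v p = (0:ℝ)) :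
    ∃ a : ONB, a 0 = n ∧ a 1 = v ∧ a 2 = p := by
  have h : Orthonormal ℝ (Set.domRestrict Set.univ (![n, v, p] : Fin 3 → E3)) := by
    rw [orthonormal_iff_ite]
    rintro ⟨i, hi⟩ ⟨j, hj⟩
    have h1 := (real_inner_comm n v).trans hnv
    have h2 := (real_inner_comm n p).trans hnp
    have h3 := (real_inner_comm v p).trans hvp
    fin_cases i <;> fin_cases j <;>
      simp [Set.domRestrict, hp, hn, hv, hnp, hnv, hvp, h1, h2, h3] <;> assumption
  obtain ⟨b, hb⟩ := h.exists_orthonormalBasis_extension_of_card_eq (by simp)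
  exact ⟨b, by simpa using hb 0 (by simp), by simpa using hb 1 (by simp), by simpa using hb 2 (by simp)⟩

theorem exists_rot (a : ONB) {c s : ℝ} (h : c ^ 2 + s ^ 2 = 1) :
    ∃ b : ONB, b 0 = c • a 0 + s • a 1 ∧ b 1 = (-s) • a 0 + c • a 1 ∧ b 2 = a 2 := by
  have e : ∀ v : E3, inner ℝ v v = (1:ℝ) → ‖v‖ = 1 := fun v hv => by
    rw [real_inner_self_eq_norm_sq] at hv; nlinarith [norm_nonneg v]
  refine exists_onb3 (e _ ?_) (e _ ?_) (e _ ?_) ?_ ?_ ?_ <;>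
    simp only [inner_add_left, inner_add_right, inner_smul_left, inner_smul_right, onb_inner] <;>
    simp <;> first | linear_combination h | ring

theorem exists_perm (a : ONB) {i j k : Fin 3} (hij : i ≠ j) (hik : i ≠ k) (hjk : j ≠ k) :
    ∃ b : ONB, b 0 = a i ∧ b 1 = a j ∧ b 2 = a k :=
  exists_onb3 (onb_norm a i) (onb_norm a j) (onb_norm a k) (by simp [onb_inner, hij])
    (by simp [onb_inner, hik]) (by simp [onb_inner, hjk])

theorem clm_zero (a : ONB) {l : E3 →L[ℝ] ℝ} (h : ∀ i, l (a i) = 0) : l = 0 := by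
  ext v
  rw [onb_expand a v]; simp [h]

theorem rf_onb (a : ONB) (i j : Fin 3) : rf (a i) (a j) = if i = j then - a j else a j := by
  rw [rf_apply (onb_norm a i), onb_inner]
  split_ifs with h
  · rw [h]; module
  · simp

theorem rf_self {n : E3} (hn : ‖n‖ = 1) : rf n n = -n := by
  rw [rf_apply hn, real_inner_self_eq_norm_sq, hn]; module

theorem rf_perp {n x : E3} (hn : ‖n‖ = 1) (h : inner ℝ n x = (0:ℝ)) : rf n x = x := by
  rw [rf_apply hn, h]; simp

theorem rf_rf (n x : E3) : rf n (rf n x) = x := Submodule.reflection_reflection _ x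

theorem rf_ne (n : E3) {x : E3} (hx : x ≠ 0) : rf n x ≠ 0 := by simpa using hx

theorem fd_iso {F : E3 → ℝ} (ρ : E3 ≃ₗᵢ[ℝ] E3) {x : E3} (hF : DifferentiableAt ℝ F (ρ x)) (v : E3) :
    fderiv ℝ (fun z => F (ρ z)) x v = fderiv ℝ F (ρ x) (ρ v) := by
  have h : HasFDerivAt (fun z => F (ρ z)) _ x :=
    hF.hasFDerivAt.comp x (ρ.toContinuousLinearEquiv : E3 →L[ℝ] E3).hasFDerivAt
  rw [h.fderiv]; rfl

theorem D2_iso {F : E3 → ℝ} (ρ : E3 ≃ₗᵢ[ℝ] E3) {x : E3} (hF : ContDiffAt ℝ 2 F (ρ x)) (u v : E3) :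
    D2 (fun z => F (ρ z)) x u v = D2 F (ρ x) (ρ u) (ρ v) :=
  D2_clm (ρ.toContinuousLinearEquiv : E3 →L[ℝ] E3) hF _ _

theorem fd_sgn {F : E3 → ℝ} (hF : Hom0 F) (n : E3) {σ : ℝ} (h : ∀ x, F (rf n x) = σ * F x) {x : E3} (hx : x ≠ 0) (v : E3) :
    fderiv ℝ F (rf n x) (rf n v) = σ * fderiv ℝ F x v := by
  rw [← fd_iso (rf n) (hF.df (rf_ne n hx))]
  simp only [h]
  rw [fderiv_const_mul (hF.df hx)]; simp

theorem D2_sgn {F : E3 → ℝ} (hF : Hom0 F) (n : E3) {σ : ℝ} (h : ∀ x, F (rf n x) = σ * F x) {x : E3} (hx : x ≠ 0) (u v : E3) :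
    D2 F (rf n x) (rf n u) (rf n v) = σ * D2 F x u v := by
  rw [← D2_iso (rf n) (hF.c2 (rf_ne n hx))]
  simp only [h]
  have := D2_cmul σ (hF.c2 hx) u v
  simpa using this

theorem fd_inv {F : E3 → ℝ} (hF : Hom0 F) (n : E3) (h : ∀ x, F (rf n x) = F x) {x : E3} (hx : x ≠ 0) (v : E3) :
    fderiv ℝ F (rf n x) (rf n v) = fderiv ℝ F x v := by
  rw [fd_sgn hF n (σ := 1) (by simpa using h) hx, one_mul]

theorem D2_inv {F : E3 → ℝ} (hF : Hom0 F) (n : E3) (h : ∀ x, F (rf n x) = F x) {x : E3} (hx : x ≠ 0) (u v : E3) :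
    D2 F (rf n x) (rf n u) (rf n v) = D2 F x u v := by
  rw [D2_sgn hF n (σ := 1) (by simpa using h) hx, one_mul]

theorem D2_neg_left {F : E3 → ℝ} (x u v : E3) : D2 F x (-u) v = - D2 F x u v := by simp [D2]
theorem D2_neg_right {F : E3 → ℝ} (x u v : E3) : D2 F x u (-v) = - D2 F x u v := by simp [D2]

section
variable {lam : ℝ} {U : E3 → ℝ}

def wdiff (U : E3 → ℝ) (n : E3) : E3 → ℝ := fun x => U (rf n x) - U x

theorem ED_wdiff (h : Sol lam U) (h2 : 2 < lam) (n : E3) : ED lam (wdiff U n) :=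
  ED_sub (by linarith) h (h.comp (rf n))

theorem wdiff_odd (n x : E3) : wdiff U n (rf n x) = - wdiff U n x := by
  unfold wdiff; rw [rf_rf]; ring

theorem inv_of_wdiff {n : E3} (h : ∀ x, x ≠ 0 → wdiff U n x = 0) (x : E3) : U (rf n x) = U x := by
  by_cases hx : x = 0
  · rw [hx, map_zero]
  · have := h x hx; unfold wdiff at this; linarith

theorem wdiff_fd (h : Sol lam U) (n : E3) {x : E3} (hx : x ≠ 0) (v : E3) :
    fderiv ℝ (wdiff U n) x v = fderiv ℝ U (rf n x) (rf n v) - fderiv ℝ U x v := by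
  rw [← fd_iso (rf n) (h.hU.df (rf_ne n hx))]
  unfold wdiff
  have h1 := ((h.hU.comp (rf n)).df hx).hasFDerivAt.fun_sub (h.hU.df hx).hasFDerivAt
  rw [h1.fderiv]; rfl

theorem wdiff_D2 (h : Sol lam U) (n : E3) {x : E3} (hx : x ≠ 0) (u v : E3) :
    D2 (wdiff U n) x u v = D2 U (rf n x) (rf n u) (rf n v) - D2 U x u v := by
  rw [← D2_iso (rf n) (h.hU.c2 (rf_ne n hx))]
  exact D2_sub ((h.hU.comp (rf n)).c2 hx) (h.hU.c2 hx) u v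

theorem lemR (h : Sol lam U) (h2 : 2 < lam) (h8 : lam ≤ 8) (a : ONB)
    (h1 : fderiv ℝ U (a 2) (a 0) = 0) (hH : D2 U (a 2) (a 0) (a 1) = 0) (x : E3) : U (rf (a 0) x) = U x := by
  refine inv_of_wdiff (C1 (ED_wdiff h h2 _) h2 h8 a (wdiff_odd _) ?_ ?_) x
  · rw [wdiff_fd h _ (onb_ne a 2)]; simp [rf_onb, h1]
  · rw [wdiff_D2 h _ (onb_ne a 2)]; simp [rf_onb, D2_neg_left, hH]

def Ax (U : E3 → ℝ) : Prop :=
  ∃ e : E3, ‖e‖ = 1 ∧ ∀ x x' : E3, ‖x‖ = 1 → ‖x'‖ = 1 → inner ℝ x e = (inner ℝ x' e : ℝ) → U x = U x'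

theorem ax_of_rf {e : E3} (he : ‖e‖ = 1) (h : ∀ n : E3, ‖n‖ = 1 → inner ℝ n e = (0:ℝ) → ∀ x, U (rf n x) = U x) : Ax U := by
  refine ⟨e, he, fun x x' hx hx' hi => ?_⟩
  by_cases hxx : x = x'
  · rw [hxx]
  have hd : ‖x - x'‖ ≠ 0 := by rw [norm_ne_zero_iff, sub_ne_zero]; exact hxx
  set d := ‖x - x'‖ with hdd
  have hn : ‖d⁻¹ • (x - x')‖ = 1 := by
    rw [norm_smul, norm_inv, ← hdd]; simp [hd, hdd]
    rw [inv_mul_cancel₀]; simpa [hdd] using hd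
  rw [← h _ hn ?_ x]
  · congr 1
    rw [rf_apply hn, inner_smul_left]
    have : 2 * inner ℝ (x - x') x = d ^ 2 := by
      rw [hdd, norm_sub_sq_real, inner_sub_left, real_inner_self_eq_norm_sq, real_inner_comm x x', hx, hx']; ring
    simp only [smul_smul, map_inv₀, RCLike.conj_to_real]
    have e : 2 * (d⁻¹ * inner ℝ (x - x') x) * d⁻¹ = 1 := by
      rw [show 2 * (d⁻¹ * inner ℝ (x - x') x) * d⁻¹ = d⁻¹ ^ 2 * (2 * inner ℝ (x - x') x) by ring, this]
      field_simp
    rw [e]; simp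
  · rw [inner_smul_left, inner_sub_left, hi]; simp

theorem D2_rot (F : E3 → ℝ) (hF : Hom0 F) (a : ONB) (c s : ℝ) {x : E3} (hx : x ≠ 0) :
    D2 F x (c • a 0 + s • a 1) ((-s) • a 0 + c • a 1) =
     (c * s) * (D2 F x (a 1) (a 1) - D2 F x (a 0) (a 0)) + (c ^ 2 - s ^ 2) * D2 F x (a 0) (a 1) := by
  have e := D2_symm (hF.c2 hx) (a 1) (a 0)
  simp only [D2] at *
  simp
  rw [e]; ring

theorem lemU (h : Sol lam U) (h2 : 2 < lam) (h8 : lam ≤ 8) (a : ONB) (h1 : fderiv ℝ U (a 2) = 0)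
    (h00 : D2 U (a 2) (a 0) (a 0) = D2 U (a 2) (a 1) (a 1)) (h01 : D2 U (a 2) (a 0) (a 1) = 0) : Ax U := by
  refine ax_of_rf (onb_norm a 2) fun n hn hp x => ?_
  have hp' := (real_inner_comm n (a 2)).trans hp
  have e := onb_expand a n
  have en := onb_normsq a n
  rw [hp', zero_smul, add_zero] at e
  rw [hn, hp'] at en
  obtain ⟨b, b0, b1, b2⟩ := exists_rot a (c := inner ℝ (a 0) n) (s := inner ℝ (a 1) n) (by linarith)
  rw [← e] at b0
  rw [← b0]
  refine lemR h h2 h8 b (by rw [b2, h1]; rfl) ?_ x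
  rw [b0, b1, b2]
  nth_rewrite 1 [e]
  rw [D2_rot U h.hU a _ _ (onb_ne a 2), h00, h01]; ring

def Sym (U : E3 → ℝ) (a : ONB) : Prop := ∀ i x, U (rf (a i) x) = U x

theorem Sym.perm {a b : ONB} (h : Sym U a) {i j k : Fin 3} (h0 : b 0 = a i) (h1 : b 1 = a j) (h2 : b 2 = a k) :
    Sym U b := by
  intro l x
  fin_cases l
  · exact h0 ▸ h i x
  · exact h1 ▸ h j x
  · exact h2 ▸ h k x

theorem Sym.crit (h : Sol lam U) {a : ONB} (hs : Sym U a) (i : Fin 3) : fderiv ℝ U (a i) = 0 := by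
  refine clm_zero a fun j => ?_
  by_cases hij : i = j
  · rw [← hij]; exact h.hU.euler (onb_ne a i)
  · have := fd_inv h.hU (a j) (hs j) (onb_ne a i) (a j)
    rw [rf_onb, rf_onb, if_neg (Ne.symm hij), if_pos rfl] at this
    simp at this; linarith

theorem Sym.hess (h : Sol lam U) {a : ONB} (hs : Sym U a) (i : Fin 3) {j k : Fin 3} (hjk : j ≠ k) :
    D2 U (a i) (a j) (a k) = 0 := by
  by_cases hij : i = j
  · have hik : k ≠ i := by rw [hij]; exact hjk.symm
    have := D2_inv h.hU (a k) (hs k) (onb_ne a i) (a j) (a k)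
    rw [rf_onb, rf_onb, rf_onb, if_neg hik, if_pos rfl, if_neg hjk.symm, D2_neg_right] at this
    linarith
  · have := D2_inv h.hU (a j) (hs j) (onb_ne a i) (a j) (a k)
    rw [rf_onb, rf_onb, rf_onb, if_neg (Ne.symm hij), if_pos rfl, if_neg hjk, D2_neg_left] at this
    linarith

theorem lemH (h : Sol lam U) (h2 : 2 < lam) (h8 : lam ≤ 8) {a : ONB} (hs : Sym U a) {c s : ℝ}
    (hcs : c ^ 2 + s ^ 2 = 1) (hc : c ≠ 0) (hs0 : s ≠ 0) (hi : ∀ x, U (rf (c • a 0 + s • a 1) x) = U x) : Ax U := by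
  obtain ⟨b, b0, b1, b2⟩ := exists_rot a hcs
  rw [← b0] at hi
  have := D2_inv h.hU (b 0) hi (onb_ne b 2) (b 0) (b 1)
  simp only [rf_onb] at this
  simp [D2_neg_left] at this
  have h0 : D2 U (b 2) (b 0) (b 1) = 0 := by linarith
  rw [b0, b1, b2, D2_rot U h.hU a _ _ (onb_ne a 2), hs.hess h 2 (by decide : (0:Fin 3) ≠ 1)] at h0
  refine lemU h h2 h8 a (hs.crit h 2) ?_ (hs.hess h 2 (by decide : (0:Fin 3) ≠ 1))
  have : c * s ≠ 0 := mul_ne_zero hc hs0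
  have h1 : (c * s) * (D2 U (a 2) (a 1) (a 1) - D2 U (a 2) (a 0) (a 0)) = 0 := by linarith
  rcases mul_eq_zero.1 h1 with h | h
  · exact absurd h this
  · linarith

theorem exists_sym (h : Sol lam U) (h2 : 2 < lam) (h8 : lam ≤ 8) : ∃ a : ONB, Sym U a := by
  obtain ⟨p, hp, hmax⟩ := (isCompact_sphere (0 : E3) 1).exists_isMaxOn
    (NormedSpace.sphere_nonempty.2 zero_le_one) (h.hU.smooth.continuousOn.mono sphere_sub)
  have hp1 : ‖p‖ = 1 := by simpa using hp
  have hp0 : p ≠ 0 := by intro h; rw [h] at hp1; simp at hp1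
  have hloc : IsLocalMax U p := by
    have : ∀ᶠ z in 𝓝 p, z ≠ 0 := isOpen_ne.mem_nhds hp0
    filter_upwards [this] with z hz
    have hz' : 0 < ‖z‖⁻¹ := inv_pos.2 (norm_pos_iff.2 hz)
    rw [← h.hU.hom _ hz' z]
    apply hmax
    simp [norm_smul, hz]
  have hcrit : fderiv ℝ U p = 0 := hloc.fderiv_eq_zero
  obtain ⟨a, ha⟩ := exists_onb2 p hp1
  rw [← ha] at hcrit
  have key : ∃ c s : ℝ, c ^ 2 + s ^ 2 = 1 ∧ D2 U (a 2) (c • a 0 + s • a 1) ((-s) • a 0 + c • a 1) = 0 := by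
    set g : ℝ → ℝ := fun θ => (cos θ * sin θ) * (D2 U (a 2) (a 1) (a 1) - D2 U (a 2) (a 0) (a 0)) +
      (cos θ ^ 2 - sin θ ^ 2) * D2 U (a 2) (a 0) (a 1) with hg
    have gc : Continuous g := by fun_prop
    have : (0:ℝ) ∈ g '' Set.uIcc 0 (π / 2) := by
      apply intermediate_value_uIcc gc.continuousOn
      simp [hg, Set.mem_uIcc]
      rcases le_total 0 (D2 U (a 2) (a 0) (a 1)) with h | h
      · right; exact h
      · left; exact h
    obtain ⟨θ, -, hθ⟩ := this
    exact ⟨cos θ, sin θ, by rw [cos_sq_add_sin_sq], by rw [D2_rot U h.hU a _ _ (onb_ne a 2)]; exact hθ⟩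
  obtain ⟨c, s, hcs, hD⟩ := key
  obtain ⟨b, b0, b1, b2⟩ := exists_rot a hcs
  rw [← b0, ← b1, ← b2] at hD
  rw [← b2] at hcrit
  have r0 := lemR h h2 h8 b (by rw [hcrit]; rfl) hD
  have r1 : ∀ x, U (rf (b 1) x) = U x := by
    obtain ⟨d, d0, d1, d2⟩ := exists_perm b (i := 1) (j := 0) (k := 2) (by decide) (by decide) (by decide)
    rw [← d0]
    refine lemR h h2 h8 d (by rw [d2, hcrit]; rfl) ?_
    rw [d0, d1, d2, D2_symm (h.hU.c2 (onb_ne b 2)), hD]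
  refine ⟨b, fun i x => ?_⟩
  fin_cases i
  · exact r0 x
  · exact r1 x
  · show U (rf (b 2) x) = U x
    rw [← h.even x, ← r0 (rf (b 2) x), ← r1 (rf (b 0) _)]
    congr 1
    conv_lhs => rw [onb_expand b x]
    conv_rhs => rw [onb_expand b x]
    simp only [map_add, map_smul, rf_onb]
    simp [rf_onb]
    module

theorem step3 (h : Sol lam U) (h2 : 2 < lam) (h8 : lam ≤ 8) {a : ONB} (hs : Sym U a) (hax : ¬ Ax U)
    {p : E3} (hp : ‖p‖ = 1) (hc : fderiv ℝ U p = 0) : inner ℝ (a 0) p * inner ℝ (a 1) p = (0:ℝ) := by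
  by_contra hne
  have hp0 : p ≠ 0 := by intro h; rw [h] at hp; simp at hp
  obtain ⟨q0, q1⟩ := mul_ne_zero_iff.1 hne
  set p0 : ℝ := inner ℝ (a 0) p with hp0'
  set p1 : ℝ := inner ℝ (a 1) p with hp1'
  set p2 : ℝ := inner ℝ (a 2) p with hp2'
  have en : p0 ^ 2 + p1 ^ 2 + p2 ^ 2 = 1 := by rw [← onb_normsq a p, hp]; norm_num
  set r := √(p0 ^ 2 + p1 ^ 2) with hr
  have hr2 : r ^ 2 = p0 ^ 2 + p1 ^ 2 := Real.sq_sqrt (by positivity)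
  have hr0 : 0 < r := Real.sqrt_pos.2 (by positivity)
  have hcs : (-p1 / r) ^ 2 + (p0 / r) ^ 2 = 1 := by
    field_simp; linarith
  set n : E3 := (-p1 / r) • a 0 + (p0 / r) • a 1 with hn
  have hn1 : ‖n‖ = 1 := by
    obtain ⟨b, b0, -, -⟩ := exists_rot a hcs
    rw [hn, ← b0]; exact onb_norm b 0
  have hnp : inner ℝ n p = (0:ℝ) := by
    rw [hn, inner_add_left, inner_smul_left, inner_smul_left]
    simp only [← hp0', ← hp1', RCLike.conj_to_real]; ring
  have hna : inner ℝ n (a 2) = (0:ℝ) := by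
    rw [hn, inner_add_left, inner_smul_left, inner_smul_left, onb_inner, onb_inner]; simp
  have han : inner ℝ (a 2) n = (0:ℝ) := by rw [real_inner_comm]; exact hna
  have hinv : ∀ x, U (rf n x) = U x := by
    by_cases q2 : p2 = 0
    · obtain ⟨b, b0, b1, b2⟩ := exists_onb3 hn1 (onb_norm a 2) hp hna hnp q2
      rw [← b0]
      refine lemR h h2 h8 b (by rw [b2, hc]; rfl) ?_
      rw [b0, b1, b2]
      have := D2_inv h.hU (a 2) (hs 2) hp0 n (a 2)
      rw [rf_perp (onb_norm a 2) q2, rf_perp (onb_norm a 2) han, rf_self (onb_norm a 2), D2_neg_right] at this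
      linarith
    · have wc : ∀ x, x ≠ 0 → inner ℝ n x = (0:ℝ) → fderiv ℝ U x = 0 →
          wdiff U n x = 0 ∧ fderiv ℝ (wdiff U n) x = 0 := by
        intro x hx hnx hcx
        constructor
        · unfold wdiff; rw [rf_perp hn1 hnx]; ring
        · ext v
          rw [wdiff_fd h n hx, rf_perp hn1 hnx, hcx]; simp
      have hE := ED_wdiff h h2 n
      have hR : ‖rf (a 2) p‖ = 1 := by rw [LinearIsometryEquiv.norm_map, hp]
      have hcR : fderiv ℝ U (rf (a 2) p) = 0 := by
        ext v
        have := fd_inv h.hU (a 2) (hs 2) hp0 (rf (a 2) v)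
        rw [rf_rf, hc] at this
        simpa using this
      have hnR : inner ℝ n (rf (a 2) p) = (0:ℝ) := by
        rw [rf_apply (onb_norm a 2), inner_sub_right, inner_smul_right, hnp, hna]; simp
      have s1 := wc _ (onb_ne a 2) hna (hs.crit h 2)
      have s2 := wc _ hp0 hnp hc
      have s3 := wc _ (rf_ne _ hp0) hnR hcR
      have i2 : inner ℝ (a 2) (rf (a 2) p) = -p2 := by
        rw [rf_apply (onb_norm a 2), inner_sub_right, inner_smul_right, onb_inner]; simp [← hp2']; ring
      have i3 : inner ℝ p (rf (a 2) p) = 1 - 2 * p2 ^ 2 := by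
        rw [rf_apply (onb_norm a 2), inner_sub_right, inner_smul_right, real_inner_self_eq_norm_sq, hp,
          real_inner_comm (a 2) p, ← hp2']; ring
      have hpos : 0 < p0 ^ 2 + p1 ^ 2 := by positivity
      refine inv_of_wdiff (pattC hE h2 h8 (onb_norm a 2) hp hR ?_ ?_ ?_
        (Sg_one hE.hom hE.even (onb_norm a 2) s1.1 s1.2) (Sg_one hE.hom hE.even hp s2.1 s2.2)
        (Sg_one hE.hom hE.even hR s3.1 s3.2))
      · rw [← hp2']; intro hh; linarith
      · rw [i2]; intro hh; nlinarith
      · rw [i3]; intro hh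
        have : p2 ^ 2 * (p0 ^ 2 + p1 ^ 2) = 0 := by nlinarith
        have := (mul_eq_zero.1 this).resolve_right hpos.ne'
        exact q2 (by simpa using this)
  exact hax (lemH h h2 h8 hs hcs (by simp [q1, hr0.ne']) (by simp [q0, hr0.ne']) hinv)

theorem crit_axis (h : Sol lam U) (h2 : 2 < lam) (h8 : lam ≤ 8) {a : ONB} (hs : Sym U a) (hax : ¬ Ax U)
    {p : E3} (hp : ‖p‖ = 1) (hc : fderiv ℝ U p = 0) {i j : Fin 3} (hij : i ≠ j) :
    inner ℝ (a i) p * inner ℝ (a j) p = (0:ℝ) := by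
  obtain ⟨k, hik, hjk⟩ : ∃ k : Fin 3, i ≠ k ∧ j ≠ k := by revert i j; decide
  obtain ⟨b, b0, b1, b2⟩ := exists_perm a hij hik hjk
  rw [← b0, ← b1]
  exact step3 h h2 h8 (hs.perm b0 b1 b2) hax hp hc

end
end MF

namespace MF
open scoped ContDiff Topology
open Filter

/-! ### Rotational derivatives -/

/-- smooth away from the origin -/
def Sm (F : E3 → ℝ) : Prop := ContDiffOn ℝ ∞ F {0}ᶜ

theorem Sm.at {F : E3 → ℝ} (h : Sm F) {x : E3} (hx : x ≠ 0) : ContDiffAt ℝ ∞ F x :=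
  h.contDiffAt (isOpen_compl_singleton.mem_nhds hx)
theorem Sm.c2 {F : E3 → ℝ} (h : Sm F) {x : E3} (hx : x ≠ 0) : ContDiffAt ℝ 2 F x := (h.at hx).of_le two_le_inf
theorem Sm.df {F : E3 → ℝ} (h : Sm F) {x : E3} (hx : x ≠ 0) : DifferentiableAt ℝ F x := C2.df (h.c2 hx)
theorem Sm.fd {F : E3 → ℝ} (h : Sm F) (v : E3) : Sm (fun x => fderiv ℝ F x v) :=
  (h.fderiv_of_isOpen isOpen_compl_singleton (m := ∞) (by simp)).clm_apply contDiffOn_const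
theorem Sm.mul {F G : E3 → ℝ} (hF : Sm F) (hG : Sm G) : Sm (fun x => F x * G x) := ContDiffOn.mul hF hG
theorem Sm.sub {F G : E3 → ℝ} (hF : Sm F) (hG : Sm G) : Sm (fun x => F x - G x) := ContDiffOn.sub hF hG
theorem Sm_inner (n : E3) : Sm (fun x => inner ℝ n x) := (innerSL ℝ n).contDiff.contDiffOn

theorem ev_ne {x : E3} (hx : x ≠ 0) : ∀ᶠ z in 𝓝 x, z ≠ 0 := isOpen_ne.mem_nhds hx

theorem fd_inner (n x v : E3) : fderiv ℝ (fun x => (inner ℝ n x : ℝ)) x v = inner ℝ n v := by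
  have : HasFDerivAt (fun x => (inner ℝ n x : ℝ)) (innerSL ℝ n) x := (innerSL ℝ n).hasFDerivAt
  rw [this.fderiv]; rfl

theorem fd_mul {F G : E3 → ℝ} {x : E3} (hF : DifferentiableAt ℝ F x) (hG : DifferentiableAt ℝ G x) (v : E3) :
    fderiv ℝ (fun z => F z * G z) x v = F x * fderiv ℝ G x v + G x * fderiv ℝ F x v := by
  have h := hF.hasFDerivAt.fun_mul hG.hasFDerivAt
  rw [h.fderiv]; rfl

theorem fd_sub {F G : E3 → ℝ} {x : E3} (hF : DifferentiableAt ℝ F x) (hG : DifferentiableAt ℝ G x) (v : E3) :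
    fderiv ℝ (fun z => F z - G z) x v = fderiv ℝ F x v - fderiv ℝ G x v := by
  have h := hF.hasFDerivAt.fun_sub hG.hasFDerivAt
  rw [h.fderiv]; rfl

theorem fd_congr {F G : E3 → ℝ} (h : ∀ z, z ≠ 0 → F z = G z) {x : E3} (hx : x ≠ 0) : fderiv ℝ F x = fderiv ℝ G x := by
  apply EventuallyEq.fderiv_eq (𝕜 := ℝ)
  filter_upwards [ev_ne hx] with z hz using h z hz

theorem lap3_eq_fd {F : E3 → ℝ} (h : Sm F) {x : E3} (hx : x ≠ 0) :
    lap3 F x = ∑ i, fderiv ℝ (fun z => fderiv ℝ F z (EuclideanSpace.basisFun (Fin 3) ℝ i)) x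
      (EuclideanSpace.basisFun (Fin 3) ℝ i) := by
  unfold lap3
  refine Finset.sum_congr rfl fun i _ => ?_
  rw [D2_apply (h.c2 hx)]

theorem dd_comm {F : E3 → ℝ} (h : Sm F) (u v : E3) {x : E3} (hx : x ≠ 0) :
    fderiv ℝ (fun z => fderiv ℝ F z u) x v = fderiv ℝ (fun z => fderiv ℝ F z v) x u := by
  rw [D2_apply (h.c2 hx), D2_apply (h.c2 hx), D2_symm (h.c2 hx)]

theorem Sm.lap {F : E3 → ℝ} (h : Sm F) : Sm (lap3 F) := by
  have : Sm (fun x => ∑ i, fderiv ℝ (fun z => fderiv ℝ F z (EuclideanSpace.basisFun (Fin 3) ℝ i)) x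
      (EuclideanSpace.basisFun (Fin 3) ℝ i)) := ContDiffOn.sum fun i _ => (h.fd _).fd _
  exact this.congr fun x hx => lap3_eq_fd h hx

theorem lap3_fd {F : E3 → ℝ} (h : Sm F) (m : E3) {x : E3} (hx : x ≠ 0) :
    lap3 (fun z => fderiv ℝ F z m) x = fderiv ℝ (lap3 F) x m := by
  rw [lap3_eq_fd (h.fd m) hx, fd_congr (fun z hz => lap3_eq_fd h hz) hx]
  rw [fderiv_fun_sum (fun i _ => ((h.fd _).fd _).df hx)]
  rw [ContinuousLinearMap.sum_apply]
  refine Finset.sum_congr rfl fun i _ => ?_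
  rw [← dd_comm (h.fd _) m _ hx]
  rw [fd_congr (fun z hz => dd_comm h _ m hz) hx]

theorem lap3_inner_mul {G : E3 → ℝ} (h : Sm G) (n : E3) {x : E3} (hx : x ≠ 0) :
    lap3 (fun z => inner ℝ n z * G z) x = inner ℝ n x * lap3 G x + 2 * fderiv ℝ G x n := by
  have hn := (EuclideanSpace.basisFun (Fin 3) ℝ).sum_repr' n
  have key : ∀ e : E3, D2 (fun z => inner ℝ n z * G z) x e e = inner ℝ n x * D2 G x e e
      + 2 * (inner ℝ e n * fderiv ℝ G x e) := by
    intro e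
    rw [← D2_apply (((Sm_inner n).mul h).c2 hx)]
    rw [fd_congr (F := fun z => fderiv ℝ (fun z => inner ℝ n z * G z) z e)
      (G := fun z => inner ℝ n z * fderiv ℝ G z e + G z * inner ℝ n e) ?_ hx]
    · have h1 := ((Sm_inner n).df hx).hasFDerivAt.fun_mul ((h.fd e).df hx).hasFDerivAt
      have h2 := (h1.fun_add ((h.df hx).hasFDerivAt.mul_const (inner ℝ n e)))
      rw [h2.fderiv]
      simp only [_root_.add_apply, _root_.smul_apply, smul_eq_mul]
      rw [fd_inner, D2_apply (h.c2 hx), real_inner_comm n e]; ring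
    · intro z hz
      rw [fd_mul ((Sm_inner n).df hz) (h.df hz), fd_inner]
  unfold lap3
  rw [Finset.sum_congr rfl fun i _ => key _, Finset.sum_add_distrib, ← Finset.mul_sum, ← Finset.mul_sum]
  congr 2
  conv_rhs => rw [← hn]
  rw [map_sum]
  refine Finset.sum_congr rfl fun i _ => ?_
  rw [map_smul, smul_eq_mul]

def rot (n m : E3) (F : E3 → ℝ) : E3 → ℝ := fun x => inner ℝ n x * fderiv ℝ F x m - inner ℝ m x * fderiv ℝ F x n

theorem Sm.rot {F : E3 → ℝ} (h : Sm F) (n m : E3) : Sm (rot n m F) :=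
  ((Sm_inner n).mul (h.fd m)).sub ((Sm_inner m).mul (h.fd n))

theorem Hom0.rot {F : E3 → ℝ} (h : Hom0 F) (n m : E3) : Hom0 (rot n m F) := by
  refine ⟨Sm.rot h.smooth n m, fun t ht x => ?_⟩
  by_cases hx : x = 0
  · rw [hx, smul_zero]
  · unfold MF.rot
    rw [h.fd_smul ht hx, h.fd_smul ht hx, inner_smul_right, inner_smul_right]
    field_simp

theorem rot_even {F : E3 → ℝ} (h : ∀ x, F (-x) = F x) (n m x : E3) : rot n m F (-x) = rot n m F x := by
  unfold rot
  rw [fd_even h, fd_even h, inner_neg_right, inner_neg_right]; ring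

theorem lap3_rot {F : E3 → ℝ} (h : Sm F) (n m : E3) {x : E3} (hx : x ≠ 0) :
    lap3 (rot n m F) x = rot n m (lap3 F) x := by
  unfold rot
  rw [lap3_sub (((Sm_inner n).mul (h.fd m)).c2 hx) (((Sm_inner m).mul (h.fd n)).c2 hx)]
  rw [lap3_inner_mul (h.fd m) n hx, lap3_inner_mul (h.fd n) m hx, lap3_fd h m hx, lap3_fd h n hx, dd_comm h n m hx]
  ring

theorem lap3_rot_div {F G : E3 → ℝ} (h : Sm F) (hG : Sm G) (hl : ∀ x, x ≠ 0 → lap3 F x = G x / ‖x‖ ^ 2)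
    (n m : E3) {x : E3} (hx : x ≠ 0) :
    lap3 (rot n m F) x = rot n m G x / ‖x‖ ^ 2 := by
  rw [lap3_rot h n m hx]
  have hx2 : ‖x‖ ^ 2 ≠ 0 := by simpa using hx
  have hn : HasFDerivAt (fun z : E3 => ‖z‖ ^ 2) (2 • innerSL ℝ x) x := (hasStrictFDerivAt_norm_sq x).hasFDerivAt
  have key : ∀ v, fderiv ℝ G x v = ‖x‖ ^ 2 * fderiv ℝ (lap3 F) x v + lap3 F x * (2 * inner ℝ x v) := by
    intro v
    rw [fd_congr (F := G) (G := fun z => ‖z‖ ^ 2 * lap3 F z) ?_ hx]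
    · have := hn.fun_mul (h.lap.df hx).hasFDerivAt
      rw [this.fderiv]
      simp
    · intro z hz
      have hz2 : ‖z‖ ^ 2 ≠ 0 := by simpa using hz
      rw [hl z hz]; field_simp
  unfold rot
  rw [key, key, eq_div_iff hx2, real_inner_comm x n, real_inner_comm x m]; ring

section
variable {lam : ℝ} {U : E3 → ℝ}

theorem Sol.lap_rot (h : Sol lam U) (n m : E3) {x : E3} (hx : x ≠ 0) :
    lap3 (rot n m U) x = - (lam * Real.exp (U x) * rot n m U x) / ‖x‖ ^ 2 := by
  have hs : Sm U := h.hU.smooth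
  have hg : Sm (fun x => lam * (1 - Real.exp (U x))) :=
    ContDiffOn.mul contDiffOn_const (ContDiffOn.sub contDiffOn_const h.hU.smooth.exp)
  rw [lap3_rot_div hs hg h.pde n m hx]
  congr 1
  have : ∀ v, fderiv ℝ (fun x => lam * (1 - Real.exp (U x))) x v = - (lam * Real.exp (U x) * fderiv ℝ U x v) := by
    intro v
    have h1 := ((h.hU.df hx).hasFDerivAt.exp.const_sub 1).const_mul lam
    rw [h1.fderiv]; simp; ring
  unfold rot
  rw [this, this]; ring

theorem ED_rot (h : Sol lam U) (h2 : 2 < lam) (n m : E3) : ED lam (rot n m U) :=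
  ED_lin (by linarith) h (h.hU.rot n m) (rot_even h.even n m) fun _ hx => h.lap_rot n m hx

theorem inner_rf (k n x : E3) : inner ℝ n (rf k x) = (inner ℝ (rf k n) x : ℝ) := by
  rw [← LinearIsometryEquiv.inner_map_map (rf k) n (rf k x), rf_rf]

theorem rot_rf {F : E3 → ℝ} (hF : Hom0 F) (k : E3) {σ : ℝ} (h : ∀ x, F (rf k x) = σ * F x) (n m : E3) {x : E3} (hx : x ≠ 0) :
    rot n m F (rf k x) = σ * rot (rf k n) (rf k m) F x := by
  unfold rot
  have e : ∀ v, fderiv ℝ F (rf k x) v = σ * fderiv ℝ F x (rf k v) := fun v => by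
    rw [← fd_sgn hF k h hx, rf_rf]
  rw [e, e, inner_rf, inner_rf]; ring

theorem rot_neg_left (n m : E3) (F : E3 → ℝ) (x : E3) : rot (-n) m F x = - rot n m F x := by
  unfold rot; rw [inner_neg_left, map_neg]; ring
theorem rot_neg_right (n m : E3) (F : E3 → ℝ) (x : E3) : rot n (-m) F x = - rot n m F x := by
  unfold rot; rw [inner_neg_left, map_neg]; ring
theorem rot_swap (n m : E3) (F : E3 → ℝ) (x : E3) : rot m n F x = - rot n m F x := by
  unfold rot; ring
theorem rot_at_zero (n m : E3) (F : E3 → ℝ) : rot n m F 0 = 0 := by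
  unfold rot; simp

theorem rot_odd (h : Sol lam U) {a : ONB} (hs : Sym U a) {i j : Fin 3} (hij : i ≠ j) (x : E3) :
    rot (a i) (a j) U (rf (a i) x) = - rot (a i) (a j) U x := by
  by_cases hx : x = 0
  · rw [hx, map_zero, rot_at_zero, neg_zero]
  rw [rot_rf h.hU (a i) (σ := 1) (by simpa using hs i) _ _ hx, rf_onb, rf_onb, if_pos rfl, if_neg hij, rot_neg_left, one_mul]

theorem rot_odd' (h : Sol lam U) {a : ONB} (hs : Sym U a) {i j : Fin 3} (hij : i ≠ j) (x : E3) :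
    rot (a i) (a j) U (rf (a j) x) = - rot (a i) (a j) U x := by
  rw [rot_swap (a j), rot_odd h hs hij.symm, rot_swap (a i), neg_neg]

theorem rot_inv (h : Sol lam U) {a : ONB} (hs : Sym U a) {i j k : Fin 3} (hik : k ≠ i) (hjk : k ≠ j) (x : E3) :
    rot (a i) (a j) U (rf (a k) x) = rot (a i) (a j) U x := by
  by_cases hx : x = 0
  · rw [hx, map_zero]
  rw [rot_rf h.hU (a k) (σ := 1) (by simpa using hs k) _ _ hx, rf_onb, rf_onb, if_neg hik, if_neg hjk, one_mul]

theorem polar (p q : ℝ) : ∃ r θ : ℝ, 0 ≤ r ∧ r ^ 2 = p ^ 2 + q ^ 2 ∧ p = r * cos θ ∧ q = r * sin θ := by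
  refine ⟨‖(⟨p, q⟩ : ℂ)‖, Complex.arg ⟨p, q⟩, norm_nonneg _, ?_, ?_, ?_⟩
  · rw [← Complex.normSq_eq_norm_sq, Complex.normSq_mk]; ring
  · rw [Complex.norm_mul_cos_arg]
  · rw [Complex.norm_mul_sin_arg]

theorem rot_zero_ax (hU : Hom0 U) (a : ONB) (h : ∀ x, x ≠ 0 → rot (a 0) (a 1) U x = 0) : Ax U := by
  refine ⟨a 2, onb_norm a 2, fun x x' hx hx' hi => ?_⟩
  obtain ⟨r, θ, r0, hr, e0, e1⟩ := polar (inner ℝ (a 0) x) (inner ℝ (a 1) x)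
  obtain ⟨r', θ', r0', hr', e0', e1'⟩ := polar (inner ℝ (a 0) x') (inner ℝ (a 1) x')
  have n1 := onb_normsq a x
  have n2 := onb_normsq a x'
  rw [hx] at n1
  rw [hx'] at n2
  rw [real_inner_comm, real_inner_comm (a 2) x'] at hi
  rw [← hi] at n2
  have rr : r' = r := by
    have : r' ^ 2 = r ^ 2 := by linarith
    exact (sq_eq_sq₀ r0' r0).1 this
  set t : ℝ := inner ℝ (a 2) x with ht
  set γ : ℝ → E3 := fun θ => (r * cos θ) • a 0 + (r * sin θ) • a 1 + t • a 2 with hγ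
  have hx1 : x = γ θ := by rw [onb_expand a x, e0, e1]
  have hx2 : x' = γ θ' := by rw [onb_expand a x', e0', e1', ← hi, rr]
  have g0 : ∀ θ, inner ℝ (a 0) (γ θ) = r * cos θ := fun θ => by
    simp only [hγ, inner_add_right, inner_smul_right, onb_inner]; simp
  have g1 : ∀ θ, inner ℝ (a 1) (γ θ) = r * sin θ := fun θ => by
    simp only [hγ, inner_add_right, inner_smul_right, onb_inner]; simp
  have g2 : ∀ θ, inner ℝ (a 2) (γ θ) = t := fun θ => by
    simp only [hγ, inner_add_right, inner_smul_right, onb_inner]; simp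
  have gn : ∀ θ, γ θ ≠ 0 := fun θ h0 => by
    have := onb_normsq a (γ θ)
    rw [g0, g1, g2, h0, norm_zero] at this
    have hcs := cos_sq_add_sin_sq θ
    have : 0 = r ^ 2 * (cos θ ^ 2 + sin θ ^ 2) + t ^ 2 := by linarith
    rw [hcs] at this
    linarith
  have gd : ∀ θ, HasDerivAt (fun s => U (γ s)) 0 θ := by
    intro θ
    have d1 : HasDerivAt γ ((r * (-sin θ)) • a 0 + (r * cos θ) • a 1) θ := by
      have := ((((hasDerivAt_cos θ).const_mul r).smul_const (a 0)).add
        (((hasDerivAt_sin θ).const_mul r).smul_const (a 1))).add_const (t • a 2)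
      exact this
    have d2 : HasDerivAt (fun s => U (γ s)) _ θ := (hU.df (gn θ)).hasFDerivAt.comp_hasDerivAt θ d1
    have := h (γ θ) (gn θ)
    unfold rot at this
    rw [g0, g1] at this
    rw [map_add, map_smul, map_smul, smul_eq_mul, smul_eq_mul] at d2
    rwa [show r * -sin θ * fderiv ℝ U (γ θ) (a 0) + r * cos θ * fderiv ℝ U (γ θ) (a 1) = 0 by linarith] at d2
  rw [hx1, hx2]
  exact is_const_of_deriv_eq_zero (fun s => (gd s).differentiableAt) (fun s => (gd s).deriv) θ θ'

end
end MF

namespace MF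
open scoped ContDiff Topology
open Filter

/-! ### The rectangle lemma -/

theorem slice_x {f : ℝ × ℝ → ℝ} (hf : ContDiff ℝ ∞ f) (r α : ℝ) : HasDerivAt (fun t => f (t, α)) (dx f (r, α)) r := by
  have h : HasDerivAt (fun t : ℝ => (t, α)) ((1:ℝ), (0:ℝ)) r := (hasDerivAt_id r).prodMk (hasDerivAt_const r α)
  exact (hf.mdf (r, α)).hasFDerivAt.comp_hasDerivAt r h

theorem slice_y {f : ℝ × ℝ → ℝ} (hf : ContDiff ℝ ∞ f) (r α : ℝ) : HasDerivAt (fun t => f (r, t)) (dy f (r, α)) α := by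
  have h : HasDerivAt (fun t : ℝ => (r, t)) ((0:ℝ), (1:ℝ)) α := (hasDerivAt_const α r).prodMk (hasDerivAt_id α)
  exact (hf.mdf (r, α)).hasFDerivAt.comp_hasDerivAt α h

theorem quot_exists {F : ℝ × ℝ → ℝ} (hF : ContDiff ℝ ∞ F) (F0 : ∀ α, F (0, α) = 0) (F1 : ∀ α, F (1, α) = 0) :
    ∃ A : ℝ × ℝ → ℝ, Continuous A ∧ (∀ p, F p = p.1 * (1 - p.1) * A p) ∧ (∀ α, A (0, α) = dx F (0, α)) ∧
      ∀ α, A (1, α) = - dx F (1, α) := by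
  have hc := hF.mdx.continuous
  set I : ℝ × ℝ → ℝ := fun p => ∫ t in (0:ℝ)..1, dx F (t * p.1, p.2) with hI
  set J : ℝ × ℝ → ℝ := fun p => ∫ t in (0:ℝ)..1, dx F (1 - t * (1 - p.1), p.2) with hJ
  have cI : Continuous I := by
    apply intervalIntegral.continuous_parametric_intervalIntegral_of_continuous'
    fun_prop
  have cJ : Continuous J := by
    apply intervalIntegral.continuous_parametric_intervalIntegral_of_continuous'
    fun_prop
  have eI : ∀ p, p.1 * I p = F p := by
    intro p
    simp only [hI]
    rw [← intervalIntegral.integral_const_mul]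
    rw [intervalIntegral.integral_eq_sub_of_hasDerivAt (f := fun t => F (t * p.1, p.2))]
    · simp [F0]
    · intro t _
      have h2 : HasDerivAt (fun t : ℝ => t * p.1) p.1 t := by simpa using (hasDerivAt_id t).mul_const p.1
      have := (slice_x hF (t * p.1) p.2).comp t h2
      rw [mul_comm]; exact this
    · apply Continuous.intervalIntegrable; fun_prop
  have eJ : ∀ p, (1 - p.1) * J p = - F p := by
    intro p
    simp only [hJ]
    rw [← intervalIntegral.integral_const_mul]
    rw [intervalIntegral.integral_eq_sub_of_hasDerivAt (f := fun t => - F (1 - t * (1 - p.1), p.2))]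
    · simp [F1]
    · intro t _
      have h2 : HasDerivAt (fun t : ℝ => 1 - t * (1 - p.1)) (-(1 - p.1)) t := by
        simpa using ((hasDerivAt_id t).mul_const (1 - p.1)).const_sub 1
      have := ((slice_x hF (1 - t * (1 - p.1)) p.2).comp t h2).neg
      have h3 : HasDerivAt (fun t => - F (1 - t * (1 - p.1), p.2)) (-(dx F (1 - t * (1 - p.1), p.2) * -(1 - p.1))) t := this
      rw [show (1 - p.1) * dx F (1 - t * (1 - p.1), p.2) = -(dx F (1 - t * (1 - p.1), p.2) * -(1 - p.1)) by ring]
      exact h3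
    · apply Continuous.intervalIntegrable; fun_prop
  refine ⟨fun p => I p - J p, cI.sub cJ, fun p => ?_, fun α => ?_, fun α => ?_⟩
  · have := eI p; have := eJ p
    linear_combination (-(1 - p.1)) * eI p + p.1 * eJ p
  · have h1 : I (0, α) = dx F (0, α) := by simp [hI]
    have h2 := eJ (0, α)
    simp [F0] at h2
    simp only [h1, h2]; ring
  · have h1 : J (1, α) = dx F (1, α) := by simp [hJ]
    have h2 := eI (1, α)
    simp [F1] at h2
    simp only [h1, h2]; ring

theorem stay_le {f : ℝ → ℝ} (hf : Continuous f) {b m m' : ℝ} (h0 : f 0 ≤ m) (hm : m < m')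
    (h : ∀ t, 0 ≤ t → t ≤ b → m < f t → f t < m' → False) : ∀ t, 0 ≤ t → t ≤ b → f t ≤ m := by
  intro t ht htb
  by_contra! hc
  have h1 : m < min (f t) m' := lt_min hc hm
  obtain ⟨v, hv1, hv2⟩ := exists_between h1
  have : v ∈ f '' Set.Icc 0 t := intermediate_value_Icc ht hf.continuousOn
    ⟨by linarith, (hv2.trans_le (min_le_left _ _)).le⟩
  obtain ⟨z, hz, rfl⟩ := this
  exact h z hz.1 (hz.2.trans htb) hv1 (hv2.trans_le (min_le_right _ _))

theorem stay_ge {f : ℝ → ℝ} (hf : Continuous f) {b m m' : ℝ} (h0 : m ≤ f 0) (hm : m' < m)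
    (h : ∀ t, 0 ≤ t → t ≤ b → f t < m → m' < f t → False) : ∀ t, 0 ≤ t → t ≤ b → m ≤ f t := by
  intro t ht htb
  have := stay_le (f := fun t => - f t) hf.neg (b := b) (m := -m) (m' := -m') (by linarith) (by linarith)
    (fun t h1 h2 h3 h4 => h t h1 h2 (by linarith) (by linarith)) t ht htb
  linarith

theorem angle_lift {A B : ℝ × ℝ → ℝ} (hA : Continuous A) (hB : Continuous B) {b : ℝ} (hb : 0 ≤ b)
    (hne : ∀ r α : ℝ, 0 ≤ r → r ≤ 1 → 0 ≤ α → α ≤ b → A (r, α) = 0 → B (r, α) = 0 → False) :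
    ∃ ρ ϑ : ℝ × ℝ → ℝ, Continuous ϑ ∧ ∀ r α : ℝ, 0 ≤ r → r ≤ 1 → 0 ≤ α → α ≤ b →
      0 < ρ (r, α) ∧ A (r, α) = ρ (r, α) * cos (ϑ (r, α)) ∧ B (r, α) = ρ (r, α) * sin (ϑ (r, α)) := by
  set cl : ℝ × ℝ → ℝ × ℝ := fun p => (max 0 (min 1 p.1), max 0 (min b p.2)) with hcl
  have ccl : Continuous cl := by fun_prop
  set H : ℝ × ℝ → ℂ := fun p => ⟨A (cl p), B (cl p)⟩ with hH
  have cH : Continuous H := by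
    have : H = fun p => (A (cl p) : ℂ) + (B (cl p) : ℂ) * Complex.I := by
      funext p; rw [hH]; exact Complex.mk_eq_add_mul_I _ _
    rw [this]
    fun_prop
  have sc : IsSimplyConnected (Set.univ : Set (ℝ × ℝ)) := by
    have : ContractibleSpace (Set.univ : Set (ℝ × ℝ)) := convex_univ.contractibleSpace ⟨0, trivial⟩
    show SimplyConnectedSpace (Set.univ : Set (ℝ × ℝ))
    infer_instance
  obtain ⟨L, hL, hLe⟩ := Complex.exists_continuousOn_eqOn_exp_comp sc isOpen_univ cH.continuousOn (by
    rintro ⟨p, -, hp⟩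
    have h1 := congrArg Complex.re hp
    have h2 := congrArg Complex.im hp
    exact hne (cl p).1 (cl p).2 (le_max_left _ _) (max_le zero_le_one (min_le_left _ _)) (le_max_left _ _)
      (max_le hb (min_le_left _ _)) h1 h2)
  refine ⟨fun p => Real.exp (L p).re, fun p => (L p).im, Complex.continuous_im.comp (continuousOn_univ.1 hL), fun r α h1 h2 h3 h4 => ?_⟩
  have e := hLe (Set.mem_univ (r, α))
  have ecl : cl (r, α) = (r, α) := by simp [hcl, h1, h2, h3, h4]
  simp only [Function.comp, hH, ecl] at e
  refine ⟨Real.exp_pos _, ?_, ?_⟩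
  · have := congrArg Complex.re e
    rw [Complex.exp_re] at this; exact this.symm
  · have := congrArg Complex.im e
    rw [Complex.exp_im] at this; exact this.symm

set_option maxHeartbeats 1000000 in
theorem rect_pos {F G : ℝ × ℝ → ℝ} (hF : ContDiff ℝ ∞ F) (hG : ContDiff ℝ ∞ G)
    (F0 : ∀ α, F (0, α) = 0) (F1 : ∀ α, F (1, α) = 0) (G0 : ∀ α, G (0, α) = 0) (G1 : ∀ α, G (1, α) = 0)
    (Ga : ∀ r, G (r, 0) = 0) (Fb : ∀ r, F (r, π / 2) = 0) {c1 c3 : ℝ} (p1 : 0 < c1) (p3 : 0 < c3)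
    (hc1 : ∀ α, dx F (0, α) = c1 * cos α) (hc3 : ∀ α, dx G (0, α) = c3 * sin α)
    (hne : ∀ r α, 0 < r → r < 1 → 0 < α → α < π / 2 → F (r, α) = 0 → G (r, α) = 0 → False)
    (hFe : ∀ r, 0 < r → r < 1 → F (r, 0) ≠ 0) (hGe : ∀ r, 0 < r → r < 1 → G (r, π / 2) ≠ 0)
    (hInt : ∀ r α c s, 0 < r → r < 1 → 0 < α → α < π / 2 → (c ≠ 0 ∨ s ≠ 0) →
      c * F (r, α) + s * G (r, α) = 0 → c * dx F (r, α) + s * dx G (r, α) = 0 →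
      c * dy F (r, α) + s * dy G (r, α) = 0 → False)
    (h1 : ∀ α c s, 0 ≤ α → α ≤ π / 2 → (c ≠ 0 ∨ s ≠ 0) → c * dx F (1, α) + s * dx G (1, α) = 0 →
      c * dy (dx F) (1, α) + s * dy (dx G) (1, α) = 0 → False) :
    ∀ r α, 0 < r → r < 1 → 0 < α → α < π / 2 → F (r, α) ≠ 0 ∧ G (r, α) ≠ 0 := by
  have hpi := Real.pi_pos
  obtain ⟨A, cA, eA, A0, A1⟩ := quot_exists hF F0 F1
  obtain ⟨B, cB, eB, B0, B1⟩ := quot_exists hG G0 G1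
  have ABne : ∀ r α : ℝ, 0 ≤ r → r ≤ 1 → 0 ≤ α → α ≤ π / 2 → A (r, α) = 0 → B (r, α) = 0 → False := by
    intro r α hr0 hr1 ha0 hab hA hB
    have fz : F (r, α) = 0 := by rw [eA, hA]; ring
    have gz : G (r, α) = 0 := by rw [eB, hB]; ring
    rcases hr0.eq_or_lt with rfl | hr0
    · rw [A0, hc1] at hA; rw [B0, hc3] at hB
      have e1 := (mul_eq_zero.1 hA).resolve_left p1.ne'
      have e2 := (mul_eq_zero.1 hB).resolve_left p3.ne'
      have := cos_sq_add_sin_sq α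
      rw [e1, e2] at this; norm_num at this
    rcases hr1.eq_or_lt with rfl | hr1
    · rw [A1, neg_eq_zero] at hA; rw [B1, neg_eq_zero] at hB
      by_cases hz : dy (dx F) (1, α) = 0
      · exact h1 α 1 0 ha0 hab (by simp) (by rw [hA]; ring) (by rw [hz]; ring)
      · exact h1 α (- dy (dx G) (1, α)) (dy (dx F) (1, α)) ha0 hab (Or.inr hz) (by rw [hA, hB]; ring) (by ring)
    rcases ha0.eq_or_lt with rfl | ha0
    · exact hFe r hr0 hr1 fz
    rcases hab.eq_or_lt with rfl | hab
    · exact hGe r hr0 hr1 gz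
    exact hne r α hr0 hr1 ha0 hab fz gz
  have Ba : ∀ r, 0 ≤ r → r ≤ 1 → B (r, 0) = 0 := by
    have hx : ∀ r, dx G (r, 0) = 0 := fun r => by
      have := slice_x hG r 0
      simp only [Ga] at this
      exact this.unique (hasDerivAt_const r 0)
    intro r hr0 hr1
    rcases hr0.eq_or_lt with rfl | hr0
    · rw [B0, hx]
    rcases hr1.eq_or_lt with rfl | hr1
    · rw [B1, hx, neg_zero]
    have := eB (r, 0)
    rw [Ga] at this
    simpa [hr0.ne', (sub_pos.2 hr1).ne'] using this.symm
  have Ab : ∀ r, 0 ≤ r → r ≤ 1 → A (r, π / 2) = 0 := by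
    have hx : ∀ r, dx F (r, π / 2) = 0 := fun r => by
      have := slice_x hF r (π / 2)
      simp only [Fb] at this
      exact this.unique (hasDerivAt_const r 0)
    intro r hr0 hr1
    rcases hr0.eq_or_lt with rfl | hr0
    · rw [A0, hx]
    rcases hr1.eq_or_lt with rfl | hr1
    · rw [A1, hx, neg_zero]
    have := eA (r, π / 2)
    rw [Fb] at this
    simpa [hr0.ne', (sub_pos.2 hr1).ne'] using this.symm
  obtain ⟨ρ, ϑ0, cϑ0, hρ0⟩ := angle_lift cA cB (by positivity : (0:ℝ) ≤ π / 2) ABne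
  -- normalisation
  have s0 : sin (ϑ0 (0, 0)) = 0 := by
    obtain ⟨e1, -, e3⟩ := hρ0 0 0 le_rfl zero_le_one le_rfl (by positivity)
    rw [Ba 0 le_rfl zero_le_one] at e3
    exact (mul_eq_zero.1 e3.symm).resolve_left e1.ne'
  have co0 : cos (ϑ0 (0, 0)) = 1 := by
    obtain ⟨e1, e2, -⟩ := hρ0 0 0 le_rfl zero_le_one le_rfl (by positivity)
    rw [A0, hc1, cos_zero, mul_one] at e2
    have h3 : 0 < cos (ϑ0 (0, 0)) := by
      by_contra hcon
      push Not at hcon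
      nlinarith
    have := cos_sq_add_sin_sq (ϑ0 (0, 0))
    rw [s0] at this
    nlinarith
  set ϑ : ℝ × ℝ → ℝ := fun p => ϑ0 p - ϑ0 (0, 0) with hϑ
  have cϑ : Continuous ϑ := by fun_prop
  have hρ : ∀ r α : ℝ, 0 ≤ r → r ≤ 1 → 0 ≤ α → α ≤ π / 2 →
      0 < ρ (r, α) ∧ A (r, α) = ρ (r, α) * cos (ϑ (r, α)) ∧ B (r, α) = ρ (r, α) * sin (ϑ (r, α)) := by
    intro r α a1 a2 a3 a4
    have := hρ0 r α a1 a2 a3 a4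
    simp only [hϑ, cos_sub, sin_sub, s0, co0]
    simpa using this
  have z00 : ϑ (0, 0) = 0 := by simp [hϑ]
  clear_value ϑ
  -- edges
  have ea : ∀ r, 0 ≤ r → r ≤ 1 → ϑ (r, 0) = 0 := by
    have hs : ∀ r, 0 ≤ r → r ≤ 1 → sin (ϑ (r, 0)) = 0 := fun r a1 a2 => by
      obtain ⟨e1, -, e3⟩ := hρ r 0 a1 a2 le_rfl (by positivity)
      rw [Ba r a1 a2] at e3
      exact (mul_eq_zero.1 e3.symm).resolve_left e1.ne'
    have cf : Continuous fun r : ℝ => ϑ (r, 0) := by fun_prop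
    intro r a1 a2
    refine le_antisymm ?_ ?_
    · exact stay_le cf (b := 1) z00.le hpi (fun t b1 b2 b3 b4 => (sin_pos_of_pos_of_lt_pi b3 b4).ne' (hs t b1 b2)) r a1 a2
    · exact stay_ge cf (b := 1) z00.ge (neg_lt_zero.2 hpi) (fun t b1 b2 b3 b4 => (sin_neg_of_neg_of_neg_pi_lt b3 b4).ne (hs t b1 b2)) r a1 a2
  have e0 : ∀ α, 0 ≤ α → α ≤ π / 2 → 0 ≤ ϑ (0, α) ∧ ϑ (0, α) ≤ π / 2 := by
    have cf : Continuous fun α : ℝ => ϑ (0, α) := by fun_prop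
    intro α a1 a2
    refine ⟨stay_ge cf (b := π / 2) z00.ge (neg_lt_zero.2 hpi) (fun t b1 b2 b3 b4 => ?_) α a1 a2,
      stay_le cf (b := π / 2) (m' := π) (by simp only [z00]; positivity) (by linarith) (fun t b1 b2 b3 b4 => ?_) α a1 a2⟩
    · obtain ⟨e1, -, e3⟩ := hρ 0 t le_rfl zero_le_one b1 b2
      rw [B0, hc3] at e3
      have := sin_nonneg_of_nonneg_of_le_pi b1 (by linarith)
      have := mul_nonneg p3.le this
      have := mul_neg_of_pos_of_neg e1 (sin_neg_of_neg_of_neg_pi_lt b3 b4)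
      linarith
    · obtain ⟨e1, e2, -⟩ := hρ 0 t le_rfl zero_le_one b1 b2
      rw [A0, hc1] at e2
      have := cos_nonneg_of_neg_pi_div_two_le_of_le (by linarith : -(π / 2) ≤ t) b2
      have := mul_nonneg p1.le this
      have := mul_neg_of_pos_of_neg e1 (cos_neg_of_pi_div_two_lt_of_lt b3 (by linarith))
      linarith
  have eb : ∀ r, 0 ≤ r → r ≤ 1 → ϑ (r, π / 2) = π / 2 := by
    have hs : ∀ r, 0 ≤ r → r ≤ 1 → cos (ϑ (r, π / 2)) = 0 := fun r a1 a2 => by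
      obtain ⟨e1, e2, -⟩ := hρ r (π / 2) a1 a2 (by positivity) le_rfl
      rw [Ab r a1 a2] at e2
      exact (mul_eq_zero.1 e2.symm).resolve_left e1.ne'
    have st : ϑ (0, π / 2) = π / 2 := by
      obtain ⟨b1, b2⟩ := e0 (π / 2) (by positivity) le_rfl
      by_contra hcon
      exact (cos_pos_of_mem_Ioo ⟨by linarith, lt_of_le_of_ne b2 hcon⟩).ne' (hs 0 le_rfl zero_le_one)
    have cf : Continuous fun r : ℝ => ϑ (r, π / 2) := by fun_prop
    intro r a1 a2
    refine le_antisymm ?_ ?_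
    · exact stay_le cf (b := 1) (m' := π) st.le (by linarith) (fun t b1 b2 b3 b4 => (cos_neg_of_pi_div_two_lt_of_lt b3 (by linarith)).ne (hs t b1 b2)) r a1 a2
    · exact stay_ge cf (b := 1) (m' := -(π / 2)) st.ge (by linarith) (fun t b1 b2 b3 b4 => (cos_pos_of_mem_Ioo ⟨b4, b3⟩).ne' (hs t b1 b2)) r a1 a2
  -- no extremum
  have noext : ∀ (σ r α : ℝ), (σ = 1 ∨ σ = -1) → 0 < r → r ≤ 1 → 0 < α → α < π / 2 →
      (∀ r' α', 0 ≤ r' → r' ≤ 1 → 0 ≤ α' → α' ≤ π / 2 → σ * (ϑ (r', α') - ϑ (r, α)) ≤ 0) → False := by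
    intro σ r α hσ hr0 hr1 ha0 hab hm
    set M := ϑ (r, α) with hM
    have hcs : (- (σ * sin M) ≠ 0 ∨ σ * cos M ≠ 0) := by
      by_contra! hcon
      have := cos_sq_add_sin_sq M
      rcases hσ with rfl | rfl <;> simp at hcon <;> rw [hcon.1, hcon.2] at this <;> norm_num at this
    have nb : ∀ᶠ p in 𝓝 ((r, α) : ℝ × ℝ), |ϑ p - M| < π := by
      have : Continuous fun p => |ϑ p - M| := by fun_prop
      refine this.continuousAt.eventually_lt continuousAt_const ?_
      simp [hM, hpi]
    have sg : ∀ r' α', 0 ≤ r' → r' ≤ 1 → 0 ≤ α' → α' ≤ π / 2 → |ϑ (r', α') - M| < π →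
        - (σ * sin M) * A (r', α') + σ * cos M * B (r', α') ≤ 0 := by
      intro r' α' a1 a2 a3 a4 a5
      obtain ⟨e1, e2, e3⟩ := hρ r' α' a1 a2 a3 a4
      have hh := hm r' α' a1 a2 a3 a4
      rw [e2, e3]
      have : - (σ * sin M) * (ρ (r', α') * cos (ϑ (r', α'))) + σ * cos M * (ρ (r', α') * sin (ϑ (r', α')))
          = ρ (r', α') * (σ * sin (ϑ (r', α') - M)) := by rw [sin_sub]; ring
      rw [this]
      apply mul_nonpos_of_nonneg_of_nonpos e1.le
      obtain ⟨u1, u2⟩ := abs_lt.1 a5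
      rcases hσ with rfl | rfl
      · have : sin (ϑ (r', α') - M) ≤ 0 := sin_nonpos_of_nonpos_of_neg_pi_le (by linarith) u1.le
        linarith
      · have : 0 ≤ sin (ϑ (r', α') - M) := sin_nonneg_of_nonneg_of_le_pi (by linarith) u2.le
        linarith
    have vz : - (σ * sin M) * A (r, α) + σ * cos M * B (r, α) = 0 := by
      obtain ⟨e1, e2, e3⟩ := hρ r α hr0.le hr1 ha0.le hab.le
      rw [e2, e3, ← hM]; ring
    rcases hr1.eq_or_lt with rfl | hr1
    · -- right edge
      set c := - (σ * sin M)
      set s := σ * cos M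
      set w : ℝ → ℝ := fun t => c * (-dx F (1, t)) + s * (-dx G (1, t)) with hw
      have hd : HasDerivAt w (c * (-dy (dx F) (1, α)) + s * (-dy (dx G) (1, α))) α :=
        ((slice_y hF.mdx 1 α).neg.const_mul c).add ((slice_y hG.mdx 1 α).neg.const_mul s)
      rw [A1, B1] at vz
      have hmax : IsLocalMax w α := by
        have c1 : ContinuousAt (fun t : ℝ => ((1:ℝ), t)) α := by fun_prop
        filter_upwards [c1.eventually nb, Ioo_mem_nhds ha0 hab] with t h1t h2t
        have := sg 1 t zero_le_one le_rfl h2t.1.le h2t.2.le h1t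
        rw [A1, B1] at this
        simp only [hw]
        linarith
      have := hmax.hasDerivAt_eq_zero hd
      exact h1 α c s ha0.le hab.le hcs (by linarith) (by linarith)
    · set c := - (σ * sin M)
      set s := σ * cos M
      set w : ℝ × ℝ → ℝ := fun p => c * F p + s * G p with hw
      have wz : w (r, α) = 0 := by
        simp only [hw]; rw [eA, eB]; linear_combination (r * (1 - r)) * vz
      have hmax : IsLocalMax w (r, α) := by
        have o1 : ∀ᶠ p in 𝓝 ((r, α) : ℝ × ℝ), p ∈ Set.Ioo (0:ℝ) 1 ×ˢ Set.Ioo (0:ℝ) (π / 2) :=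
          (isOpen_Ioo.prod isOpen_Ioo).mem_nhds ⟨⟨hr0, hr1⟩, ⟨ha0, hab⟩⟩
        filter_upwards [nb, o1] with p h1p h2p
        obtain ⟨r', α'⟩ := p
        obtain ⟨⟨b1, b2⟩, ⟨b3, b4⟩⟩ := h2p
        simp only at b1 b2 b3 b4
        have := sg r' α' b1.le b2.le b3.le b4.le h1p
        rw [wz]; simp only [hw]; rw [eA, eB]
        have := mul_nonneg_of_nonpos_of_nonpos this (by nlinarith : -(r' * (1 - r')) ≤ 0)
        simp only
        linarith
      have f0 := hmax.fderiv_eq_zero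
      have fd : ∀ v, c * fderiv ℝ F (r, α) v + s * fderiv ℝ G (r, α) v = 0 := by
        intro v
        have := ((hF.mdf (r, α)).hasFDerivAt.const_mul c).add ((hG.mdf (r, α)).hasFDerivAt.const_mul s)
        have := this.fderiv
        have e : fderiv ℝ w (r, α) v = 0 := by rw [f0]; rfl
        have e2 : fderiv ℝ w (r, α) = _ := this
        rw [e2] at e
        simpa using e
      exact hInt r α c s hr0 hr1 ha0 hab hcs wz (fd _) (fd _)
  -- global bounds
  have hK : IsCompact (Set.Icc (0:ℝ) 1 ×ˢ Set.Icc (0:ℝ) (π / 2)) := isCompact_Icc.prod isCompact_Icc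
  have hKn : (Set.Icc (0:ℝ) 1 ×ˢ Set.Icc (0:ℝ) (π / 2)).Nonempty := ⟨(0, 0), ⟨⟨le_rfl, zero_le_one⟩, ⟨le_rfl, by positivity⟩⟩⟩
  have up : ∀ r α, 0 ≤ r → r ≤ 1 → 0 ≤ α → α ≤ π / 2 → ϑ (r, α) ≤ π / 2 := by
    obtain ⟨⟨r0, α0⟩, hx, hmx⟩ := hK.exists_isMaxOn hKn cϑ.continuousOn
    obtain ⟨⟨b1, b2⟩, ⟨b3, b4⟩⟩ := hx
    simp only at b1 b2 b3 b4
    have hmx' : ∀ r' α', 0 ≤ r' → r' ≤ 1 → 0 ≤ α' → α' ≤ π / 2 → ϑ (r', α') ≤ ϑ (r0, α0) :=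
      fun r' α' a1 a2 a3 a4 => hmx (show (r', α') ∈ _ from ⟨⟨a1, a2⟩, ⟨a3, a4⟩⟩)
    have : ϑ (r0, α0) ≤ π / 2 := by
      rcases b1.eq_or_lt with rfl | b1
      · exact (e0 α0 b3 b4).2
      rcases b3.eq_or_lt with rfl | b3
      · rw [ea r0 b1.le b2]; positivity
      rcases b4.eq_or_lt with rfl | b4
      · rw [eb r0 b1.le b2]
      exact (noext 1 r0 α0 (Or.inl rfl) b1 b2 b3 b4 fun r' α' a1 a2 a3 a4 => by
        have := hmx' r' α' a1 a2 a3 a4; linarith).elim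
    intro r α a1 a2 a3 a4
    exact (hmx' r α a1 a2 a3 a4).trans this
  have lo : ∀ r α, 0 ≤ r → r ≤ 1 → 0 ≤ α → α ≤ π / 2 → 0 ≤ ϑ (r, α) := by
    obtain ⟨⟨r0, α0⟩, hx, hmx⟩ := hK.exists_isMinOn hKn cϑ.continuousOn
    obtain ⟨⟨b1, b2⟩, ⟨b3, b4⟩⟩ := hx
    simp only at b1 b2 b3 b4
    have hmx' : ∀ r' α', 0 ≤ r' → r' ≤ 1 → 0 ≤ α' → α' ≤ π / 2 → ϑ (r0, α0) ≤ ϑ (r', α') :=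
      fun r' α' a1 a2 a3 a4 => hmx (show (r', α') ∈ _ from ⟨⟨a1, a2⟩, ⟨a3, a4⟩⟩)
    have : 0 ≤ ϑ (r0, α0) := by
      rcases b1.eq_or_lt with rfl | b1
      · exact (e0 α0 b3 b4).1
      rcases b3.eq_or_lt with rfl | b3
      · rw [ea r0 b1.le b2]
      rcases b4.eq_or_lt with rfl | b4
      · rw [eb r0 b1.le b2]; positivity
      exact (noext (-1) r0 α0 (Or.inr rfl) b1 b2 b3 b4 fun r' α' a1 a2 a3 a4 => by
        have := hmx' r' α' a1 a2 a3 a4; linarith).elim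
    intro r α a1 a2 a3 a4
    exact this.trans (hmx' r α a1 a2 a3 a4)
  intro r α a1 a2 a3 a4
  obtain ⟨e1, e2, e3⟩ := hρ r α a1.le a2.le a3.le a4.le
  have t1 : ϑ (r, α) ≠ π / 2 := fun hh => noext 1 r α (Or.inl rfl) a1 a2.le a3 a4 fun r' α' b1 b2 b3 b4 => by
    have := up r' α' b1 b2 b3 b4; rw [hh]; linarith
  have t2 : ϑ (r, α) ≠ 0 := fun hh => noext (-1) r α (Or.inr rfl) a1 a2.le a3 a4 fun r' α' b1 b2 b3 b4 => by
    have := lo r' α' b1 b2 b3 b4; rw [hh]; linarith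
  have u1 := lt_of_le_of_ne (up r α a1.le a2.le a3.le a4.le) t1
  have u2 := lt_of_le_of_ne (lo r α a1.le a2.le a3.le a4.le) t2.symm
  have k1 : 0 < cos (ϑ (r, α)) := cos_pos_of_mem_Ioo ⟨by linarith, u1⟩
  have k2 : 0 < sin (ϑ (r, α)) := sin_pos_of_pos_of_lt_pi u2 (by linarith)
  have k3 : 0 < r * (1 - r) := mul_pos a1 (by linarith)
  constructor
  · rw [eA, e2]; exact (mul_pos k3 (mul_pos e1 k1)).ne'
  · rw [eB, e3]; exact (mul_pos k3 (mul_pos e1 k2)).ne'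

theorem rect {F G : ℝ × ℝ → ℝ} (hF : ContDiff ℝ ∞ F) (hG : ContDiff ℝ ∞ G)
    (F0 : ∀ α, F (0, α) = 0) (F1 : ∀ α, F (1, α) = 0) (G0 : ∀ α, G (0, α) = 0) (G1 : ∀ α, G (1, α) = 0)
    (Ga : ∀ r, G (r, 0) = 0) (Fb : ∀ r, F (r, π / 2) = 0) {c1 c3 : ℝ} (p1 : c1 ≠ 0) (p3 : c3 ≠ 0)
    (hc1 : ∀ α, dx F (0, α) = c1 * cos α) (hc3 : ∀ α, dx G (0, α) = c3 * sin α)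
    (hne : ∀ r α, 0 < r → r < 1 → 0 < α → α < π / 2 → F (r, α) = 0 → G (r, α) = 0 → False)
    (hFe : ∀ r, 0 < r → r < 1 → F (r, 0) ≠ 0) (hGe : ∀ r, 0 < r → r < 1 → G (r, π / 2) ≠ 0)
    (hInt : ∀ r α c s, 0 < r → r < 1 → 0 < α → α < π / 2 → (c ≠ 0 ∨ s ≠ 0) →
      c * F (r, α) + s * G (r, α) = 0 → c * dx F (r, α) + s * dx G (r, α) = 0 →
      c * dy F (r, α) + s * dy G (r, α) = 0 → False)
    (h1 : ∀ α c s, 0 ≤ α → α ≤ π / 2 → (c ≠ 0 ∨ s ≠ 0) → c * dx F (1, α) + s * dx G (1, α) = 0 →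
      c * dy (dx F) (1, α) + s * dy (dx G) (1, α) = 0 → False) :
    ∀ r α, 0 < r → r < 1 → 0 < α → α < π / 2 → F (r, α) ≠ 0 ∧ G (r, α) ≠ 0 := by
  have key := rect_pos (F := fun p => c1 * F p) (G := fun p => c3 * G p) (contDiff_const.mul hF) (contDiff_const.mul hG)
    (by simp [F0]) (by simp [F1]) (by simp [G0]) (by simp [G1]) (by simp [Ga]) (by simp [Fb])
    (c1 := c1 ^ 2) (c3 := c3 ^ 2) (by positivity) (by positivity)
    (by intro α; rw [dx_cmul c1 hF]; simp only [hc1]; ring) (by intro α; rw [dx_cmul c3 hG]; simp only [hc3]; ring)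
    (by
      intro r α a1 a2 a3 a4 b1 b2
      exact hne r α a1 a2 a3 a4 ((mul_eq_zero.1 b1).resolve_left p1) ((mul_eq_zero.1 b2).resolve_left p3))
    (fun r a1 a2 => mul_ne_zero p1 (hFe r a1 a2)) (fun r a1 a2 => mul_ne_zero p3 (hGe r a1 a2))
    (by
      intro r α c s a1 a2 a3 a4 hcs b1 b2 b3
      rw [dx_cmul c1 hF, dx_cmul c3 hG] at b2
      rw [dy_cmul c1 hF, dy_cmul c3 hG] at b3
      exact hInt r α (c * c1) (s * c3) a1 a2 a3 a4 (hcs.imp (mul_ne_zero · p1) (mul_ne_zero · p3))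
        (by linarith) (by linarith) (by linarith))
    (by
      intro α c s a1 a2 hcs b2 b3
      rw [dx_cmul c1 hF, dx_cmul c3 hG] at b2 b3
      rw [dy_cmul c1 hF.mdx, dy_cmul c3 hG.mdx] at b3
      exact h1 α (c * c1) (s * c3) a1 a2 (hcs.imp (mul_ne_zero · p1) (mul_ne_zero · p3))
        (by linarith) (by linarith))
  intro r α a1 a2 a3 a4
  exact ⟨(mul_ne_zero_iff.1 (key r α a1 a2 a3 a4).1).2, (mul_ne_zero_iff.1 (key r α a1 a2 a3 a4).2).2⟩
end MF

namespace MF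
open scoped ContDiff Topology
open Filter

/-! ### Nonvanishing of the rotational derivatives in an octant -/

theorem C2crit' {lam : ℝ} {w : E3 → ℝ} (h : ED lam w) (h2 : 2 < lam) (h8 : lam ≤ 8) {n : E3} (hn : ‖n‖ = 1)
    (ho : ∀ x, w (rf n x) = - w x) {x : E3} (hx0 : inner ℝ n x ≠ (0:ℝ))
    (hx1 : inner ℝ n x ^ 2 ≠ ‖x‖ ^ 2) (h0 : w x = 0) (h1 : fderiv ℝ w x = 0) :
    ∀ x : E3, x ≠ 0 → w x = 0 := by
  have hx : x ≠ 0 := by rintro rfl; simp at hx0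
  have hp : 0 < ‖x‖ := norm_pos_iff.2 hx
  have hp' : 0 < ‖x‖⁻¹ := inv_pos.2 hp
  refine C2crit h h2 h8 hn ho (x := ‖x‖⁻¹ • x) ?_ ?_ ?_ ?_ ?_
  · rw [norm_smul, norm_inv, norm_norm, inv_mul_cancel₀ hp.ne']
  · rw [inner_smul_right]; exact mul_ne_zero hp'.ne' hx0
  · rw [inner_smul_right]; intro hh; apply hx1
    field_simp at hh; exact hh
  · rw [h.hom.hom _ hp', h0]
  · ext v; rw [h.hom.fd_smul hp' hx, h1]; simp

section
variable {lam : ℝ} {U : E3 → ℝ}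

theorem crit_axis' (h : Sol lam U) (h2 : 2 < lam) (h8 : lam ≤ 8) {a : ONB} (hs : Sym U a) (hax : ¬ Ax U)
    {p : E3} (hp : p ≠ 0) (hc : fderiv ℝ U p = 0) {i j : Fin 3} (hij : i ≠ j) :
    inner ℝ (a i) p * inner ℝ (a j) p = (0:ℝ) := by
  have hp1 : 0 < ‖p‖ := norm_pos_iff.2 hp
  have hp' : 0 < ‖p‖⁻¹ := inv_pos.2 hp1
  have := crit_axis h h2 h8 hs hax (p := ‖p‖⁻¹ • p) (by rw [norm_smul, norm_inv, norm_norm, inv_mul_cancel₀ hp1.ne'])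
    (by ext v; rw [h.hU.fd_smul hp' hp, hc]; simp) hij
  rw [inner_smul_right, inner_smul_right] at this
  have : ‖p‖⁻¹ * ‖p‖⁻¹ * (inner ℝ (a i) p * inner ℝ (a j) p) = 0 := by rw [← this]; ring
  exact (mul_eq_zero.1 this).resolve_left (mul_pos hp' hp').ne'

theorem rot_lin (n m m' : E3) (c s : ℝ) (x : E3) :
    rot n (c • m + s • m') U x = c * rot n m U x + s * rot n m' U x := by
  unfold rot
  rw [map_add, map_smul, map_smul, inner_add_left, inner_smul_left, inner_smul_left]
  simp; ring

/-- the combination is not identically zero -/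
theorem comb_ne (h : Sol lam U) {a : ONB} (hax : ¬ Ax U) {c s : ℝ} (hcs : c ≠ 0 ∨ s ≠ 0)
    (hz : ∀ x, x ≠ 0 → c * rot (a 1) (a 2) U x + s * rot (a 1) (a 0) U x = 0) : False := by
  have hk : 0 < c ^ 2 + s ^ 2 := by
    rcases hcs with h | h <;> positivity
  set κ := √(c ^ 2 + s ^ 2) with hκ
  have hκ0 : 0 < κ := Real.sqrt_pos.2 hk
  have hκ2 : κ ^ 2 = c ^ 2 + s ^ 2 := Real.sq_sqrt hk.le
  obtain ⟨b, b0, b1, b2⟩ := exists_perm a (i := 2) (j := 0) (k := 1) (by decide) (by decide) (by decide)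
  obtain ⟨d, d0, d1, d2⟩ := exists_rot b (c := c / κ) (s := s / κ) (by field_simp; exact hκ2.symm)
  obtain ⟨e, e0, e1, e2⟩ := exists_perm d (i := 2) (j := 0) (k := 1) (by decide) (by decide) (by decide)
  refine hax (rot_zero_ax h.hU e fun x hx => ?_)
  rw [e0, e1, d0, d2, b0, b1, b2, rot_lin]
  have := hz x hx
  field_simp
  linarith

theorem axis_der (h : Sol lam U) (h2 : 2 < lam) (h8 : lam ≤ 8) {a : ONB} (hs : Sym U a) (hax : ¬ Ax U)
    {i j k : Fin 3} (hij : i ≠ j) (hik : i ≠ k) (hjk : j ≠ k) :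
    fderiv ℝ (rot (a i) (a j) U) (a i) (a j) ≠ 0 ∧ fderiv ℝ (rot (a i) (a j) U) (a i) (a k) = 0 := by
  have hR := h.hU.rot (a i) (a j)
  have hinv := rot_inv h hs hik.symm hjk.symm
  constructor
  · intro hz
    obtain ⟨b, b0, b1, b2⟩ := exists_perm a hjk hij.symm hik.symm
    have key := C1 (ED_rot h h2 (a i) (a j)) h2 h8 b (by rw [b0]; exact rot_odd' h hs hij) (by rw [b0, b2]; exact hz) (by
      rw [b0, b1, b2]
      have := D2_inv hR (a k) hinv (onb_ne a i) (a j) (a k)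
      rw [rf_onb, rf_onb, rf_onb, if_neg hik.symm, if_neg hjk.symm, if_pos rfl, D2_neg_right] at this
      linarith)
    obtain ⟨e, e0, e1, e2⟩ := exists_perm a hij hik hjk
    refine hax (rot_zero_ax h.hU e fun x hx => ?_)
    rw [e0, e1]; exact key x hx
  · have := fd_inv hR (a k) hinv (onb_ne a i) (a k)
    rw [rf_onb, rf_onb, if_neg hik.symm, if_pos rfl] at this
    simp at this; linarith

def XX (a : ONB) (p : ℝ × ℝ) : E3 := (p.1 * sin p.2) • a 0 + (1 - p.1) • a 1 + (p.1 * cos p.2) • a 2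

theorem XX_0 (a : ONB) (p : ℝ × ℝ) : inner ℝ (a 0) (XX a p) = p.1 * sin p.2 := by
  unfold XX; simp [inner_add_right, inner_smul_right, onb_inner]
theorem XX_1 (a : ONB) (p : ℝ × ℝ) : inner ℝ (a 1) (XX a p) = 1 - p.1 := by
  unfold XX; simp [inner_add_right, inner_smul_right, onb_inner]
theorem XX_2 (a : ONB) (p : ℝ × ℝ) : inner ℝ (a 2) (XX a p) = p.1 * cos p.2 := by
  unfold XX; simp [inner_add_right, inner_smul_right, onb_inner]
theorem XX_norm (a : ONB) (p : ℝ × ℝ) : ‖XX a p‖ ^ 2 = p.1 ^ 2 + (1 - p.1) ^ 2 := by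
  rw [onb_normsq a, XX_0, XX_1, XX_2]
  linear_combination p.1 ^ 2 * sin_sq_add_cos_sq p.2
theorem XX_ne (a : ONB) (p : ℝ × ℝ) : XX a p ≠ 0 := by
  intro hh
  have := XX_norm a p
  rw [hh] at this; simp at this
  nlinarith [sq_nonneg (2 * p.1 - 1)]
theorem XX_smooth (a : ONB) : ContDiff ℝ ∞ (XX a) := by
  unfold XX
  exact ((((contDiff_fst.mul (contDiff_sin.comp contDiff_snd)).smul contDiff_const).add
    ((contDiff_const.sub contDiff_fst).smul contDiff_const))).add
    ((contDiff_fst.mul (contDiff_cos.comp contDiff_snd)).smul contDiff_const)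
theorem XX_comp (a : ONB) {F : E3 → ℝ} (hF : Hom0 F) : ContDiff ℝ ∞ (fun p => F (XX a p)) :=
  contDiff_iff_contDiffAt.2 fun p => (hF.atp (XX_ne a p)).comp p (XX_smooth a).contDiffAt

theorem XX_dx (a : ONB) {F : E3 → ℝ} (hF : Hom0 F) (r α : ℝ) :
    dx (fun p => F (XX a p)) (r, α) = fderiv ℝ F (XX a (r, α)) (sin α • a 0 - a 1 + cos α • a 2) := by
  have h1 := slice_x (XX_comp a hF) r α
  have h2 : HasDerivAt (fun t => XX a (t, α)) (sin α • a 0 - a 1 + cos α • a 2) r := by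
    have e1 : HasDerivAt (fun t : ℝ => t * sin α) (1 * sin α) r := (hasDerivAt_id r).mul_const _
    have e2 : HasDerivAt (fun t : ℝ => 1 - t) (-1) r := (hasDerivAt_id r).const_sub 1
    have e3 : HasDerivAt (fun t : ℝ => t * cos α) (1 * cos α) r := (hasDerivAt_id r).mul_const _
    have := ((e1.smul_const (a 0)).add (e2.smul_const (a 1))).add (e3.smul_const (a 2))
    rw [show sin α • a 0 - a 1 + cos α • a 2 = (1 * sin α) • a 0 + (-1:ℝ) • a 1 + (1 * cos α) • a 2 by module]
    exact this
  exact h1.unique ((hF.df (XX_ne a (r, α))).hasFDerivAt.comp_hasDerivAt r h2)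

theorem XX_dα (a : ONB) (r α : ℝ) :
    HasDerivAt (fun t => XX a (r, t)) ((r * cos α) • a 0 - (r * sin α) • a 2) α := by
  have e1 : HasDerivAt (fun t : ℝ => r * sin t) (r * cos α) α := (hasDerivAt_sin α).const_mul r
  have e3 : HasDerivAt (fun t : ℝ => r * cos t) (r * (- sin α)) α := (hasDerivAt_cos α).const_mul r
  have := ((e1.smul_const (a 0)).add (hasDerivAt_const α ((1 - r) • a 1))).add (e3.smul_const (a 2))
  rw [show (r * cos α) • a 0 - (r * sin α) • a 2 = (r * cos α) • a 0 + 0 + (r * (-sin α)) • a 2 by module]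
  exact this

theorem XX_dy (a : ONB) {F : E3 → ℝ} (hF : Hom0 F) (r α : ℝ) :
    dy (fun p => F (XX a p)) (r, α) = fderiv ℝ F (XX a (r, α)) ((r * cos α) • a 0 - (r * sin α) • a 2) := by
  have h1 := slice_y (XX_comp a hF) r α
  exact h1.unique ((hF.df (XX_ne a (r, α))).hasFDerivAt.comp_hasDerivAt α (XX_dα a r α))

theorem XX_dx1 (a : ONB) {F : E3 → ℝ} (hF : Hom0 F) (α : ℝ) :
    dx (fun p => F (XX a p)) (1, α) = - fderiv ℝ F (XX a (1, α)) (a 1) := by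
  rw [XX_dx a hF, show sin α • a 0 - a 1 + cos α • a 2 = XX a (1, α) - a 1 by unfold XX; module, map_sub,
    hF.euler (XX_ne a _)]
  ring

theorem XX_dyx1 (a : ONB) {F : E3 → ℝ} (hF : Hom0 F) (α : ℝ) :
    dy (dx (fun p => F (XX a p))) (1, α) = - D2 F (XX a (1, α)) (cos α • a 0 - sin α • a 2) (a 1) := by
  have h1 := slice_y (XX_comp a hF).mdx 1 α
  simp only [XX_dx1 a hF] at h1
  have hS : Sm F := hF.smooth
  have h2 := (((hS.fd (a 1)).df (XX_ne a (1, α))).hasFDerivAt.comp_hasDerivAt α (XX_dα a 1 α)).neg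
  have := h1.unique h2
  rw [this, D2_apply (hS.c2 (XX_ne a _))]
  simp

set_option maxHeartbeats 1000000 in
theorem oct1 (h : Sol lam U) (h2 : 2 < lam) (h8 : lam ≤ 8) {a : ONB} (hs : Sym U a) (hax : ¬ Ax U) (r α : ℝ)
    (hr0 : 0 < r) (hr1 : r < 1) (ha0 : 0 < α) (hab : α < π / 2) :
    rot (a 1) (a 2) U (XX a (r, α)) ≠ 0 ∧ rot (a 1) (a 0) U (XX a (r, α)) ≠ 0 := by
  have hF := h.hU.rot (a 1) (a 2)
  have hG := h.hU.rot (a 1) (a 0)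
  have z12 : ∀ m, rot (a 1) m U (a 1) = 0 := fun m => by
    unfold rot; rw [hs.crit h 1]; simp
  have X0 : ∀ α, XX a (0, α) = a 1 := fun α => by unfold XX; simp
  have odd1 : ∀ m : Fin 3, m ≠ 1 → ∀ x, inner ℝ (a 1) x = (0:ℝ) → rot (a 1) (a m) U x = 0 := fun m hm x hx => by
    have := rot_odd h hs (i := 1) (j := m) hm.symm x
    rw [rf_perp (onb_norm a 1) hx] at this; linarith
  have odd2 : ∀ m : Fin 3, m ≠ 1 → ∀ x, inner ℝ (a m) x = (0:ℝ) → rot (a 1) (a m) U x = 0 := fun m hm x hx => by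
    have := rot_odd' h hs (i := 1) (j := m) hm.symm x
    rw [rf_perp (onb_norm a m) hx] at this; linarith
  -- common zeros
  have common : ∀ r α, 0 < r → r < 1 → rot (a 1) (a 2) U (XX a (r, α)) = 0 → rot (a 1) (a 0) U (XX a (r, α)) = 0 → False := by
    intro r α hr0 hr1 e1 e2
    set x := XX a (r, α) with hx
    have hx0 : x ≠ 0 := XX_ne a _
    have i0 : inner ℝ (a 0) x = r * sin α := XX_0 a _
    have i1 : inner ℝ (a 1) x = 1 - r := XX_1 a _
    have i2 : inner ℝ (a 2) x = r * cos α := XX_2 a _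
    have eu := h.hU.euler hx0
    have ex := onb_expand a x
    have eu' : inner ℝ (a 0) x * fderiv ℝ U x (a 0) + inner ℝ (a 1) x * fderiv ℝ U x (a 1) + inner ℝ (a 2) x * fderiv ℝ U x (a 2) = 0 := by
      rw [← eu]
      conv_rhs => enter [2]; rw [ex]
      simp only [map_add, map_smul, smul_eq_mul]
    unfold rot at e1 e2
    rw [i0, i1, i2] at eu'
    rw [i1, i2] at e1
    rw [i1, i0] at e2
    have hr : 0 < 1 - r := by linarith
    have u1 : fderiv ℝ U x (a 1) = 0 := by
      have k : (r ^ 2 + (1 - r) ^ 2) * fderiv ℝ U x (a 1) = 0 := by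
        linear_combination (1 - r) * eu' - r * cos α * e1 - r * sin α * e2 - r ^ 2 * fderiv ℝ U x (a 1) * sin_sq_add_cos_sq α
      exact (mul_eq_zero.1 k).resolve_left (by positivity)
    rw [u1] at e1 e2
    have u2 : fderiv ℝ U x (a 2) = 0 := by
      have : (1 - r) * fderiv ℝ U x (a 2) = 0 := by linarith
      exact (mul_eq_zero.1 this).resolve_left hr.ne'
    have u0 : fderiv ℝ U x (a 0) = 0 := by
      have : (1 - r) * fderiv ℝ U x (a 0) = 0 := by linarith
      exact (mul_eq_zero.1 this).resolve_left hr.ne'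
    have hc : fderiv ℝ U x = 0 := clm_zero a (by intro i; fin_cases i <;> assumption)
    have k0 := crit_axis' h h2 h8 hs hax hx0 hc (i := 1) (j := 0) (by decide)
    have k2 := crit_axis' h h2 h8 hs hax hx0 hc (i := 1) (j := 2) (by decide)
    rw [i1, i0] at k0
    rw [i1, i2] at k2
    have s0 : sin α = 0 := by simpa [hr.ne', hr0.ne'] using k0
    have c0 : cos α = 0 := by simpa [hr.ne', hr0.ne'] using k2
    have := sin_sq_add_cos_sq α
    rw [s0, c0] at this; norm_num at this
  have hED : ∀ c s : ℝ, ED lam (fun x => c * rot (a 1) (a 2) U x + s * rot (a 1) (a 0) U x) := fun c s => by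
    have := ED_rot h h2 (a 1) (c • a 2 + s • a 0)
    have e : rot (a 1) (c • a 2 + s • a 0) U = fun x => c * rot (a 1) (a 2) U x + s * rot (a 1) (a 0) U x :=
      funext fun x => rot_lin _ _ _ _ _ _
    rwa [e] at this
  have hodd : ∀ c s : ℝ, ∀ x, (fun x => c * rot (a 1) (a 2) U x + s * rot (a 1) (a 0) U x) (rf (a 1) x)
      = - (fun x => c * rot (a 1) (a 2) U x + s * rot (a 1) (a 0) U x) x := fun c s x => by
    simp only
    rw [rot_odd h hs (by decide), rot_odd h hs (by decide)]; ring
  have hfd : ∀ c s : ℝ, ∀ x, x ≠ 0 → ∀ v, fderiv ℝ (fun x => c * rot (a 1) (a 2) U x + s * rot (a 1) (a 0) U x) x v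
      = c * fderiv ℝ (rot (a 1) (a 2) U) x v + s * fderiv ℝ (rot (a 1) (a 0) U) x v := fun c s x hx v => by
    have : HasFDerivAt (fun x => c * rot (a 1) (a 2) U x + s * rot (a 1) (a 0) U x) _ x :=
      ((hF.df hx).hasFDerivAt.const_mul c).fun_add ((hG.df hx).hasFDerivAt.const_mul s)
    rw [this.fderiv]; simp
  obtain ⟨d1, d1'⟩ := axis_der h h2 h8 hs hax (i := 1) (j := 2) (k := 0) (by decide) (by decide) (by decide)
  obtain ⟨d3, d3'⟩ := axis_der h h2 h8 hs hax (i := 1) (j := 0) (k := 2) (by decide) (by decide) (by decide)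
  refine rect (F := fun p => rot (a 1) (a 2) U (XX a p)) (G := fun p => rot (a 1) (a 0) U (XX a p))
    (XX_comp a hF) (XX_comp a hG) (fun α => by simp only [X0, z12]) (fun α => odd1 2 (by decide) _ (by rw [XX_1]; ring))
    (fun α => by simp only [X0, z12]) (fun α => odd1 0 (by decide) _ (by rw [XX_1]; ring))
    (fun r => odd2 0 (by decide) _ (by rw [XX_0]; simp)) (fun r => odd2 2 (by decide) _ (by rw [XX_2]; simp))
    d1 d3 ?_ ?_ (fun r α b1 b2 _ _ => common r α b1 b2) ?_ ?_ ?_ ?_ r α hr0 hr1 ha0 hab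
  · intro α
    rw [XX_dx a hF, X0]
    simp only [map_add, map_sub, map_smul, smul_eq_mul, d1', hF.euler (onb_ne a 1)]
    ring
  · intro α
    rw [XX_dx a hG, X0]
    simp only [map_add, map_sub, map_smul, smul_eq_mul, d3', hG.euler (onb_ne a 1)]
    ring
  · intro r b1 b2 hz
    exact common r 0 b1 b2 hz (odd2 0 (by decide) _ (by rw [XX_0]; simp))
  · intro r b1 b2 hz
    exact common r (π / 2) b1 b2 (odd2 2 (by decide) _ (by rw [XX_2]; simp)) hz
  · intro r α c s b1 b2 _ _ hcs hw hwx hwy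
    rw [XX_dx a hF, XX_dx a hG] at hwx
    rw [XX_dy a hF, XX_dy a hG] at hwy
    refine comb_ne h hax hcs (C2crit' (hED c s) h2 h8 (onb_norm a 1) (hodd c s) (x := XX a (r, α)) ?_ ?_ hw ?_)
    · rw [XX_1]; simp only; linarith
    · rw [XX_1, XX_norm]; simp only; nlinarith
    · have hx0 := XX_ne a (r, α)
      rw [← hfd c s _ hx0] at hwx hwy
      have eu := (hED c s).hom.euler hx0
      have eX : XX a (r, α) = (r * sin α) • a 0 + (1 - r) • a 1 + (r * cos α) • a 2 := rfl
      set L := fderiv ℝ (fun x => c * rot (a 1) (a 2) U x + s * rot (a 1) (a 0) U x) (XX a (r, α))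
      rw [eX] at eu
      simp only [map_add, map_sub, map_smul, smul_eq_mul] at hwx hwy eu
      have hsc := sin_sq_add_cos_sq α
      have q1 : sin α * L (a 0) + cos α * L (a 2) = 0 := by linear_combination eu + (1 - r) * hwx
      have q2 : cos α * L (a 0) - sin α * L (a 2) = 0 := by
        have : r * (cos α * L (a 0) - sin α * L (a 2)) = 0 := by linear_combination hwy
        exact (mul_eq_zero.1 this).resolve_left b1.ne'
      have l0 : L (a 0) = 0 := by linear_combination sin α * q1 + cos α * q2 - L (a 0) * hsc
      have l2 : L (a 2) = 0 := by linear_combination cos α * q1 - sin α * q2 - L (a 2) * hsc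
      have l1 : L (a 1) = 0 := by rw [l0, l2] at hwx; linarith
      exact clm_zero a (by intro i; fin_cases i <;> assumption)
  · intro α c s _ _ hcs hwx hwy
    rw [XX_dx1 a hF, XX_dx1 a hG] at hwx
    rw [XX_dyx1 a hF, XX_dyx1 a hG] at hwy
    have hx0 := XX_ne a (1, α)
    have hsc := sin_sq_add_cos_sq α
    have e1 : ∀ v : E3, inner ℝ v v = (1:ℝ) → ‖v‖ = 1 := fun v hv => by
      rw [real_inner_self_eq_norm_sq] at hv; nlinarith [norm_nonneg v]
    have hp : ‖XX a (1, α)‖ = 1 := by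
      have := XX_norm a (1, α); simp at this; exact this.resolve_right (by linarith [norm_nonneg (XX a (1, α))])
    obtain ⟨b, b0, b1, b2⟩ := exists_onb3 (n := a 1) (v := cos α • a 0 - sin α • a 2) (p := XX a (1, α)) (onb_norm a 1)
      (e1 _ (by
        simp only [inner_sub_left, inner_sub_right, inner_smul_left, inner_smul_right, onb_inner]
        simp; linear_combination hsc)) hp
      (by simp only [inner_sub_right, inner_smul_right, onb_inner]; simp) (by rw [XX_1]; ring)
      (by rw [inner_sub_left, inner_smul_left, inner_smul_left, XX_0, XX_2]; simp; ring)
    refine comb_ne h hax hcs (C1 (hED c s) h2 h8 b (by rw [b0]; exact hodd c s) ?_ ?_)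
    · rw [b0, b2, hfd c s _ hx0]; linarith
    · rw [b0, b1, b2, D2_symm ((hED c s).hom.c2 hx0), ← D2_apply ((hED c s).hom.c2 hx0)]
      rw [fd_congr (fun z hz => hfd c s z hz (a 1)) hx0]
      have sF : Sm (rot (a 1) (a 2) U) := hF.smooth
      have sG : Sm (rot (a 1) (a 0) U) := hG.smooth
      have := (((sF.fd (a 1)).df hx0).hasFDerivAt.const_mul c).fun_add (((sG.fd (a 1)).df hx0).hasFDerivAt.const_mul s)
      rw [this.fderiv]
      simp only [_root_.add_apply, _root_.smul_apply, smul_eq_mul]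
      rw [D2_apply (hF.c2 hx0), D2_apply (hG.c2 hx0)]
      linarith

theorem oct2 (h : Sol lam U) (h2 : 2 < lam) (h8 : lam ≤ 8) {a : ONB} (hs : Sym U a) (hax : ¬ Ax U) {x : E3}
    (x0 : 0 < inner ℝ (a 0) x) (x1 : 0 < inner ℝ (a 1) x) (x2 : 0 < inner ℝ (a 2) x) :
    rot (a 1) (a 2) U x ≠ 0 ∧ rot (a 1) (a 0) U x ≠ 0 := by
  set y0 := inner ℝ (a 0) x with hy0
  set y1 := inner ℝ (a 1) x with hy1
  set y2 := inner ℝ (a 2) x with hy2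
  have hα : 0 < arctan (y0 / y2) := arctan_pos.2 (div_pos x0 x2)
  have hα2 := arctan_lt_pi_div_two (y0 / y2)
  set α := arctan (y0 / y2) with hαd
  have hc : 0 < cos α := cos_arctan_pos _
  have hsn : sin α * y2 = y0 * cos α := by
    have := tan_mul_cos hc.ne'
    rw [hαd, tan_arctan, ← hαd] at this
    rw [← this]; field_simp
  set k := y2 / cos α with hk
  have hk0 : 0 < k := div_pos x2 hc
  have e0 : k * sin α = y0 := by rw [hk]; field_simp; linarith
  have e2 : k * cos α = y2 := by rw [hk]; field_simp
  have hT : 0 < y1 + k := by linarith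
  have eX : x = (y1 + k) • XX a (k / (y1 + k), α) := by
    unfold XX
    rw [smul_add, smul_add, smul_smul, smul_smul, smul_smul]
    rw [show (y1 + k) * (k / (y1 + k) * sin α) = y0 by field_simp; exact e0,
      show (y1 + k) * (k / (y1 + k) * cos α) = y2 by field_simp; exact e2,
      show (y1 + k) * (1 - k / (y1 + k)) = y1 by field_simp; ring]
    exact onb_expand a x
  rw [eX, (h.hU.rot _ _).hom _ hT, (h.hU.rot _ _).hom _ hT]
  exact oct1 h h2 h8 hs hax _ _ (div_pos hk0 hT) ((div_lt_one hT).2 (by linarith)) hα hα2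

theorem oct (h : Sol lam U) (h2 : 2 < lam) (h8 : lam ≤ 8) {a : ONB} (hs : Sym U a) (hax : ¬ Ax U) {x : E3}
    (x0 : 0 < inner ℝ (a 0) x) (x1 : 0 < inner ℝ (a 1) x) (x2 : 0 < inner ℝ (a 2) x) :
    rot (a 0) (a 1) U x ≠ 0 ∧ rot (a 1) (a 2) U x ≠ 0 ∧ rot (a 2) (a 0) U x ≠ 0 := by
  obtain ⟨k1, k2⟩ := oct2 h h2 h8 hs hax x0 x1 x2
  obtain ⟨b, b0, b1, b2⟩ := exists_perm a (i := 1) (j := 2) (k := 0) (by decide) (by decide) (by decide)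
  obtain ⟨k3, k4⟩ := oct2 h h2 h8 (hs.perm b0 b1 b2) hax (by rwa [b0]) (by rwa [b1]) (by rwa [b2])
  rw [b1, b2] at k3
  refine ⟨?_, k1, k3⟩
  rw [rot_swap (a 1)]; simpa using k2

end
end MF

namespace MF
open scoped ContDiff Topology
open Filter

/-! ### The integral identity and the conclusion for smooth solutions -/

def bmp : ContDiffBump (2:ℝ) := ⟨1 / 2, 1, by norm_num, by norm_num⟩

def chi (x : E3) : ℝ := bmp (‖x‖ ^ 2)

theorem chi_smooth : ContDiff ℝ ∞ chi := bmp.contDiff.comp (contDiff_norm_sq ℝ)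

theorem chi_nonneg (x : E3) : 0 ≤ chi x := bmp.nonneg

theorem chi_small {x : E3} (hx : ‖x‖ ^ 2 < 1) : chi x = 0 := by
  apply bmp.zero_of_le_dist
  rw [Real.dist_eq, abs_of_nonpos (by linarith)]
  show (1:ℝ) ≤ _
  linarith

theorem chi_big {x : E3} (hx : 3 ≤ ‖x‖ ^ 2) : chi x = 0 := by
  apply bmp.zero_of_le_dist
  rw [Real.dist_eq, abs_of_nonneg (by linarith)]
  show (1:ℝ) ≤ _
  linarith

theorem chi_one {x : E3} (hx : ‖x‖ ^ 2 = 2) : chi x = 1 := by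
  unfold chi; rw [hx]
  exact bmp.one_of_mem_closedBall (by simp [bmp])

theorem chi_ev : ∀ᶠ x in 𝓝 (0 : E3), chi x = 0 := by
  have : Continuous fun x : E3 => ‖x‖ ^ 2 := by fun_prop
  have h : ∀ᶠ x in 𝓝 (0 : E3), ‖x‖ ^ 2 < 1 := this.continuousAt.eventually_lt continuousAt_const (by simp)
  filter_upwards [h] with x hx using chi_small hx

theorem chi_fd (x : E3) : ∃ κ : ℝ, ∀ v, fderiv ℝ chi x v = κ * inner ℝ x v := by
  have h1 : HasDerivAt (bmp : ℝ → ℝ) (deriv bmp (‖x‖ ^ 2)) (‖x‖ ^ 2) :=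
    ((bmp.contDiff (n := 1)).differentiable one_ne_zero _).hasDerivAt
  have hn : HasFDerivAt (fun z : E3 => ‖z‖ ^ 2) (2 • innerSL ℝ x) x := (hasStrictFDerivAt_norm_sq x).hasFDerivAt
  have h2 : HasFDerivAt chi _ x := h1.comp_hasFDerivAt x hn
  refine ⟨2 * deriv bmp (‖x‖ ^ 2), fun v => ?_⟩
  rw [h2.fderiv]
  simp; ring

theorem chi_mul_smooth {W : E3 → ℝ} (hW : Sm W) : ContDiff ℝ ∞ (fun x => chi x * W x) := by
  rw [contDiff_iff_contDiffAt]
  intro x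
  by_cases hx : x = 0
  · rw [hx]
    refine (contDiffAt_const (c := (0:ℝ))).congr_of_eventuallyEq ?_
    filter_upwards [chi_ev] with z hz
    rw [hz, zero_mul]
  · exact chi_smooth.contDiffAt.mul (hW.at hx)

theorem chi_mul_supp (W : E3 → ℝ) : HasCompactSupport (fun x => chi x * W x) := by
  apply HasCompactSupport.intro (isCompact_closedBall (0 : E3) 2)
  intro x hx
  have : 2 < ‖x‖ := by simpa using hx
  rw [chi_big (by nlinarith), zero_mul]

theorem integral_fd_zero {V : E3 → ℝ} (hV : ContDiff ℝ ∞ V) (hc : HasCompactSupport V) (v : E3) :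
    ∫ x, fderiv ℝ V x v = 0 ∧ Integrable (fun x => fderiv ℝ V x v) := by
  have c1 : Continuous (fun x => fderiv ℝ V x v) := (hV.continuous_fderiv (by simp)).clm_apply continuous_const
  have s1 : HasCompactSupport (fun x => fderiv ℝ V x v) := hc.fderiv_apply ℝ v
  have i1 := c1.integrable_of_hasCompactSupport (μ := volume) s1
  have i2 := hV.continuous.integrable_of_hasCompactSupport (μ := volume) hc
  have := integral_mul_fderiv_eq_neg_fderiv_mul_of_integrable (μ := (volume : Measure E3)) (f := fun _ : E3 => (1:ℝ)) (g := V) (v := v)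
    (by simp) (by simpa using i1) (by simpa using i2) (fun x _ => differentiableAt_const _)
    (fun x _ => hV.differentiable (by simp) x)
  refine ⟨by simpa using this, i1⟩

theorem green {F G : E3 → ℝ} (hF : Hom0 F) (hG : Hom0 G) :
    ∫ x, chi x * (F x * lap3 G x - G x * lap3 F x) = 0 := by
  have sF : Sm F := hF.smooth
  have sG : Sm G := hG.smooth
  set e := EuclideanSpace.basisFun (Fin 3) ℝ with he
  set W : Fin 3 → E3 → ℝ := fun i x => F x * fderiv ℝ G x (e i) - G x * fderiv ℝ F x (e i) with hW
  have sW : ∀ i, Sm (W i) := fun i => (sF.mul (sG.fd _)).sub (sG.mul (sF.fd _))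
  have key : ∀ x, chi x * (F x * lap3 G x - G x * lap3 F x) = ∑ i, fderiv ℝ (fun x => chi x * W i x) x (e i) := by
    intro x
    by_cases hx : x = 0
    · have : ∀ i, fderiv ℝ (fun x => chi x * W i x) x = 0 := fun i => by
        have : (fun x => chi x * W i x) =ᶠ[𝓝 x] fun _ => (0:ℝ) := by
          rw [hx]; filter_upwards [chi_ev] with z hz
          rw [hz, zero_mul]
        rw [EventuallyEq.fderiv_eq (𝕜 := ℝ) this]; simp
      rw [Finset.sum_eq_zero fun i _ => by rw [this i]; rfl, hx, chi_small (by simp), zero_mul]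
    · obtain ⟨κ, hκ⟩ := chi_fd x
      have hd : ∀ i, fderiv ℝ (fun x => chi x * W i x) x (e i) = chi x * (F x * D2 G x (e i) (e i) - G x * D2 F x (e i) (e i))
          + κ * (F x * (inner ℝ (e i) x * fderiv ℝ G x (e i)) - G x * (inner ℝ (e i) x * fderiv ℝ F x (e i))) := by
        intro i
        rw [fd_mul ((chi_smooth.differentiable (by simp)) x) ((sW i).df hx)]
        simp only [hW]
        rw [fd_sub ((sF.mul (sG.fd _)).df hx) ((sG.mul (sF.fd _)).df hx), fd_mul (sF.df hx) ((sG.fd _).df hx),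
          fd_mul (sG.df hx) ((sF.fd _).df hx), D2_apply (sF.c2 hx), D2_apply (sG.c2 hx), hκ, real_inner_comm]
        ring
      have eu : ∀ {H : E3 → ℝ}, Hom0 H → ∑ i, inner ℝ (e i) x * fderiv ℝ H x (e i) = 0 := fun {H} hH => by
        rw [← hH.euler hx]
        conv_rhs => enter [2]; rw [← e.sum_repr' x]
        rw [map_sum]
        refine Finset.sum_congr rfl fun i _ => ?_
        rw [map_smul, smul_eq_mul]
      rw [Finset.sum_congr rfl fun i _ => hd i, Finset.sum_add_distrib, ← Finset.mul_sum, ← Finset.mul_sum,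
        Finset.sum_sub_distrib, Finset.sum_sub_distrib, ← Finset.mul_sum, ← Finset.mul_sum, ← Finset.mul_sum, ← Finset.mul_sum,
        eu hF, eu hG]
      unfold lap3
      rw [← he]; ring
  rw [integral_congr_ae (Eventually.of_forall key), integral_finsetSum]
  · exact Finset.sum_eq_zero fun i _ => (integral_fd_zero (chi_mul_smooth (sW i)) (chi_mul_supp _) _).1
  · exact fun i _ => (integral_fd_zero (chi_mul_smooth (sW i)) (chi_mul_supp _) _).2

section
variable {lam : ℝ} {U : E3 → ℝ}

theorem triple (h : Sol lam U) (hl : lam ≠ 0) (n1 m1 n2 m2 n3 m3 : E3) :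
    ∫ x, chi x * (Real.exp (U x) * (rot n1 m1 U x * rot n2 m2 U x * rot n3 m3 U x) * (‖x‖ ^ 2)⁻¹) = 0 := by
  have h1 := h.hU.rot n1 m1
  have h3 := h.hU.rot n3 m3
  have hg := green h3 (h1.rot n2 m2)
  have s1 : Sm (rot n1 m1 U) := h1.smooth
  have hGs : Sm (fun x => - (lam * Real.exp (U x) * rot n1 m1 U x)) :=
    ((contDiffOn_const.mul h.hU.smooth.exp).mul s1).neg
  have key : ∀ x, x ≠ 0 → lap3 (rot n2 m2 (rot n1 m1 U)) x
      = - (lam * Real.exp (U x) * (rot n1 m1 U x * rot n2 m2 U x + rot n2 m2 (rot n1 m1 U) x)) / ‖x‖ ^ 2 := by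
    intro x hx
    rw [lap3_rot_div s1 hGs (fun x hx => h.lap_rot n1 m1 hx) n2 m2 hx]
    congr 1
    have : ∀ v, fderiv ℝ (fun x => - (lam * Real.exp (U x) * rot n1 m1 U x)) x v =
        - (lam * Real.exp (U x) * (rot n1 m1 U x * fderiv ℝ U x v + fderiv ℝ (rot n1 m1 U) x v)) := by
      intro v
      have h1 : HasFDerivAt (fun x => - (lam * Real.exp (U x) * rot n1 m1 U x)) _ x :=
        (((h.hU.df hx).hasFDerivAt.exp.const_mul lam).fun_mul (s1.df hx).hasFDerivAt).fun_neg
      rw [h1.fderiv]; simp; ring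
    rw [rot, this, this, rot.eq_1 n2 m2 U, rot.eq_1 n2 m2 (rot n1 m1 U)]; ring
  have e : ∀ x, chi x * (rot n3 m3 U x * lap3 (rot n2 m2 (rot n1 m1 U)) x - rot n2 m2 (rot n1 m1 U) x * lap3 (rot n3 m3 U) x)
      = (-lam) * (chi x * (Real.exp (U x) * (rot n1 m1 U x * rot n2 m2 U x * rot n3 m3 U x) * (‖x‖ ^ 2)⁻¹)) := by
    intro x
    by_cases hx : x = 0
    · rw [hx, chi_small (by simp)]; ring
    · rw [key x hx, h.lap_rot n3 m3 hx]; ring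
  rw [integral_congr_ae (Eventually.of_forall e), integral_const_mul] at hg
  exact (mul_eq_zero.1 hg).resolve_left (neg_ne_zero.2 hl)

theorem inner_rf_onb (a : ONB) (i j : Fin 3) (x : E3) :
    inner ℝ (a j) (rf (a i) x) = if i = j then - (inner ℝ (a j) x : ℝ) else inner ℝ (a j) x := by
  rw [inner_rf, rf_onb]; split_ifs <;> simp

set_option maxHeartbeats 1000000 in
theorem sol_ax (h : Sol lam U) (h2 : 2 < lam) (h8 : lam ≤ 8) : Ax U := by
  by_contra hax
  obtain ⟨a, hs⟩ := exists_sym h h2 h8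
  have ht := triple h (by linarith : lam ≠ 0) (a 1) (a 2) (a 2) (a 0) (a 0) (a 1)
  set P : E3 → ℝ := fun x => rot (a 1) (a 2) U x * rot (a 2) (a 0) U x * rot (a 0) (a 1) U x with hP
  have sP : Sm P := (((h.hU.rot _ _).smooth.mul (h.hU.rot _ _).smooth).mul (h.hU.rot _ _).smooth)
  have inv : ∀ i x, P (rf (a i) x) = P x := by
    intro i x
    simp only [hP]
    fin_cases i
    · show rot (a 1) (a 2) U (rf (a 0) x) * rot (a 2) (a 0) U (rf (a 0) x) * rot (a 0) (a 1) U (rf (a 0) x) = _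
      rw [rot_inv h hs (by decide) (by decide), rot_odd' h hs (by decide), rot_odd h hs (by decide)]; ring
    · show rot (a 1) (a 2) U (rf (a 1) x) * rot (a 2) (a 0) U (rf (a 1) x) * rot (a 0) (a 1) U (rf (a 1) x) = _
      rw [rot_odd h hs (by decide), rot_inv h hs (by decide) (by decide), rot_odd' h hs (by decide)]; ring
    · show rot (a 1) (a 2) U (rf (a 2) x) * rot (a 2) (a 0) U (rf (a 2) x) * rot (a 0) (a 1) U (rf (a 2) x) = _
      rw [rot_odd' h hs (by decide), rot_odd h hs (by decide), rot_inv h hs (by decide) (by decide)]; ring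
  have zer : ∀ i x, inner ℝ (a i) x = (0:ℝ) → P x = 0 := by
    have z : ∀ i j : Fin 3, i ≠ j → ∀ x, inner ℝ (a i) x = (0:ℝ) → rot (a i) (a j) U x = 0 := fun i j hij x hx => by
      have := rot_odd h hs hij x
      rw [rf_perp (onb_norm a i) hx] at this; linarith
    intro i x hx
    simp only [hP]
    fin_cases i
    · rw [z 0 1 (by decide) x hx]; ring
    · rw [z 1 2 (by decide) x hx]; ring
    · rw [z 2 0 (by decide) x hx]; ring
  have nz : ∀ x, 0 < (inner ℝ (a 0) x : ℝ) → 0 < (inner ℝ (a 1) x : ℝ) → 0 < (inner ℝ (a 2) x : ℝ) → P x ≠ 0 := fun x x0 x1 x2 => by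
    obtain ⟨k1, k2, k3⟩ := oct h h2 h8 hs hax x0 x1 x2
    exact mul_ne_zero (mul_ne_zero k2 k3) k1
  set q : E3 := √(2 / 3) • (a 0 + a 1 + a 2) with hq
  have hq0 : 0 < √(2 / 3 : ℝ) := Real.sqrt_pos.2 (by norm_num)
  have q0 : inner ℝ (a 0) q = √(2 / 3 : ℝ) := by rw [hq, inner_smul_right]; simp [inner_add_right, onb_inner]
  have q1 : inner ℝ (a 1) q = √(2 / 3 : ℝ) := by rw [hq, inner_smul_right]; simp [inner_add_right, onb_inner]
  have q2 : inner ℝ (a 2) q = √(2 / 3 : ℝ) := by rw [hq, inner_smul_right]; simp [inner_add_right, onb_inner]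
  have qn : ‖q‖ ^ 2 = 2 := by
    rw [onb_normsq a, q0, q1, q2, Real.sq_sqrt (by norm_num)]; norm_num
  have Pq := nz q (by rwa [q0]) (by rwa [q1]) (by rwa [q2])
  have pos3 : ∀ x, 0 < (inner ℝ (a 0) x : ℝ) → 0 < (inner ℝ (a 1) x : ℝ) → 0 < (inner ℝ (a 2) x : ℝ) → 0 ≤ P q * P x := by
    intro y y0 y1 y2
    by_contra! hneg
    -- segment from q to y
    set f : ℝ → E3 := fun t => (1 - t) • q + t • y with hf
    have fi : ∀ i : Fin 3, 0 < (inner ℝ (a i) q : ℝ) → 0 < (inner ℝ (a i) y : ℝ) → ∀ t ∈ Set.Icc (0:ℝ) 1, 0 < (inner ℝ (a i) (f t) : ℝ) := by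
      intro i k1 k2 t ⟨t0, t1⟩
      simp only [hf, inner_add_right, inner_smul_right]
      rcases t0.eq_or_lt with rfl | t0
      · simpa using k1
      · have : 0 < t * inner ℝ (a i) y := mul_pos t0 k2
        have : 0 ≤ (1 - t) * inner ℝ (a i) q := mul_nonneg (by linarith) k1.le
        linarith
    have f0 := fi 0 (by rwa [q0]) y0
    have f1 := fi 1 (by rwa [q1]) y1
    have f2 := fi 2 (by rwa [q2]) y2
    have hc : ContinuousOn (fun t => P q * P (f t)) (Set.Icc (0:ℝ) 1) := by
      refine continuousOn_const.mul (sP.continuousOn.comp (by fun_prop) fun t ht => ?_)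
      intro h0
      have h0' : f t = 0 := h0
      have := f0 t ht
      rw [h0'] at this; simp at this
    have := intermediate_value_Icc' zero_le_one hc
    obtain ⟨t, ht, hz⟩ := this (show (0:ℝ) ∈ Set.Icc _ _ from ⟨by simpa [hf] using hneg.le, by simpa [hf] using mul_self_nonneg (P q)⟩)
    exact mul_ne_zero Pq (nz _ (f0 t ht) (f1 t ht) (f2 t ht)) hz
  have pos2 : ∀ x, 0 < (inner ℝ (a 0) x : ℝ) → 0 < (inner ℝ (a 1) x : ℝ) → 0 ≤ P q * P x := by
    intro x x0 x1
    rcases lt_trichotomy (inner ℝ (a 2) x : ℝ) 0 with hh | hh | hh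
    · rw [← inv 2 x]
      apply pos3 <;> rw [inner_rf_onb] <;> simpa
    · rw [zer 2 x hh]; simp
    · exact pos3 x x0 x1 hh
  have pos1 : ∀ x, 0 < (inner ℝ (a 0) x : ℝ) → 0 ≤ P q * P x := by
    intro x x0
    rcases lt_trichotomy (inner ℝ (a 1) x : ℝ) 0 with hh | hh | hh
    · rw [← inv 1 x]
      apply pos2 <;> rw [inner_rf_onb] <;> simpa
    · rw [zer 1 x hh]; simp
    · exact pos2 x x0 hh
  have pos : ∀ x, 0 ≤ P q * P x := by
    intro x
    rcases lt_trichotomy (inner ℝ (a 0) x : ℝ) 0 with hh | hh | hh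
    · rw [← inv 0 x]
      apply pos1; rw [inner_rf_onb]; simpa
    · rw [zer 0 x hh]; simp
    · exact pos1 x hh
  have sI : Sm (fun x => P q * (Real.exp (U x) * P x * (‖x‖ ^ 2)⁻¹)) := by
    refine contDiffOn_const.mul ((h.hU.smooth.exp.mul sP).mul ?_)
    exact ContDiffOn.inv (contDiff_norm_sq ℝ).contDiffOn (fun x hx => by simpa using hx)
  have hpos := Continuous.integral_pos_of_hasCompactSupport_nonneg_nonzero (μ := (volume : Measure E3)) (x := q)
    (chi_mul_smooth sI).continuous (chi_mul_supp _)
    (fun x => by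
      have := mul_nonneg (chi_nonneg x) (mul_nonneg (pos x) (mul_nonneg (Real.exp_pos (U x)).le (inv_nonneg.2 (sq_nonneg ‖x‖))))
      show 0 ≤ _
      rw [show chi x * (P q * (Real.exp (U x) * P x * (‖x‖ ^ 2)⁻¹)) = chi x * (P q * P x * (Real.exp (U x) * (‖x‖ ^ 2)⁻¹)) by ring]
      exact this)
    (by
      rw [chi_one qn, qn]
      exact mul_ne_zero one_ne_zero (mul_ne_zero Pq (mul_ne_zero (mul_ne_zero (Real.exp_pos _).ne' Pq) (by norm_num))))
  have e : ∀ x, chi x * (P q * (Real.exp (U x) * P x * (‖x‖ ^ 2)⁻¹)) = P q * (chi x * (Real.exp (U x) * P x * (‖x‖ ^ 2)⁻¹)) :=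
    fun x => by ring
  rw [integral_congr_ae (Eventually.of_forall e), integral_const_mul] at hpos
  rw [ht] at hpos
  simp at hpos

end
end MF

namespace MF
open scoped ContDiff Topology
open Filter

/-! ### Part P: the Cauchy transform and regularity -/

/-- the unit vector at angle `θ` -/
def eth (θ : ℝ) : ℂ := (Real.cos θ : ℂ) + (Real.sin θ : ℂ) * Complex.I

theorem eth_cont : Continuous eth := by
  unfold eth
  fun_prop

theorem eth_deriv (θ : ℝ) : HasDerivAt eth (Complex.I * eth θ) θ := by
  have h1 : HasDerivAt (fun t : ℝ => ((Real.cos t : ℝ) : ℂ)) ((-Real.sin θ : ℝ) : ℂ) θ :=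
    (Real.hasDerivAt_cos θ).ofReal_comp
  have h2 : HasDerivAt (fun t : ℝ => ((Real.sin t : ℝ) : ℂ)) ((Real.cos θ : ℝ) : ℂ) θ :=
    (Real.hasDerivAt_sin θ).ofReal_comp
  have h3 : HasDerivAt eth _ θ := h1.add (h2.mul_const Complex.I)
  rw [show Complex.I * eth θ = ((-Real.sin θ : ℝ) : ℂ) + ((Real.cos θ : ℝ) : ℂ) * Complex.I by
    unfold eth
    have := Complex.I_sq
    push_cast
    linear_combination (Complex.sin θ) * this]
  exact h3

theorem eth_ne (θ : ℝ) : eth θ ≠ 0 := by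
  intro h
  have h1 := congrArg Complex.re h
  have h2 := congrArg Complex.im h
  simp [eth, -Complex.ofReal_cos, -Complex.ofReal_sin] at h1 h2
  have := Real.sin_sq_add_cos_sq θ
  rw [h1, h2] at this
  norm_num at this

theorem eth_norm (θ : ℝ) : ‖eth θ‖ = 1 := by
  unfold eth
  simp [Complex.norm_cos_add_sin_mul_I]

theorem clm_re_im (L : ℂ →L[ℝ] ℂ) (a : ℂ) : L a = (a.re : ℂ) * L 1 + (a.im : ℂ) * L Complex.I := by
  have : a = a.re • (1:ℂ) + a.im • Complex.I := by
    simp [Complex.re_add_im]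
  conv_lhs => rw [this]
  rw [map_add, map_smul, map_smul, Complex.real_smul, Complex.real_smul]

theorem polar_integrand (L : ℂ →L[ℝ] ℂ) {r : ℝ} (hr : 0 < r) (θ : ℝ) :
    r • ((r * eth θ)⁻¹ * (L 1 + Complex.I * L Complex.I))
      = L (eth θ) + Complex.I * L (Complex.I * eth θ) := by
  rw [clm_re_im L (eth θ), clm_re_im L (Complex.I * eth θ)]
  have h1 := eth_ne θ
  have hr' : (r : ℂ) ≠ 0 := by exact_mod_cast hr.ne'
  rw [Complex.real_smul]
  have e1 : (eth θ).re = Real.cos θ := by simp [eth, -Complex.ofReal_cos, -Complex.ofReal_sin]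
  have e2 : (eth θ).im = Real.sin θ := by simp [eth, -Complex.ofReal_cos, -Complex.ofReal_sin]
  have e3 : (Complex.I * eth θ).re = - Real.sin θ := by simp [e2]
  have e4 : (Complex.I * eth θ).im = Real.cos θ := by simp [e1]
  rw [e1, e2, e3, e4]
  field_simp
  have hcs : ((Real.sin θ : ℂ)) ^ 2 + (Real.cos θ : ℂ) ^ 2 = 1 := by
    exact_mod_cast Real.sin_sq_add_cos_sq θ
  have hI := Complex.I_sq
  unfold eth
  set c := (Real.cos θ : ℂ)
  set s := (Real.sin θ : ℂ)
  have : ((-Real.sin θ : ℝ) : ℂ) = -s := by simp [s]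
  rw [this]
  linear_combination (-(L 1 + Complex.I * L Complex.I)) * hcs + (s ^ 2 * (L 1) - s*c*(L Complex.I) ) * hI

theorem cauchy_core {k : ℂ → ℂ} (hk : ContDiff ℝ 1 k) (hc : HasCompactSupport k) :
    ∫ t, t⁻¹ * (fderiv ℝ k t 1 + Complex.I * fderiv ℝ k t Complex.I) = -(2 * π) * k 0 := by
  have hkd : Continuous (fderiv ℝ k) := hk.continuous_fderiv (by simp)
  have hkdiff : Differentiable ℝ k := hk.differentiable (by simp)
  obtain ⟨R0, hR0⟩ := hc.isCompact.isBounded.subset_closedBall 0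
  set R : ℝ := max R0 0 + 1 with hR
  have hRpos : 0 < R := by positivity
  have hout : ∀ z : ℂ, R ≤ ‖z‖ → k z = 0 ∧ fderiv ℝ k z = 0 := by
    intro z hz
    have hz1 : z ∉ tsupport k := by
      intro h
      have := hR0 h
      simp at this
      have := le_max_left R0 0
      linarith
    exact ⟨image_eq_zero_of_notMem_tsupport hz1, by
      by_contra h
      exact hz1 (support_fderiv_subset ℝ (Function.mem_support.2 h))⟩
  set A : ℝ × ℝ → ℂ := fun p => fderiv ℝ k (p.1 * eth p.2) (eth p.2) with hA
  set B : ℝ × ℝ → ℂ := fun p => fderiv ℝ k (p.1 * eth p.2) (Complex.I * eth p.2) with hB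
  have hAc : Continuous A := by
    have := eth_cont
    exact (hkd.comp (by fun_prop)).clm_apply (by fun_prop)
  have hBc : Continuous B := by
    have := eth_cont
    exact (hkd.comp (by fun_prop)).clm_apply (by fun_prop)
  rw [← Complex.integral_comp_polarCoord_symm]
  have hT : polarCoord.target = Set.Ioi (0:ℝ) ×ˢ Set.Ioo (-π) π := rfl
  rw [hT]
  have hm : MeasurableSet (Set.Ioi (0:ℝ) ×ˢ Set.Ioo (-π) π) :=
    measurableSet_Ioi.prod measurableSet_Ioo
  have s1 : ∫ p in Set.Ioi (0:ℝ) ×ˢ Set.Ioo (-π) π, p.1 • ((Complex.polarCoord.symm p)⁻¹ *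
      (fderiv ℝ k (Complex.polarCoord.symm p) 1
        + Complex.I * fderiv ℝ k (Complex.polarCoord.symm p) Complex.I))
      = ∫ p in Set.Ioi (0:ℝ) ×ˢ Set.Ioo (-π) π, (A p + Complex.I * B p) := by
    apply setIntegral_congr_fun hm
    rintro ⟨r, θ⟩ ⟨hr, _⟩
    have := polar_integrand (fderiv ℝ k (r * eth θ)) hr θ
    simp only [Complex.polarCoord_symm_apply]
    exact this
  rw [s1]
  have s2 : ∫ p in Set.Ioi (0:ℝ) ×ˢ Set.Ioo (-π) π, (A p + Complex.I * B p)
      = ∫ p in Set.Ioc (0:ℝ) R ×ˢ Set.Ioc (-π) π, (A p + Complex.I * B p) := by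
    have : ∫ p in Set.Ioi (0:ℝ) ×ˢ Set.Ioo (-π) π, (A p + Complex.I * B p)
      = ∫ p in Set.Ioc (0:ℝ) R ×ˢ Set.Ioo (-π) π, (A p + Complex.I * B p) := by
      apply setIntegral_eq_of_subset_of_forall_diff_eq_zero hm
      · exact Set.prod_mono Set.Ioc_subset_Ioi_self le_rfl
      · rintro ⟨r, θ⟩ ⟨⟨hr, hθ⟩, hn⟩
        have hr' : 0 < r := hr
        have hRr : R ≤ r := by
          by_contra h
          exact hn ⟨⟨hr, (not_le.1 h).le⟩, hθ⟩
        have : fderiv ℝ k (r * eth θ) = 0 := (hout _ (by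
          rw [norm_mul, eth_norm]; simpa [abs_of_pos hr'] using hRr)).2
        simp [hA, hB, this]
    rw [this]
    apply setIntegral_congr_set
    exact Measure.set_prod_ae_eq ae_eq_rfl Ioo_ae_eq_Ioc
  rw [s2]
  have hsub : Set.Ioc (0:ℝ) R ×ˢ Set.Ioc (-π) π ⊆ Set.Icc (0:ℝ) R ×ˢ Set.Icc (-π) π :=
    Set.prod_mono Set.Ioc_subset_Icc_self Set.Ioc_subset_Icc_self
  have hAi : IntegrableOn A (Set.Ioc (0:ℝ) R ×ˢ Set.Ioc (-π) π) :=
    (hAc.continuousOn.integrableOn_compact (isCompact_Icc.prod isCompact_Icc)).mono_set hsub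
  have hBi : IntegrableOn B (Set.Ioc (0:ℝ) R ×ˢ Set.Ioc (-π) π) :=
    (hBc.continuousOn.integrableOn_compact (isCompact_Icc.prod isCompact_Icc)).mono_set hsub
  rw [integral_add hAi (hBi.const_mul _), integral_const_mul]
  have hBz : ∫ p in Set.Ioc (0:ℝ) R ×ˢ Set.Ioc (-π) π, B p = 0 := by
    rw [Measure.volume_eq_prod, setIntegral_prod B (by rwa [← Measure.volume_eq_prod])]
    rw [show (0:ℂ) = ∫ x in Set.Ioc (0:ℝ) R, (0:ℂ) by simp]
    apply setIntegral_congr_fun measurableSet_Ioc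
    intro r hr
    have hr' : 0 < r := hr.1
    simp only
    rw [← intervalIntegral.integral_of_le (by linarith [Real.pi_pos])]
    have hd : ∀ θ ∈ Set.uIcc (-π) π, HasDerivAt (fun θ : ℝ => k (r * eth θ)) (r * B (r, θ)) θ := by
      intro θ _
      have h1 : HasDerivAt (fun θ : ℝ => (r : ℂ) * eth θ) (r * (Complex.I * eth θ)) θ :=
        (eth_deriv θ).const_mul _
      have h2 := ((hkdiff (r * eth θ)).hasFDerivAt).comp_hasDerivAt θ h1
      have h3 : fderiv ℝ k (r * eth θ) (r * (Complex.I * eth θ)) = r * B (r, θ) := by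
        have e : (r : ℂ) * (Complex.I * eth θ) = r • (Complex.I * eth θ) :=
          (Complex.real_smul).symm
        rw [e, map_smul, Complex.real_smul]
      rw [h3] at h2
      exact h2
    have h4 := intervalIntegral.integral_eq_sub_of_hasDerivAt hd
      (Continuous.intervalIntegrable (by fun_prop) _ _)
    rw [intervalIntegral.integral_const_mul] at h4
    have h5 : eth π = eth (-π) := by simp [eth]
    rw [h5, sub_self] at h4
    rcases mul_eq_zero.1 h4 with h | h
    · exact absurd h (by exact_mod_cast hr'.ne')
    · exact h
  have hAz : ∫ p in Set.Ioc (0:ℝ) R ×ˢ Set.Ioc (-π) π, A p = -(2 * π) * k 0 := by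
    rw [Measure.volume_eq_prod, ← setIntegral_prod_swap]
    rw [setIntegral_prod (fun z : ℝ × ℝ => A z.swap) (by
      have : Continuous fun z : ℝ × ℝ => A z.swap := hAc.comp continuous_swap
      rw [← Measure.volume_eq_prod]
      exact (this.continuousOn.integrableOn_compact
        (isCompact_Icc.prod isCompact_Icc)).mono_set
          (Set.prod_mono Set.Ioc_subset_Icc_self Set.Ioc_subset_Icc_self))]
    have : ∀ θ : ℝ, ∫ r in Set.Ioc (0:ℝ) R, A (θ, r).swap = - k 0 := by
      intro θ
      rw [← intervalIntegral.integral_of_le hRpos.le]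
      have hd : ∀ r ∈ Set.uIcc 0 R, HasDerivAt (fun r : ℝ => k (r * eth θ)) (A (r, θ)) r := by
        intro r _
        have h1 : HasDerivAt (fun r : ℝ => (r : ℂ) * eth θ) (1 * eth θ) r :=
          (hasDerivAt_id r).ofReal_comp.mul_const _
        rw [one_mul] at h1
        exact ((hkdiff (r * eth θ)).hasFDerivAt).comp_hasDerivAt r h1
      have h4 := intervalIntegral.integral_eq_sub_of_hasDerivAt hd
        (Continuous.intervalIntegrable (by fun_prop) _ _)
      have h6 : k (R * eth θ) = 0 := (hout _ (by
          rw [norm_mul, eth_norm]; simp [abs_of_pos hRpos])).1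
      rw [h6] at h4
      simpa using h4
    simp only [this]
    rw [integral_const]
    simp [show (0:ℝ) ≤ π + π by linarith [Real.pi_pos]]
    left; ring
  rw [hBz, hAz]; ring

end MF

namespace MF
open scoped ContDiff Topology
open Filter

theorem inv_locInt : LocallyIntegrable (fun z : ℂ => z⁻¹) := by
  have hb : ∀ r : ℝ, IntegrableOn (fun z : ℂ => z⁻¹) (Metric.ball 0 r) := by
    intro r
    have h1 : IntegrableOn (fun x : ℂ => (fun y : ℝ => y⁻¹) ‖x‖) (Metric.ball (0 : ℂ) r) := by
      rw [integrableOn_fun_norm_addHaar]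
      have : IntegrableOn (fun _ : ℝ => (1:ℝ)) (Set.Ioo 0 r) := by
        simp
      refine this.congr_fun ?_ measurableSet_Ioo
      intro y hy
      have : y ≠ 0 := hy.1.ne'
      simp [Complex.finrank_real_complex, this]
    refine Integrable.mono h1 ?_ ?_
    · exact (measurable_inv.aestronglyMeasurable)
    · refine Filter.Eventually.of_forall fun z => ?_
      simp
  intro x
  refine ⟨Metric.ball 0 (‖x‖ + 1), Metric.isOpen_ball.mem_nhds ?_, hb _⟩
  simp

open scoped Convolution in
theorem dbar_solve {f : ℂ → ℂ} {n : ℕ} (hn : 1 ≤ n) (hf : ContDiff ℝ n f)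
    (hc : HasCompactSupport f) :
    ∃ v : ℂ → ℂ, ContDiff ℝ n v ∧
      ∀ z, fderiv ℝ v z 1 + Complex.I * fderiv ℝ v z Complex.I = f z := by
  set L := ContinuousLinearMap.mul ℝ ℂ with hL
  have hf1 : ContDiff ℝ 1 f := hf.of_le (by exact_mod_cast hn)
  set w : ℂ → ℂ := (fun z : ℂ => z⁻¹) ⋆[L, volume] f with hw
  have hwc : ContDiff ℝ n w := by
    have := hc.contDiff_convolution_right (n := (n : ℕ∞)) L inv_locInt (by exact_mod_cast hf)
    exact_mod_cast this
  have hfd : Continuous (fderiv ℝ f) := hf1.continuous_fderiv (by simp)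
  have hap : ∀ z v, fderiv ℝ w z v = ∫ t, t⁻¹ * fderiv ℝ f (z - t) v := by
    intro z v
    rw [(hc.hasFDerivAt_convolution_right L inv_locInt hf1 z).fderiv]
    rw [convolution_precompR_apply L inv_locInt (hc.fderiv ℝ) hfd z v]
    rfl
  have hInt : ∀ z v, Integrable (fun t : ℂ => t⁻¹ * fderiv ℝ f (z - t) v) := by
    intro z v
    have h1 : HasCompactSupport (fun t => fderiv ℝ f t v) := hc.fderiv_apply ℝ v
    exact h1.convolutionExists_right L inv_locInt (by fun_prop) z
  refine ⟨fun z => (2 * π : ℂ)⁻¹ * w z, contDiff_const.mul hwc, ?_⟩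
  intro z
  have hwd : DifferentiableAt ℝ w z := hwc.differentiable (by exact_mod_cast (by omega)) z
  have h2 : HasFDerivAt (fun z => (2 * π : ℂ)⁻¹ * w z) _ z := hwd.hasFDerivAt.const_mul _
  rw [h2.fderiv]
  simp only [_root_.smul_apply, smul_eq_mul]
  have hcore := cauchy_core (k := fun t => f (z - t)) (hf1.comp (by fun_prop))
    (hc.comp_homeomorph (Homeomorph.subLeft z))
  have hfk : ∀ t v, fderiv ℝ (fun t => f (z - t)) t v = - fderiv ℝ f (z - t) v := by
    intro t v
    have h3 : HasFDerivAt (fun t : ℂ => z - t) (-ContinuousLinearMap.id ℝ ℂ) t :=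
      (hasFDerivAt_id t).const_sub z
    have h4 : HasFDerivAt (fun t => f (z - t)) _ t :=
      ((hf1.differentiable (by simp)) (z - t)).hasFDerivAt.comp t h3
    rw [h4.fderiv]
    simp
  simp only [hfk, sub_zero] at hcore
  have h5 : ∫ t : ℂ, t⁻¹ * (-fderiv ℝ f (z - t) 1 + Complex.I * -fderiv ℝ f (z - t) Complex.I)
      = - (fderiv ℝ w z 1 + Complex.I * fderiv ℝ w z Complex.I) := by
    rw [hap, hap, ← integral_const_mul, ← integral_add (hInt z 1) ((hInt z _).const_mul _),
      ← integral_neg]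
    congr 1; funext t; ring
  rw [h5] at hcore
  have hpi : (π : ℂ) ≠ 0 := by exact_mod_cast Real.pi_ne_zero
  have h6 : fderiv ℝ w z 1 + Complex.I * fderiv ℝ w z Complex.I = 2 * π * f z := by
    linear_combination -hcore
  field_simp
  linear_combination h6

/-- Regularity step for the Laplacian on ℂ. -/
theorem reg_step {W g : ℂ → ℝ} {n : ℕ} (hn : 2 ≤ n) (hW : ContDiff ℝ n W) (hg : ContDiff ℝ n g)
    (he : ∀ z, D2 W z 1 1 + D2 W z Complex.I Complex.I = g z) : ContDiff ℝ (n + 1 : ℕ) W := by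
  have hW2 : ContDiff ℝ 2 W := hW.of_le (by exact_mod_cast hn)
  have hWd : ContDiff ℝ 1 (fderiv ℝ W) := hW2.fderiv_right (by norm_num)
  set h : ℂ → ℂ := fun z => ((fderiv ℝ W z 1 : ℝ) : ℂ) - Complex.I * ((fderiv ℝ W z Complex.I : ℝ) : ℂ) with hh
  have hx1 : ∀ v, ContDiff ℝ 1 (fun z => fderiv ℝ W z v) := fun v => hWd.clm_apply contDiff_const
  have hhf : ∀ z v, fderiv ℝ h z v = ((D2 W z v 1 : ℝ) : ℂ) - Complex.I * ((D2 W z v Complex.I : ℝ) : ℂ) := by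
    intro z v
    have a1 : ∀ u : ℂ, HasFDerivAt (fun z => ((fderiv ℝ W z u : ℝ) : ℂ))
        (Complex.ofRealCLM.comp (fderiv ℝ (fun z => fderiv ℝ W z u) z)) z := by
      intro u
      exact Complex.ofRealCLM.hasFDerivAt.comp z
        (((hx1 u).differentiable (by simp)) z).hasFDerivAt
    have a2 : HasFDerivAt h _ z := (a1 1).fun_sub ((a1 Complex.I).const_mul Complex.I)
    rw [a2.fderiv]
    simp only [_root_.sub_apply, _root_.smul_apply, ContinuousLinearMap.comp_apply,
      Complex.ofRealCLM_apply, smul_eq_mul]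
    rw [D2_apply (hW2.contDiffAt), D2_apply (hW2.contDiffAt)]
  have hhd : ContDiff ℝ 1 h := by
    have := Complex.ofRealCLM.contDiff (n := 1) (𝕜 := ℝ)
    exact (this.comp (hx1 1)).sub (contDiff_const.mul (this.comp (hx1 Complex.I)))
  have key : ContDiff ℝ n h := by
    rw [contDiff_iff_contDiffAt]
    intro z0
    let χ : ContDiffBump z0 := ⟨1, 2, by norm_num, by norm_num⟩
    set f : ℂ → ℂ := fun z => ((χ z * g z : ℝ) : ℂ) with hfdef
    have hf : ContDiff ℝ n f := by
      have := Complex.ofRealCLM.contDiff (n := n) (𝕜 := ℝ)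
      exact this.comp (χ.contDiff.mul hg)
    have hfc : HasCompactSupport f := by
      have : HasCompactSupport (fun z => χ z * g z) := χ.hasCompactSupport.mul_right
      exact this.comp_left (g := ((↑) : ℝ → ℂ)) Complex.ofReal_zero
    obtain ⟨v, hv, hve⟩ := dbar_solve (by omega) hf hfc
    have hvd : Differentiable ℝ v := hv.differentiable (by exact_mod_cast (by omega))
    have hhd' : Differentiable ℝ h := hhd.differentiable (by simp)
    have hdiff : DifferentiableOn ℂ (fun z => h z - v z) (Metric.ball z0 1) := by
      intro z hz
      apply DifferentiableAt.differentiableWithinAt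
      rw [differentiableAt_complex_iff_differentiableAt_real]
      refine ⟨(hhd' z).fun_sub (hvd z), ?_⟩
      rw [fderiv_fun_sub (hhd' z) (hvd z)]
      simp only [_root_.sub_apply, hhf, smul_eq_mul]
      have h1 : χ z = 1 := χ.one_of_mem_closedBall (Metric.ball_subset_closedBall hz)
      have h2 := hve z
      have h3 : f z = ((D2 W z 1 1 : ℝ) : ℂ) + ((D2 W z Complex.I Complex.I : ℝ) : ℂ) := by
        simp only [hfdef, h1, one_mul, ← he z]; push_cast; rfl
      rw [h3] at h2
      have h4 : D2 W z Complex.I 1 = D2 W z 1 Complex.I := D2_symm hW2.contDiffAt _ _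
      rw [h4]
      have hI := Complex.I_sq
      linear_combination (Complex.I) * h2 + (-(fderiv ℝ v z Complex.I) + ((D2 W z 1 Complex.I : ℝ) : ℂ)) * hI
    have han : ContDiffAt ℝ n (fun z => h z - v z) z0 := by
      have h5 := hdiff.analyticAt (Metric.isOpen_ball.mem_nhds (Metric.mem_ball_self one_pos))
      exact (h5.contDiffAt (n := n)).restrict_scalars ℝ
    have := han.add hv.contDiffAt
    refine this.congr_of_eventuallyEq (Filter.Eventually.of_forall fun z => ?_)
    simp
  have k1 : ContDiff ℝ n (fun z => fderiv ℝ W z 1) := by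
    have : (fun z => fderiv ℝ W z 1) = fun z => Complex.reCLM (h z) := by
      funext z; simp [hh]
    rw [this]; exact Complex.reCLM.contDiff.comp key
  have k2 : ContDiff ℝ n (fun z => fderiv ℝ W z Complex.I) := by
    have : (fun z => fderiv ℝ W z Complex.I) = fun z => - Complex.imCLM (h z) := by
      funext z; simp [hh]
    rw [this]; exact (Complex.imCLM.contDiff.comp key).neg
  have : ContDiff ℝ ((n : WithTop ℕ∞) + 1) W := by
    rw [contDiff_succ_iff_fderiv_apply]
    refine ⟨hW2.differentiable (by simp), fun h => absurd h (by simp), ?_⟩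
    intro y
    have e : (fun x => fderiv ℝ W x y)
        = fun x => y.re * fderiv ℝ W x 1 + y.im * fderiv ℝ W x Complex.I := by
      funext x
      have : y = y.re • (1:ℂ) + y.im • Complex.I := by simp [Complex.re_add_im]
      conv_lhs => rw [this]
      rw [map_add, map_smul, map_smul, smul_eq_mul, smul_eq_mul]
    rw [e]
    exact (contDiff_const.mul k1).add (contDiff_const.mul k2)
  exact_mod_cast this

end MF

namespace MF
open scoped ContDiff Topology
open Filter

theorem reg_smooth {w : ℝ × ℝ → ℝ} {lam : ℝ} (hw : ContDiff ℝ 2 w)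
    (he : ∀ y, D2 w y (1, 0) (1, 0) + D2 w y (0, 1) (0, 1)
      = 4 * lam * (1 - Real.exp (w y)) / NN y ^ 2) : ContDiff ℝ ∞ w := by
  set L : ℂ →L[ℝ] ℝ × ℝ := (Complex.equivRealProdCLM : ℂ →L[ℝ] ℝ × ℝ) with hL
  set W : ℂ → ℝ := fun z => w (L z) with hWdef
  have hW2 : ContDiff ℝ 2 W := hw.comp L.contDiff
  have hWe : ∀ z, D2 W z 1 1 + D2 W z Complex.I Complex.I
      = 4 * lam * (1 - Real.exp (W z)) / NN (L z) ^ 2 := by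
    intro z
    simp only [hWdef]
    rw [D2_clm L hw.contDiffAt, D2_clm L hw.contDiffAt, ← he (L z)]
    have e1 : L 1 = (1, 0) := by simp [hL]
    have e2 : L Complex.I = (0, 1) := by simp [hL]
    rw [e1, e2]
  have hind : ∀ n : ℕ, ContDiff ℝ (n + 2 : ℕ) W := by
    intro n
    induction n with
    | zero => exact_mod_cast hW2
    | succ n ih =>
      have hg : ContDiff ℝ (n + 2 : ℕ) (fun z => 4 * lam * (1 - Real.exp (W z)) / NN (L z) ^ 2) := by
        have hN : ContDiff ℝ (n + 2 : ℕ) (fun z => NN (L z)) :=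
          contDiff_infty.1 (NN_smooth.comp L.contDiff) _
        refine ContDiff.div (contDiff_const.mul (contDiff_const.sub ih.exp)) (hN.pow 2) ?_
        intro z
        exact pow_ne_zero _ (NN_pos _).ne'
      have := reg_step (by omega) ih hg hWe
      rw [show n + 1 + 2 = n + 2 + 1 by ring]
      exact this
  have hWi : ContDiff ℝ ∞ W := by
    rw [contDiff_infty]
    intro n
    exact (hind n).of_le (by exact_mod_cast (by omega))
  have e : w = fun y => W (Complex.equivRealProdCLM.symm y) := by
    funext y
    simp [hWdef, hL]
  rw [e]
  exact hWi.comp Complex.equivRealProdCLM.symm.contDiff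

/-- stereographic coordinates -/
def psi (a : ONB) (z : E3) : ℝ × ℝ :=
  (inner ℝ (a 0) z / (‖z‖ + inner ℝ (a 2) z), inner ℝ (a 1) z / (‖z‖ + inner ℝ (a 2) z))

theorem ch_psi (a : ONB) {z : E3} (hz : 0 < ‖z‖ + inner ℝ (a 2) z) :
    ch a (psi a z) = (2 / (‖z‖ + inner ℝ (a 2) z)) • z := by
  have e := onb_expand a z
  have n := onb_normsq a z
  unfold ch psi
  simp only
  set z0 : ℝ := inner ℝ (a 0) z
  set z1 : ℝ := inner ℝ (a 1) z
  set z2 : ℝ := inner ℝ (a 2) z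
  set N := ‖z‖ + z2 with hN
  have h1 : 1 - (z0 / N) ^ 2 - (z1 / N) ^ 2 = 2 / N * z2 := by
    field_simp
    rw [hN]
    linear_combination n
  rw [h1]
  conv_rhs => rw [e]
  rw [smul_add, smul_add, smul_smul, smul_smul, smul_smul]
  congr 3 <;> ring_nf

theorem psi_smooth (a : ONB) {z : E3} (h0 : z ≠ 0) (hz : 0 < ‖z‖ + inner ℝ (a 2) z) :
    ContDiffAt ℝ ∞ (psi a) z := by
  have hn : ContDiffAt ℝ ∞ (fun z : E3 => ‖z‖) z := contDiffAt_norm ℝ h0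
  have hi : ∀ i, ContDiffAt ℝ ∞ (fun z : E3 => (inner ℝ (a i) z : ℝ)) z := fun i =>
    contDiffAt_const.inner ℝ contDiffAt_id
  exact ((hi 0).div (hn.add (hi 2)) hz.ne').prodMk ((hi 1).div (hn.add (hi 2)) hz.ne')

theorem chart_smooth_back {U : E3 → ℝ} (hom : ∀ t : ℝ, 0 < t → ∀ x, U (t • x) = U x) (a : ONB)
    (hs : ContDiff ℝ ∞ (fun y => U (ch a y))) {z : E3} (h0 : z ≠ 0)
    (hz : 0 < ‖z‖ + inner ℝ (a 2) z) : ContDiffAt ℝ ∞ U z := by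
  have h1 : ContDiffAt ℝ ∞ (fun x => U (ch a (psi a x))) z :=
    ContDiffAt.comp (g := fun y => U (ch a y)) z hs.contDiffAt (psi_smooth a h0 hz)
  refine h1.congr_of_eventuallyEq ?_
  have hc : Continuous (fun x : E3 => ‖x‖ + inner ℝ (a 2) x) := by fun_prop
  filter_upwards [(isOpen_lt continuous_const hc).mem_nhds hz] with x hx
  have hx' : 0 < ‖x‖ + inner ℝ (a 2) x := hx
  rw [ch_psi a hx', hom _ (by positivity)]

theorem chart_pde_back {U : E3 → ℝ} {lam : ℝ} (h : Hom0 U) (a : ONB)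
    (he : ∀ y, D2 (fun y => U (ch a y)) y (1, 0) (1, 0) + D2 (fun y => U (ch a y)) y (0, 1) (0, 1)
      = 4 * lam * (1 - Real.exp (U (ch a y))) / NN y ^ 2) {z : E3} (h0 : z ≠ 0)
    (hz : 0 < ‖z‖ + inner ℝ (a 2) z) : lap3 U z = lam * (1 - Real.exp (U z)) / ‖z‖ ^ 2 := by
  have h1 := he (psi a z)
  rw [chart_lap h a, ← ch_norm a, ch_psi a hz] at h1
  set c := 2 / (‖z‖ + inner ℝ (a 2) z) with hc
  have hcp : 0 < c := by positivity
  rw [h.hom c hcp, norm_smul, Real.norm_of_nonneg hcp.le] at h1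
  have h2 : lap3 U (c • z) = c⁻¹ ^ 2 * lap3 U z := by
    unfold lap3
    rw [Finset.mul_sum]
    exact Finset.sum_congr rfl fun i _ => h.D2_smul hcp h0 _ _
  rw [h2] at h1
  have hzn : ‖z‖ ≠ 0 := norm_ne_zero_iff.2 h0
  field_simp at h1 ⊢
  linear_combination h1

theorem sol_of_charts {U : E3 → ℝ} {lam : ℝ} (hom : ∀ t : ℝ, 0 < t → ∀ x, U (t • x) = U x)
    (hev : ∀ x, U (-x) = U x) (a b : ONB) (hab : b 2 = - a 2)
    (ha : ContDiff ℝ 2 (fun y => U (ch a y))) (hb : ContDiff ℝ 2 (fun y => U (ch b y)))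
    (hea : ∀ y, D2 (fun y => U (ch a y)) y (1, 0) (1, 0) + D2 (fun y => U (ch a y)) y (0, 1) (0, 1)
      = 4 * lam * (1 - Real.exp (U (ch a y))) / NN y ^ 2)
    (heb : ∀ y, D2 (fun y => U (ch b y)) y (1, 0) (1, 0) + D2 (fun y => U (ch b y)) y (0, 1) (0, 1)
      = 4 * lam * (1 - Real.exp (U (ch b y))) / NN y ^ 2) : Sol lam U := by
  have hcase : ∀ z : E3, z ≠ 0 → 0 < ‖z‖ + inner ℝ (a 2) z ∨ 0 < ‖z‖ + inner ℝ (b 2) z := by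
    intro z hz
    have := norm_pos_iff.2 hz
    rw [hab, inner_neg_left]
    by_contra hc
    push Not at hc
    linarith [hc.1, hc.2]
  have hH : Hom0 U := by
    refine ⟨?_, hom⟩
    intro z hz
    apply ContDiffAt.contDiffWithinAt
    rcases hcase z hz with h | h
    · exact chart_smooth_back hom a (reg_smooth ha hea) hz h
    · exact chart_smooth_back hom b (reg_smooth hb heb) hz h
  refine ⟨hH, hev, fun z hz => ?_⟩
  rcases hcase z hz with h | h
  · exact chart_pde_back hH a hea hz h
  · exact chart_pde_back hH b heb hz h

end MF

namespace MF
open scoped ContDiff Topology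
open Filter

/-- `Fin 3 → ℝ` vectors as points of the Euclidean space -/
def ext (u : (Fin 3 → ℝ) → ℝ) (x : E3) : ℝ := u (fun i => x i / ‖x‖)

/-- the standard frame -/
def fS : ONB := EuclideanSpace.basisFun (Fin 3) ℝ
/-- the reflected standard frame -/
def fN : ONB := fS.map (rf (fS 2))

theorem fN0 : fN 0 = fS 0 := by
  unfold fN; rw [OrthonormalBasis.map_apply, rf_onb]; simp
theorem fN1 : fN 1 = fS 1 := by
  unfold fN; rw [OrthonormalBasis.map_apply, rf_onb]; simp
theorem fN2 : fN 2 = - fS 2 := by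
  unfold fN; rw [OrthonormalBasis.map_apply, rf_onb]; simp

theorem ext_chS (u : (Fin 3 → ℝ) → ℝ) : (fun y => ext u (ch fS y)) = fun y => u (stereoS y) := by
  funext y
  unfold ext
  congr 1
  rw [ch_norm]
  funext i
  fin_cases i <;> simp [ch, fS, stereoS, NN]

theorem ext_chN (u : (Fin 3 → ℝ) → ℝ) : (fun y => ext u (ch fN y)) = fun y => u (stereoN y) := by
  funext y
  unfold ext
  congr 1
  rw [ch_norm]
  funext i
  fin_cases i <;> simp [ch, fN0, fN1, fN2, fS, stereoN, NN]
  ring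

theorem lap_D2 (w : ℝ × ℝ → ℝ) (y : ℝ × ℝ) :
    lap w y = D2 w y (1, 0) (1, 0) + D2 w y (0, 1) (0, 1) := by
  simp [lap, iteratedFDeriv_two_apply, D2]

theorem nsq (x : E3) : ‖x‖ ^ 2 = x 0 ^ 2 + x 1 ^ 2 + x 2 ^ 2 := by
  rw [EuclideanSpace.norm_sq_eq]
  simp [Fin.sum_univ_three]

theorem ext_sol {lam : ℝ} {u : (Fin 3 → ℝ) → ℝ} (hu : IsMFSolution lam u)
    (heven : ∀ x ∈ sphere3, u (-x) = u x) : Sol lam (ext u) := by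
  obtain ⟨_, hN, hS, eN, eS⟩ := hu
  refine sol_of_charts ?_ ?_ fS fN fN2 ?_ ?_ ?_ ?_
  · intro t ht x
    unfold ext
    congr 1
    funext i
    rw [norm_smul, Real.norm_of_nonneg ht.le]
    simp only [PiLp.smul_apply, smul_eq_mul]
    rw [mul_div_mul_left _ _ ht.ne']
  · intro x
    unfold ext
    by_cases hx : x = 0
    · simp [hx]
    have hx' : ‖x‖ ≠ 0 := norm_ne_zero_iff.2 hx
    rw [← heven (fun i => x i / ‖x‖) (by
      have := nsq x
      simp only [sphere3, Set.mem_setOf_eq]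
      field_simp
      exact this.symm)]
    congr 1
    funext i
    simp [neg_div]
  · rw [ext_chS]; exact hS
  · rw [ext_chN]; exact hN
  · intro y
    have h := eS y
    rw [lap_D2] at h
    rw [ext_chS, h, ← congrFun (ext_chS u) y]
    rfl
  · intro y
    have h := eN y
    rw [lap_D2] at h
    rw [ext_chN, h, ← congrFun (ext_chN u) y]
    rfl

theorem ax_back {u : (Fin 3 → ℝ) → ℝ} (h : Ax (ext u)) : AxiallySymmetric u := by
  obtain ⟨e, he, hx⟩ := h
  have hn : ∀ x ∈ sphere3, ‖(WithLp.toLp 2 x : E3)‖ = 1 := by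
    intro x hx
    have h1 := nsq (WithLp.toLp 2 x)
    have h2 : x 0 ^ 2 + x 1 ^ 2 + x 2 ^ 2 = 1 := hx
    simp only at h1
    rw [h2] at h1
    nlinarith [norm_nonneg (WithLp.toLp 2 x : E3)]
  have hi : ∀ x : Fin 3 → ℝ, inner ℝ (WithLp.toLp 2 x : E3) e
      = x 0 * e 0 + x 1 * e 1 + x 2 * e 2 := by
    intro x
    rw [PiLp.inner_apply]
    simp [Fin.sum_univ_three]
    ring
  have hu : ∀ x ∈ sphere3, ext u (WithLp.toLp 2 x) = u x := by
    intro x hx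
    unfold ext
    rw [hn x hx]
    simp
  refine ⟨fun i => e i, ?_, ?_⟩
  · rw [← nsq, he]; norm_num
  · intro x hxs x' hxs' hh
    rw [← hu x hxs, ← hu x' hxs']
    refine hx _ _ (hn x hxs) (hn x' hxs') ?_
    rw [hi, hi]; exact hh

end MF

/-- For `2 < λ ≤ 8`, an even solution of the mean field equation
`Δu = λ(1 - e^u)` on `S²` is axially symmetric. -/
theorem even_solution_axially_symmetric (lam : ℝ) (hlam₁ : 2 < lam) (hlam₂ : lam ≤ 8)
    (u : (Fin 3 → ℝ) → ℝ) (hu : IsMFSolution lam u)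
    (heven : ∀ x ∈ sphere3, u (-x) = u x) :
    AxiallySymmetric u :=
  MF.ax_back (MF.sol_ax (MF.ext_sol hu heven) hlam₁ hlam₂)
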